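/- arXiv:1309.6414 — 2 statements merged into one kernel-verified Lean document; each statement's English description precedes it below -/
import Mathlib

section
/- Let d ≥ 1 and α ∈ (1,2). For every λ > 0 the function r_λ is continuously differentiable on ℝ^d \ {0}, and there is a constant c₁ > 1 depending only on d and α such that for every λ > 0 and every z ≠ 0, c₁^{−1} ( |z|^{−(d+1−α)} ∧ λ^{−2} |z|^{−(d+1+α)} ) ≤ |∇ r_λ(z)| ≤ c₁ ( |z|^{−(d+1−α)} ∧ λ^{−2} |z|^{−(d+1+α)} ), where a ∧ b := min{a,b}. -/
open MeasureTheory Filter Topology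
open scoped ENNReal RealInnerProductSpace

/-- `p(t,x) = (2π)^{-d} ∫ e^{-iξ·x} e^{-t|ξ|^α} dξ` (real part of the complex integral). -/
noncomputable def stableP (d : ℕ) (α : ℝ) (t : ℝ) (x : EuclideanSpace ℝ (Fin d)) : ℝ :=
  ((((2 * Real.pi) ^ (-(d : ℝ)) : ℝ) : ℂ) *
    ∫ ξ : EuclideanSpace ℝ (Fin d),
      Complex.exp (-Complex.I * ((⟪ξ, x⟫ : ℝ) : ℂ)) *
        Complex.exp (-(t : ℂ) * ((‖ξ‖ ^ α : ℝ) : ℂ))).re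

/-- The `λ`-resolvent kernel `r_λ(x) = ∫_0^∞ e^{-λt} p(t,x) dt`. -/
noncomputable def resKer (d : ℕ) (α : ℝ) (l : ℝ) (x : EuclideanSpace ℝ (Fin d)) : ℝ :=
  ∫ t in Set.Ioi (0 : ℝ), Real.exp (-(l * t)) * stableP d α t x


section Part1
open MeasureTheory Filter Topology Complex

lemma sr_denom_pos {β l : ℝ} (hβ0 : 0 < β) (hβ1 : β < 1) (hl : 0 < l) {z : ℂ} (hz : |z.im| ≤ Real.pi) :
    (l : ℂ) + Complex.exp (β * z) ≠ 0 := by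
  intro h
  have him := congrArg Complex.im h
  have hre := congrArg Complex.re h
  simp [Complex.exp_re, Complex.exp_im] at him hre
  have h1 : |β * z.im| < Real.pi := by
    rw [abs_mul, abs_of_pos hβ0]
    nlinarith [abs_nonneg z.im, Real.pi_pos]
  rw [abs_lt] at h1
  have h2 : β * z.im = 0 := by
    rcases lt_trichotomy (β * z.im) 0 with h3 | h3 | h3
    · exact absurd him (Real.sin_neg_of_neg_of_neg_pi_lt h3 h1.1).ne
    · exact h3
    · exact absurd him (Real.sin_pos_of_pos_of_lt_pi h3 h1.2).ne'
  rw [h2] at hre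
  simp at hre
  have := Real.exp_pos (β * z.re)
  linarith

lemma sr_H_diff {β l w : ℝ} (hβ0 : 0 < β) (hβ1 : β < 1) (hl : 0 < l) :
    DifferentiableOn ℂ (fun z : ℂ => dslope (fun z : ℂ => ((l : ℂ) + Complex.exp (β * z))⁻¹) (w : ℂ) z /
      dslope (fun z : ℂ => - Complex.exp (w - z)) (w : ℂ) z) {z : ℂ | |z.im| ≤ Real.pi} := by
  have hs : {z : ℂ | |z.im| ≤ Real.pi} ∈ 𝓝 (w : ℂ) := by
    have : {z : ℂ | |z.im| < Real.pi} ∈ 𝓝 (w : ℂ) := by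
      apply IsOpen.mem_nhds
      · exact isOpen_lt (by fun_prop) (by fun_prop)
      · simp [Real.pi_pos]
    filter_upwards [this] with z hz using le_of_lt hz
  apply DifferentiableOn.div
  · rw [Complex.differentiableOn_dslope hs]
    intro z hz
    apply DifferentiableAt.differentiableWithinAt
    apply DifferentiableAt.inv (by fun_prop)
    exact sr_denom_pos hβ0 hβ1 hl hz
  · rw [Complex.differentiableOn_dslope hs]
    fun_prop
  · intro z hz
    by_cases h : z = w
    · subst h
      rw [dslope_same]
      have : HasDerivAt (fun z : ℂ => - Complex.exp (w - z)) (-(Complex.exp ((w:ℂ) - w) * (0 - 1))) (w : ℂ) :=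
        (((hasDerivAt_const _ _).sub (hasDerivAt_id _)).cexp).neg
      rw [this.deriv]; simp
    · rw [dslope_of_ne _ h, slope_def_field]
      have h1 : z - w ≠ 0 := sub_ne_zero.2 h
      apply div_ne_zero _ h1
      simp only [sub_self, Complex.exp_zero]
      intro h2
      have h3 : Complex.exp (w - z) = 1 := by linear_combination -h2
      rw [Complex.exp_eq_one_iff] at h3
      obtain ⟨n, hn⟩ := h3
      have him := congrArg Complex.im hn
      simp at him
      have hz' : |z.im| ≤ Real.pi := hz
      rw [abs_le] at hz'
      have hn0 : n = 0 := by
        have hp := Real.pi_pos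
        have h4 : (n:ℝ) < 1 := by nlinarith
        have h5 : (-1:ℝ) < n := by nlinarith
        have h4' : n < 1 := by exact_mod_cast h4
        have h5' : -1 < n := by exact_mod_cast h5
        omega
      rw [hn0] at hn
      simp at hn
      exact h1 (by linear_combination -hn)

lemma sr_H_eq {β l w : ℝ} {z : ℂ} (h : z ≠ w) :
    dslope (fun z : ℂ => ((l : ℂ) + Complex.exp (β * z))⁻¹) (w : ℂ) z /
      dslope (fun z : ℂ => - Complex.exp (w - z)) (w : ℂ) z =
    (((l : ℂ) + Complex.exp (β * z))⁻¹ - ((l : ℂ) + Complex.exp (β * w))⁻¹) / (1 - Complex.exp (w - z)) := by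
  rw [dslope_of_ne _ h, dslope_of_ne _ h, slope_def_field, slope_def_field]
  have h1 : z - w ≠ 0 := sub_ne_zero.2 h
  rw [div_div_div_cancel_right₀ h1]
  simp
  ring_nf

noncomputable def mK (β l s : ℝ) : ℝ :=
  Real.sin (Real.pi * β) / Real.pi * s ^ β / (l ^ 2 + 2 * l * s ^ β * Real.cos (Real.pi * β) + (s ^ β) ^ 2)

/-- horizontal difference -/
lemma sr_horiz {β l w y : ℝ} (hβ0 : 0 < β) (hβ1 : β < 1) (hl : 0 < l) :
    (((l : ℂ) + Complex.exp (β * (y + ((-Real.pi : ℝ) : ℂ) * I)))⁻¹ - ((l : ℂ) + Complex.exp (β * w))⁻¹) / (1 - Complex.exp (w - (y + ((-Real.pi : ℝ) : ℂ) * I)))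
    - (((l : ℂ) + Complex.exp (β * (y + (Real.pi : ℂ) * I)))⁻¹ - ((l : ℂ) + Complex.exp (β * w))⁻¹) / (1 - Complex.exp (w - (y + (Real.pi : ℂ) * I)))
    = 2 * Real.pi * I * ((mK β l (Real.exp y) * (Real.exp y / (Real.exp y + Real.exp w)) : ℝ) : ℂ) := by
  have e1 : Complex.exp (w - (y + ((-Real.pi : ℝ) : ℂ) * I)) = - Complex.exp (w - y) := by
    rw [show (w - (y + ((-Real.pi : ℝ) : ℂ) * I)) = (w - y : ℂ) + Real.pi * I by push_cast; ring, Complex.exp_add, Complex.exp_pi_mul_I]; ring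
  have e2 : Complex.exp (w - (y + (Real.pi : ℂ) * I)) = - Complex.exp (w - y) := by
    rw [show (w - (y + (Real.pi : ℂ) * I)) = (w - y : ℂ) - Real.pi * I by ring, Complex.exp_sub, Complex.exp_pi_mul_I]; ring
  rw [e1, e2, ← sub_div]
  have d1 : (l : ℂ) + Complex.exp (β * (y + ((-Real.pi : ℝ) : ℂ) * I)) ≠ 0 :=
    sr_denom_pos hβ0 hβ1 hl (by simp [abs_of_pos Real.pi_pos])
  have d2 : (l : ℂ) + Complex.exp (β * (y + (Real.pi : ℂ) * I)) ≠ 0 :=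
    sr_denom_pos hβ0 hβ1 hl (by simp [abs_of_pos Real.pi_pos])
  have f1 : Complex.exp (β * (y + ((-Real.pi : ℝ) : ℂ) * I)) = ((Real.exp y ^ β : ℝ) : ℂ) * (Real.cos (Real.pi * β) - Real.sin (Real.pi * β) * I) := by
    rw [show (β * (y + ((-Real.pi : ℝ) : ℂ) * I)) = ((y * β : ℝ) : ℂ) + ((-(Real.pi * β) : ℝ) : ℂ) * I by push_cast; ring,
      Complex.exp_add, Complex.exp_mul_I, ← Complex.ofReal_cos, ← Complex.ofReal_sin, Real.cos_neg, Real.sin_neg, ← Complex.ofReal_exp, Real.exp_mul]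
    push_cast; ring
  have f2 : Complex.exp (β * (y + (Real.pi : ℂ) * I)) = ((Real.exp y ^ β : ℝ) : ℂ) * (Real.cos (Real.pi * β) + Real.sin (Real.pi * β) * I) := by
    rw [show (β * (y + ((Real.pi : ℝ) : ℂ) * I)) = ((y * β : ℝ) : ℂ) + (((Real.pi * β) : ℝ) : ℂ) * I by push_cast; ring,
      Complex.exp_add, Complex.exp_mul_I, ← Complex.ofReal_cos, ← Complex.ofReal_sin, ← Complex.ofReal_exp, Real.exp_mul]
  rw [f1] at d1 ⊢
  rw [f2] at d2 ⊢
  have hI : I ^ 2 = -1 := Complex.I_sq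
  have hsc : (Real.sin (Real.pi * β) : ℂ)^2 + (Real.cos (Real.pi * β) : ℂ)^2 = 1 := by
    exact_mod_cast Real.sin_sq_add_cos_sq (Real.pi * β)
  have hprod : ((l : ℂ) + ((Real.exp y ^ β : ℝ) : ℂ) * (Real.cos (Real.pi * β) - Real.sin (Real.pi * β) * I)) *
     ((l : ℂ) + ((Real.exp y ^ β : ℝ) : ℂ) * (Real.cos (Real.pi * β) + Real.sin (Real.pi * β) * I))
     = ((l ^ 2 + 2 * l * (Real.exp y) ^ β * Real.cos (Real.pi * β) + ((Real.exp y) ^ β) ^ 2 : ℝ) : ℂ) := by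
    simp only [Complex.ofReal_add, Complex.ofReal_mul, Complex.ofReal_pow, Complex.ofReal_ofNat]
    linear_combination (-(((Real.exp y ^ β : ℝ) : ℂ)^2 * (Real.sin (Real.pi * β) : ℂ)^2)) * hI + (((Real.exp y ^ β : ℝ) : ℂ)^2) * hsc
  have e3 : (1 - -Complex.exp (w - y)) = (((Real.exp y + Real.exp w) / Real.exp y : ℝ) : ℂ) := by
    rw [Complex.exp_sub]
    push_cast
    have := Complex.exp_ne_zero (y : ℂ)
    field_simp
    ring
  have e4 : ∀ A B C : ℂ, A ≠ 0 → B ≠ 0 → (A⁻¹ - C - (B⁻¹ - C)) = (B - A) / (A * B) := by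
    intro A B C hA hB; field_simp; ring
  rw [e4 _ _ _ d1 d2, hprod, e3]
  unfold mK
  have hpi : (Real.pi : ℂ) ≠ 0 := by exact_mod_cast Real.pi_ne_zero
  have hD : ((l ^ 2 + 2 * l * (Real.exp y) ^ β * Real.cos (Real.pi * β) + ((Real.exp y) ^ β) ^ 2 : ℝ) : ℂ) ≠ 0 := by
    rw [← hprod]; exact mul_ne_zero d1 d2
  have hE : ((Real.exp y + Real.exp w : ℝ) : ℂ) ≠ 0 := by
    have := Real.exp_pos y
    have := Real.exp_pos w
    exact_mod_cast (by positivity)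
  have hy : ((Real.exp y : ℝ) : ℂ) ≠ 0 := by exact_mod_cast (Real.exp_pos y).ne'
  rw [Complex.ofReal_mul, Complex.ofReal_div, Complex.ofReal_div, Complex.ofReal_div, Complex.ofReal_mul, Complex.ofReal_div]
  generalize ((l ^ 2 + 2 * l * (Real.exp y) ^ β * Real.cos (Real.pi * β) + ((Real.exp y) ^ β) ^ 2 : ℝ) : ℂ) = D at *
  generalize ((Real.exp y + Real.exp w : ℝ) : ℂ) = E at *
  generalize ((Real.exp y : ℝ) : ℂ) = Y at *
  field_simp
  ring

lemma sr_mK_denom {β l a c : ℝ} (hl : 0 < l) (ha : 0 < a) (hc : c = Real.cos (Real.pi * β)) (hβ0 : 0 < β) (hβ1 : β < 1) :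
    0 < l ^ 2 + 2 * l * a * c + a ^ 2 := by
  have h1 : -1 < c := by
    rw [hc, ← Real.cos_pi]
    apply Real.cos_lt_cos_of_nonneg_of_le_pi <;> nlinarith [Real.pi_pos]
  nlinarith [sq_nonneg (l - a), mul_pos hl ha]

lemma sr_sin_pos {β : ℝ} (hβ0 : 0 < β) (hβ1 : β < 1) : 0 < Real.sin (Real.pi * β) := by
  apply Real.sin_pos_of_pos_of_lt_pi <;> nlinarith [Real.pi_pos]

lemma sr_mK_pos {β l s : ℝ} (hβ0 : 0 < β) (hβ1 : β < 1) (hl : 0 < l) (hs : 0 < s) : 0 < mK β l s := by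
  unfold mK
  have h1 := sr_mK_denom (β := β) hl (Real.rpow_pos_of_pos hs β) rfl hβ0 hβ1
  have h2 := sr_sin_pos hβ0 hβ1
  have := Real.rpow_pos_of_pos hs β
  have := Real.pi_pos
  positivity

lemma sr_mK_contOn {β l : ℝ} (hβ0 : 0 < β) (hβ1 : β < 1) (hl : 0 < l) : ContinuousOn (mK β l) (Set.Ioi 0) := by
  intro s hs
  have hs : 0 < s := hs
  have h1 := sr_mK_denom (β := β) hl (Real.rpow_pos_of_pos hs β) rfl hβ0 hβ1
  have h2 : ContinuousAt (fun s : ℝ => s ^ β) s := Real.continuousAt_rpow_const _ _ (Or.inl hs.ne')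
  unfold mK
  apply ContinuousAt.continuousWithinAt
  apply ContinuousAt.div
  · exact continuousAt_const.mul h2
  · exact (continuousAt_const.add ((continuousAt_const.mul h2).mul continuousAt_const)).add (h2.pow 2)
  · exact h1.ne'

lemma sr_right_lim {β l w : ℝ} (hβ0 : 0 < β) (hβ1 : β < 1) (hl : 0 < l) :
    Tendsto (fun T : ℝ => ∫ y in (-Real.pi)..Real.pi, 
      (((l : ℂ) + Complex.exp (β * ((T:ℂ) + y * I)))⁻¹ - ((l : ℂ) + Complex.exp (β * w))⁻¹) / (1 - Complex.exp (w - ((T:ℂ) + y * I))))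
      atTop (𝓝 (∫ y in (-Real.pi)..Real.pi, -((l : ℂ) + Complex.exp (β * w))⁻¹)) := by
  have hA : ∀ y : ℝ, Tendsto (fun T : ℝ => Complex.exp (β * ((T:ℂ) + y * I))) atTop (Bornology.cobounded ℂ) := by
    intro y
    rw [← tendsto_norm_atTop_iff_cobounded]
    simp only [Complex.norm_exp]
    simp
    exact tendsto_id.const_mul_atTop hβ0
  have hsub : Tendsto (fun T : ℝ => w - T) atTop atBot := by
    simpa only [sub_eq_add_neg] using (tendsto_atBot_add_const_left atTop w (tendsto_neg_atTop_atBot (G := ℝ)))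
  have hB : ∀ y : ℝ, Tendsto (fun T : ℝ => Complex.exp (w - ((T:ℂ) + y * I))) atTop (𝓝 0) := by
    intro y
    rw [tendsto_zero_iff_norm_tendsto_zero]
    simp only [Complex.norm_exp]
    simp
    exact hsub
  apply intervalIntegral.tendsto_integral_filter_of_dominated_convergence (fun _ => (1 + ‖((l : ℂ) + Complex.exp (β * w))⁻¹‖) / (1/2))
  · filter_upwards with T
    apply Measurable.aestronglyMeasurable
    fun_prop
  · have e1 : ∀ᶠ T : ℝ in atTop, l + 1 ≤ Real.exp (β * T) := 
      ((Real.tendsto_exp_atTop.comp (tendsto_id.const_mul_atTop hβ0)).eventually_ge_atTop (l + 1))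
    have e2 : ∀ᶠ T : ℝ in atTop, Real.exp (w - T) ≤ 1/2 := by
      have : Tendsto (fun T : ℝ => Real.exp (w - T)) atTop (𝓝 0) := by
        apply Real.tendsto_exp_atBot.comp
        exact hsub
      exact (this.eventually_lt_const (by norm_num)).mono fun _ h => h.le
    filter_upwards [e1, e2] with T h1 h2
    filter_upwards with y hy
    rw [norm_div]
    have n1 : ‖Complex.exp (β * ((T:ℂ) + y * I))‖ = Real.exp (β * T) := by
      simp [Complex.norm_exp]
    have n2 : ‖Complex.exp (w - ((T:ℂ) + y * I))‖ = Real.exp (w - T) := by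
      simp [Complex.norm_exp]
    have n3 : 1 ≤ ‖(l : ℂ) + Complex.exp (β * ((T:ℂ) + y * I))‖ := by
      have := norm_sub_le ((l : ℂ) + Complex.exp (β * ((T:ℂ) + y * I))) (l : ℂ)
      rw [add_sub_cancel_left, n1, Complex.norm_real, Real.norm_eq_abs, abs_of_pos hl] at this
      linarith
    have n4 : 1/2 ≤ ‖1 - Complex.exp (w - ((T:ℂ) + y * I))‖ := by
      have := norm_sub_norm_le (1:ℂ) (Complex.exp (w - ((T:ℂ) + y * I)))
      rw [n2] at this
      simp only [norm_one] at this
      linarith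
    gcongr
    apply (norm_sub_le _ _).trans
    gcongr
    rw [norm_inv]
    exact inv_le_one_of_one_le₀ n3
  · simp
  · filter_upwards with y hy
    have h1 := (tendsto_inv₀_cobounded.comp ((tendsto_const_add_cobounded (l:ℂ)).comp (hA y)))
    have h2 := (h1.sub_const ((l : ℂ) + Complex.exp (β * w))⁻¹).div ((hB y).const_sub 1) (by simp)
    simpa [Pi.div_def] using h2

lemma sr_left_lim {β l w : ℝ} (hβ0 : 0 < β) (hl : 0 < l) :
    Tendsto (fun T : ℝ => ∫ y in (-Real.pi)..Real.pi, 
      (((l : ℂ) + Complex.exp (β * (((-T : ℝ):ℂ) + y * I)))⁻¹ - ((l : ℂ) + Complex.exp (β * w))⁻¹) / (1 - Complex.exp (w - (((-T : ℝ):ℂ) + y * I))))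
      atTop (𝓝 0) := by
  have hlim : Tendsto (fun T : ℝ => (∫ y in (-Real.pi)..Real.pi, (2 / l + ‖((l : ℂ) + Complex.exp (β * w))⁻¹‖) / (Real.exp (w + T) - 1))) atTop (𝓝 0) := by
    simp only [intervalIntegral.integral_const]
    have h3 : Tendsto (fun T : ℝ => Real.exp (w + T) - 1) atTop atTop := by
      apply tendsto_atTop_add_const_right
      apply Real.tendsto_exp_atTop.comp
      exact tendsto_atTop_add_const_left _ _ tendsto_id
    have := (h3.const_div_atTop (2 / l + ‖((l : ℂ) + Complex.exp (β * w))⁻¹‖)).const_smul (Real.pi - -Real.pi)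
    simpa using this
  apply squeeze_zero_norm' _ hlim
  have e1 : ∀ᶠ T : ℝ in atTop, Real.exp (β * (-T)) ≤ l / 2 := by
    have : Tendsto (fun T : ℝ => Real.exp (β * (-T))) atTop (𝓝 0) := by
      apply Real.tendsto_exp_atBot.comp
      exact (tendsto_neg_atTop_atBot (G := ℝ)).const_mul_atBot hβ0
    exact (this.eventually_lt_const (by positivity)).mono fun _ h => h.le
  have e2 : ∀ᶠ T : ℝ in atTop, 2 ≤ Real.exp (w + T) := 
    (Real.tendsto_exp_atTop.comp (tendsto_atTop_add_const_left _ _ tendsto_id)).eventually_ge_atTop 2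
  filter_upwards [e1, e2] with T h1 h2
  apply intervalIntegral.norm_integral_le_of_norm_le (by linarith [Real.pi_pos])
  · filter_upwards with y hy
    rw [norm_div]
    have n1 : ‖Complex.exp (β * (((-T : ℝ):ℂ) + y * I))‖ = Real.exp (β * (-T)) := by
      simp [Complex.norm_exp]
    have n2 : ‖Complex.exp (w - (((-T : ℝ):ℂ) + y * I))‖ = Real.exp (w + T) := by
      simp [Complex.norm_exp]
    have n3 : l / 2 ≤ ‖(l : ℂ) + Complex.exp (β * (((-T : ℝ):ℂ) + y * I))‖ := by
      have := norm_sub_le ((l : ℂ) + Complex.exp (β * (((-T : ℝ):ℂ) + y * I))) (Complex.exp (β * (((-T : ℝ):ℂ) + y * I)))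
      rw [add_sub_cancel_right, n1, Complex.norm_real, Real.norm_eq_abs, abs_of_pos hl] at this
      linarith
    have n4 : Real.exp (w + T) - 1 ≤ ‖1 - Complex.exp (w - (((-T : ℝ):ℂ) + y * I))‖ := by
      have := norm_sub_norm_le (Complex.exp (w - (((-T : ℝ):ℂ) + y * I))) (1:ℂ)
      rw [n2, norm_sub_rev] at this
      simpa only [norm_one] using this
    have : 0 < Real.exp (w + T) - 1 := by linarith
    gcongr
    apply (norm_sub_le _ _).trans
    gcongr
    rw [norm_inv, show 2 / l = (l / 2)⁻¹ by simp]
    gcongr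
  · simp

lemma sr_lim {β l w : ℝ} (hβ0 : 0 < β) (hβ1 : β < 1) (hl : 0 < l) :
    Tendsto (fun T : ℝ => ∫ y in (-T)..T, mK β l (Real.exp y) * (Real.exp y / (Real.exp y + Real.exp w)))
      atTop (𝓝 ((l + Real.exp (β * w))⁻¹)) := by
  set H := (fun z : ℂ => dslope (fun z : ℂ => ((l : ℂ) + Complex.exp (β * z))⁻¹) (w : ℂ) z /
      dslope (fun z : ℂ => - Complex.exp (w - z)) (w : ℂ) z) with hH
  have hd : DifferentiableOn ℂ H _ := sr_H_diff (w := w) hβ0 hβ1 hl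
  have hp := Real.pi_pos
  have hid : ∀ T : ℝ, (∫ y in (-T)..T, H (y + ((-Real.pi : ℝ):ℂ) * I)) - (∫ y in (-T)..T, H (y + (Real.pi:ℂ) * I))
      + I * (∫ y in (-Real.pi)..Real.pi, H ((T:ℂ) + y * I)) - I * (∫ y in (-Real.pi)..Real.pi, H (((-T:ℝ):ℂ) + y * I)) = 0 := by
    intro T
    have := Complex.integral_boundary_rect_eq_zero_of_differentiableOn H ⟨-T, -Real.pi⟩ ⟨T, Real.pi⟩ (by
      apply hd.mono
      intro z hz
      have := hz.2
      simp only [Set.mem_preimage] at this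
      rw [Set.uIcc_of_le (by linarith)] at this
      exact abs_le.2 this)
    simpa only [smul_eq_mul] using this
  have hcont : ∀ a : ℝ, |a| ≤ Real.pi → Continuous (fun y : ℝ => H (y + (a:ℂ) * I)) := by
    intro a ha
    apply ContinuousOn.comp_continuous hd.continuousOn (by fun_prop)
    intro y
    simp [ha]
  have hhor : ∀ T : ℝ, (∫ y in (-T)..T, H (y + ((-Real.pi : ℝ):ℂ) * I)) - (∫ y in (-T)..T, H (y + (Real.pi:ℂ) * I))
      = 2 * Real.pi * I * ((∫ y in (-T)..T, mK β l (Real.exp y) * (Real.exp y / (Real.exp y + Real.exp w)) : ℝ) : ℂ) := by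
    intro T
    rw [← intervalIntegral.integral_sub]
    · rw [← intervalIntegral.integral_ofReal, ← intervalIntegral.integral_const_mul]
      congr 1
      ext y
      rw [← sr_horiz hβ0 hβ1 hl, hH]
      simp only
      rw [sr_H_eq, sr_H_eq]
      · intro h
        have := congrArg Complex.im h
        simp at this
      · intro h
        have := congrArg Complex.im h
        simp at this
    · exact (hcont _ (by simp [abs_of_pos hp])).intervalIntegrable _ _
    · exact (hcont _ (by simp [abs_of_pos hp])).intervalIntegrable _ _
  have hR := sr_right_lim (w := w) hβ0 hβ1 hl
  have hL := sr_left_lim (β := β) (w := w) hβ0 hl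
  have hlim := ((hL.const_mul I).sub (hR.const_mul I)).div_const (2 * Real.pi * I)
  have hpi : (Real.pi : ℂ) ≠ 0 := by exact_mod_cast Real.pi_ne_zero
  have hlim2 : Tendsto (fun T : ℝ => ((∫ y in (-T)..T, mK β l (Real.exp y) * (Real.exp y / (Real.exp y + Real.exp w)) : ℝ) : ℂ)) atTop
     (𝓝 (((l + Real.exp (β * w))⁻¹ : ℝ) : ℂ)) := by
    refine Tendsto.congr' ?_ (hlim.trans_eq ?_)
    · filter_upwards [eventually_gt_atTop |w|] with T hT
      have h1 := hid T
      rw [hhor T] at h1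
      rw [abs_lt] at hT
      have hA : ∀ y : ℝ, H ((T:ℂ) + y * I) = (((l : ℂ) + Complex.exp (β * ((T:ℂ) + y * I)))⁻¹ - ((l : ℂ) + Complex.exp (β * w))⁻¹) / (1 - Complex.exp (w - ((T:ℂ) + y * I))) := by
        intro y
        apply sr_H_eq
        intro h
        have := congrArg Complex.re h
        simp at this
        linarith
      have hB : ∀ y : ℝ, H (((-T : ℝ):ℂ) + y * I) = (((l : ℂ) + Complex.exp (β * (((-T : ℝ):ℂ) + y * I)))⁻¹ - ((l : ℂ) + Complex.exp (β * w))⁻¹) / (1 - Complex.exp (w - (((-T : ℝ):ℂ) + y * I))) := by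
        intro y
        apply sr_H_eq
        intro h
        have := congrArg Complex.re h
        simp at this
        linarith
      simp only [hA, hB] at h1
      rw [div_eq_iff (by simp [hpi])]
      linear_combination -h1
    · congr 1
      rw [intervalIntegral.integral_const]
      simp only [Complex.real_smul]
      push_cast
      field_simp
      ring
  have := (Complex.continuous_re.tendsto _).comp hlim2
  simpa only [Function.comp_def, Complex.ofReal_re] using this

lemma sr_stieltjes {β l v : ℝ} (hβ0 : 0 < β) (hβ1 : β < 1) (hl : 0 < l) (hv : 0 < v) :
    IntegrableOn (fun s => mK β l s / (s + v)) (Set.Ioi 0) ∧ ∫ s in Set.Ioi 0, mK β l s / (s + v) = (l + v ^ β)⁻¹ := by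
  have hlim := sr_lim (w := Real.log v) hβ0 hβ1 hl
  rw [Real.exp_log hv, mul_comm β, Real.exp_mul, Real.exp_log hv] at hlim
  have hc : Continuous (fun y => mK β l (Real.exp y) * (Real.exp y / (Real.exp y + v))) := by
    apply Continuous.mul
    · exact (sr_mK_contOn hβ0 hβ1 hl).comp_continuous Real.continuous_exp (fun y => Real.exp_pos y)
    · apply Continuous.div (by fun_prop) (by fun_prop)
      intro y
      have := Real.exp_pos y
      positivity
  have hnn : ∀ y, 0 ≤ mK β l (Real.exp y) * (Real.exp y / (Real.exp y + v)) := by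
    intro y
    have := sr_mK_pos hβ0 hβ1 hl (Real.exp_pos y)
    positivity
  have hint : Integrable (fun y => mK β l (Real.exp y) * (Real.exp y / (Real.exp y + v))) := by
    apply integrable_of_intervalIntegral_norm_tendsto (l := atTop) (a := fun T : ℝ => -T) (b := fun T => T) ((l + v ^ β)⁻¹)
    · intro T
      exact (hc.integrableOn_Icc).mono_set Set.Ioc_subset_Icc_self
    · exact tendsto_neg_atTop_atBot
    · exact tendsto_id
    · simp only [Real.norm_eq_abs, abs_of_nonneg (hnn _)]
      exact hlim
  have hval := tendsto_nhds_unique (intervalIntegral_tendsto_integral hint tendsto_neg_atTop_atBot tendsto_id) hlim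
  have himg : Real.exp '' Set.univ = Set.Ioi 0 := by simp [Real.range_exp]
  have hder : ∀ x ∈ (Set.univ : Set ℝ), HasDerivWithinAt Real.exp (Real.exp x) Set.univ x := fun x _ => (Real.hasDerivAt_exp x).hasDerivWithinAt
  have hinj : Set.InjOn Real.exp Set.univ := Real.exp_injective.injOn
  have hcong : (fun x => |Real.exp x| • (mK β l (Real.exp x) / (Real.exp x + v))) = (fun y => mK β l (Real.exp y) * (Real.exp y / (Real.exp y + v))) := by
    ext y
    rw [abs_of_pos (Real.exp_pos y), smul_eq_mul]; ring
  constructor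
  · rw [← himg, integrableOn_image_iff_integrableOn_abs_deriv_smul MeasurableSet.univ hder hinj, hcong, integrableOn_univ]
    exact hint
  · rw [← himg, integral_image_eq_integral_abs_deriv_smul MeasurableSet.univ hder hinj, hcong, setIntegral_univ]
    exact hval

end Part1

section Part2
open MeasureTheory Filter Topology

lemma sr_gamma {a r : ℝ} (ha : 0 < a) (hr : 0 < r) :
    IntegrableOn (fun t : ℝ => t ^ (a - 1) * Real.exp (-(r * t))) (Set.Ioi 0) ∧
    ∫ t in Set.Ioi (0:ℝ), t ^ (a - 1) * Real.exp (-(r * t)) = (1 / r) ^ a * Real.Gamma a := by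
  refine ⟨?_, Real.integral_rpow_mul_exp_neg_mul_Ioi ha hr⟩
  have := integrableOn_rpow_mul_exp_neg_mul_rpow (p := 1) (s := a - 1) (by linarith) one_pos hr
  simpa using this

lemma sr_lower {f : ℝ → ℝ} {a c : ℝ} (ha : 0 < a) (hf : ∀ x, 0 < x → 0 ≤ f x) (hi : IntegrableOn f (Set.Ioi 0))
    (hc : ∀ x, a ≤ x → x ≤ 2 * a → c ≤ f x) : a * c ≤ ∫ x in Set.Ioi 0, f x := by
  have hsub : Set.Ioc a (2 * a) ⊆ Set.Ioi 0 := fun x hx => lt_trans ha hx.1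
  calc a * c = ∫ x in Set.Ioc a (2 * a), c := by
        simp only [integral_const, smul_eq_mul, measureReal_restrict_apply_univ, Real.volume_real_Ioc]
        rw [max_eq_left (by linarith)]; ring
    _ ≤ ∫ x in Set.Ioc a (2 * a), f x := by
        apply setIntegral_mono_on (by simp) (hi.mono_set hsub) measurableSet_Ioc
        intro x hx
        exact hc x hx.1.le hx.2
    _ ≤ _ := by
        apply setIntegral_mono_set hi _ (Eventually.of_forall hsub)
        filter_upwards [ae_restrict_mem measurableSet_Ioi] with x hx using hf x hx

lemma sr_mK_meas (β l : ℝ) : Measurable (mK β l) := by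
  unfold mK
  fun_prop

lemma sr_mK_bounds {β : ℝ} (hβ0 : 0 < β) (hβ1 : β < 1) : ∃ A c : ℝ, 0 < A ∧ 0 < c ∧ ∀ l s : ℝ, 0 < l → 0 < s →
    mK β l s ≤ A * s ^ (-β) ∧ mK β l s ≤ A * ((l ^ 2)⁻¹ * s ^ β) ∧ c * min (s ^ (-β)) ((l ^ 2)⁻¹ * s ^ β) ≤ mK β l s := by
  set C := Real.cos (Real.pi * β) with hC
  set K := Real.sin (Real.pi * β) / Real.pi with hK
  have hKpos : 0 < K := div_pos (sr_sin_pos hβ0 hβ1) Real.pi_pos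
  have h1 : -1 < C := by
    rw [hC, ← Real.cos_pi]
    apply Real.cos_lt_cos_of_nonneg_of_le_pi <;> nlinarith [Real.pi_pos]
  have h2 : C < 1 := by
    rw [hC, ← Real.cos_zero]
    apply Real.cos_lt_cos_of_nonneg_of_le_pi <;> nlinarith [Real.pi_pos]
  have hδ : 0 < 1 - |C| := by
    have := abs_lt.2 ⟨h1, h2⟩; linarith
  refine ⟨K / (1 - |C|), K / 4, by positivity, by positivity, ?_⟩
  intro l s hl hs
  have ha : 0 < s ^ β := Real.rpow_pos_of_pos hs β
  have hm : mK β l s = K * s ^ β / (l ^ 2 + 2 * l * s ^ β * C + (s ^ β) ^ 2) := rfl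
  have hD0 := sr_mK_denom (β := β) hl ha rfl hβ0 hβ1
  rw [← hC] at hD0
  rw [hm, Real.rpow_neg hs.le]
  generalize s ^ β = a at *
  have hlow : (1 - |C|) * (l ^ 2 + a ^ 2) ≤ l ^ 2 + 2 * l * a * C + a ^ 2 := by
    have h3 : -|C| ≤ C := neg_abs_le C
    have h4 : 2 * l * a * (-|C|) ≤ 2 * l * a * C := by gcongr
    nlinarith [mul_nonneg (abs_nonneg C) (sq_nonneg (l - a))]
  have hup : l ^ 2 + 2 * l * a * C + a ^ 2 ≤ (l + a) ^ 2 := by nlinarith [mul_pos hl ha]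
  refine ⟨?_, ?_, ?_⟩
  · rw [div_le_iff₀ hD0]
    calc K * a = K / (1 - |C|) * a⁻¹ * ((1 - |C|) * a ^ 2) := by field_simp
      _ ≤ _ := by
        gcongr
        nlinarith [mul_pos hδ (pow_pos hl 2)]
  · rw [div_le_iff₀ hD0]
    calc K * a = K / (1 - |C|) * ((l ^ 2)⁻¹ * a) * ((1 - |C|) * l ^ 2) := by field_simp
      _ ≤ _ := by
        gcongr
        nlinarith [mul_pos hδ (pow_pos ha 2)]
  · rw [le_div_iff₀ hD0]
    rcases le_total l a with h | h
    · calc K / 4 * min a⁻¹ ((l ^ 2)⁻¹ * a) * (l ^ 2 + 2 * l * a * C + a ^ 2) ≤ K / 4 * a⁻¹ * (4 * a ^ 2) := by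
            gcongr
            · exact min_le_left _ _
            · nlinarith
        _ = _ := by field_simp
    · calc K / 4 * min a⁻¹ ((l ^ 2)⁻¹ * a) * (l ^ 2 + 2 * l * a * C + a ^ 2) ≤ K / 4 * ((l ^ 2)⁻¹ * a) * (4 * l ^ 2) := by
            gcongr
            · exact min_le_right _ _
            · nlinarith
        _ = _ := by field_simp

noncomputable def nK (β l w : ℝ) : ℝ := ∫ s in Set.Ioi 0, Real.exp (-(s / w)) * mK β l s

lemma sr_nK_meas (β l : ℝ) : Measurable (nK β l) := by
  unfold nK
  apply StronglyMeasurable.measurable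
  apply StronglyMeasurable.integral_prod_right' (f := fun p : ℝ × ℝ => Real.exp (-(p.2 / p.1)) * mK β l p.2)
  apply Measurable.stronglyMeasurable
  have := sr_mK_meas β l
  fun_prop

lemma sr_nK_integrable {β l w : ℝ} (hβ0 : 0 < β) (hβ1 : β < 1) (hl : 0 < l) (hw : 0 < w) :
    IntegrableOn (fun s => Real.exp (-(s / w)) * mK β l s) (Set.Ioi 0) := by
  obtain ⟨A, c, hA, hc, hb⟩ := sr_mK_bounds hβ0 hβ1
  have hg := (sr_gamma (a := 1 - β) (r := 1 / w) (by linarith) (by positivity)).1.const_mul A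
  refine Integrable.mono' hg ?_ ?_
  · have := sr_mK_meas β l
    exact Measurable.aestronglyMeasurable (by fun_prop)
  · filter_upwards [ae_restrict_mem measurableSet_Ioi] with s hs
    have hs : 0 < s := hs
    have hp := sr_mK_pos hβ0 hβ1 hl hs
    rw [Real.norm_eq_abs, abs_of_pos (by positivity)]
    have := (hb l s hl hs).1
    calc Real.exp (-(s / w)) * mK β l s ≤ Real.exp (-(s / w)) * (A * s ^ (-β)) := by gcongr
      _ = _ := by
        rw [show 1 - β - 1 = -β by ring, show 1 / w * s = s / w by ring]; ring

lemma sr_nK_nonneg {β l w : ℝ} (hβ0 : 0 < β) (hβ1 : β < 1) (hl : 0 < l) : 0 ≤ nK β l w := by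
  apply setIntegral_nonneg measurableSet_Ioi
  intro s hs
  have hp := sr_mK_pos hβ0 hβ1 hl hs
  positivity

lemma sr_rpow_double {a x γ : ℝ} (ha : 0 < a) (h1 : a ≤ x) (h2 : x ≤ 2 * a) : 2 ^ (-|γ|) * a ^ γ ≤ x ^ γ := by
  rcases le_total 0 γ with h | h
  · calc (2:ℝ) ^ (-|γ|) * a ^ γ ≤ 1 * a ^ γ := by
          gcongr
          apply Real.rpow_le_one_of_one_le_of_nonpos (by norm_num)
          simp
      _ ≤ _ := by
          rw [one_mul]
          gcongr
  · rw [abs_of_nonpos h, neg_neg, ← Real.mul_rpow (by norm_num) ha.le]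
    exact Real.rpow_le_rpow_of_nonpos (by linarith) h2 h

lemma sr_nK_bounds {β : ℝ} (hβ0 : 0 < β) (hβ1 : β < 1) : ∃ A c : ℝ, 0 < A ∧ 0 < c ∧ ∀ l w : ℝ, 0 < l → 0 < w →
    nK β l w ≤ A * w ^ (1 - β) ∧ nK β l w ≤ A * ((l ^ 2)⁻¹ * w ^ (1 + β)) ∧
    c * min (w ^ (1 - β)) ((l ^ 2)⁻¹ * w ^ (1 + β)) ≤ nK β l w := by
  obtain ⟨A, c, hA, hc, hb⟩ := sr_mK_bounds hβ0 hβ1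
  have hG1 := Real.Gamma_pos_of_pos (show 0 < 1 - β by linarith)
  have hG2 := Real.Gamma_pos_of_pos (show 0 < 1 + β by linarith)
  refine ⟨A * (Real.Gamma (1 - β) + Real.Gamma (1 + β)), Real.exp (-2) * (c * 2 ^ (-β)), by positivity, by positivity, ?_⟩
  intro l w hl hw
  have hint := sr_nK_integrable hβ0 hβ1 hl hw
  refine ⟨?_, ?_, ?_⟩
  · obtain ⟨g1, g2⟩ := (sr_gamma (a := 1 - β) (r := 1 / w) (by linarith) (by positivity))
    calc nK β l w ≤ ∫ s in Set.Ioi (0:ℝ), A * (s ^ (1 - β - 1) * Real.exp (-(1 / w * s))) := by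
          apply setIntegral_mono_on hint (g1.const_mul A) measurableSet_Ioi
          intro s hs
          calc Real.exp (-(s / w)) * mK β l s ≤ Real.exp (-(s / w)) * (A * s ^ (-β)) := by
                gcongr
                exact (hb l s hl hs).1
            _ = _ := by
              rw [show 1 - β - 1 = -β by ring, show 1 / w * s = s / w by ring]; ring
      _ = A * (w ^ (1 - β) * Real.Gamma (1 - β)) := by
          rw [integral_const_mul, g2, one_div_one_div]
      _ ≤ _ := by
          rw [mul_assoc]
          gcongr A * ?_
          rw [mul_comm]
          gcongr
          linarith
  · obtain ⟨g1, g2⟩ := (sr_gamma (a := 1 + β) (r := 1 / w) (by linarith) (by positivity))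
    calc nK β l w ≤ ∫ s in Set.Ioi (0:ℝ), A * (l ^ 2)⁻¹ * (s ^ (1 + β - 1) * Real.exp (-(1 / w * s))) := by
          apply setIntegral_mono_on hint (g1.const_mul _) measurableSet_Ioi
          intro s hs
          calc Real.exp (-(s / w)) * mK β l s ≤ Real.exp (-(s / w)) * (A * ((l ^ 2)⁻¹ * s ^ β)) := by
                gcongr
                exact (hb l s hl hs).2.1
            _ = _ := by
              rw [show 1 + β - 1 = β by ring, show 1 / w * s = s / w by ring]; ring
      _ = A * ((l ^ 2)⁻¹ * (w ^ (1 + β) * Real.Gamma (1 + β))) := by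
          rw [integral_const_mul, g2, one_div_one_div]; ring
      _ ≤ A * ((l ^ 2)⁻¹ * (w ^ (1 + β) * (Real.Gamma (1 - β) + Real.Gamma (1 + β)))) := by
          gcongr
          linarith
      _ = _ := by ring
  · have hmin : min (w ^ (1 - β)) ((l ^ 2)⁻¹ * w ^ (1 + β)) = w * min (w ^ (-β)) ((l ^ 2)⁻¹ * w ^ β) := by
      rw [mul_min_of_nonneg _ _ hw.le, sub_eq_add_neg, Real.rpow_add hw, Real.rpow_add hw, Real.rpow_one]
      congr 1; ring
    rw [hmin]
    calc _ = w * (Real.exp (-2) * (c * (2 ^ (-β) * min (w ^ (-β)) ((l ^ 2)⁻¹ * w ^ β)))) := by ring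
      _ ≤ _ := by
        apply sr_lower hw _ hint
        · intro s h1 h2
          have hs : 0 < s := by linarith
          have hp := sr_mK_pos hβ0 hβ1 hl hs
          have d1 := sr_rpow_double (γ := β) hw h1 h2
          have d2 := sr_rpow_double (γ := -β) hw h1 h2
          rw [abs_neg] at d2
          rw [abs_of_pos hβ0] at d1 d2
          gcongr
          · rw [div_le_iff₀ hw]; exact h2
          · refine le_trans ?_ (hb l s hl hs).2.2
            gcongr
            rw [mul_min_of_nonneg _ _ (by positivity)]
            apply min_le_min d2
            calc _ = (l ^ 2)⁻¹ * (2 ^ (-β) * w ^ β) := by ring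
              _ ≤ _ := by gcongr
        · intro s hs
          have hp := sr_mK_pos hβ0 hβ1 hl hs
          positivity

end Part2

section Part3
open MeasureTheory Filter Topology

noncomputable def iK (β l k q : ℝ) : ℝ := ∫ w in Set.Ioi (0:ℝ), w ^ (k - 2) * Real.exp (-(q * w / 4)) * nK β l w

lemma sr_iK_meas (β l k q : ℝ) : Measurable (fun w : ℝ => w ^ (k - 2) * Real.exp (-(q * w / 4)) * nK β l w) := by
  have := sr_nK_meas β l
  fun_prop

lemma sr_iK_bound {β : ℝ} (hβ0 : 0 < β) (hβ1 : β < 1) : ∃ A : ℝ, 0 < A ∧ ∀ l k q w : ℝ, 0 < l → 0 < w →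
    w ^ (k - 2) * Real.exp (-(q * w / 4)) * nK β l w ≤ A * (w ^ ((k - β) - 1) * Real.exp (-(q / 4 * w))) ∧
    w ^ (k - 2) * Real.exp (-(q * w / 4)) * nK β l w ≤ A * (l ^ 2)⁻¹ * (w ^ ((k + β) - 1) * Real.exp (-(q / 4 * w))) := by
  obtain ⟨A, c, hA, hc, hb⟩ := sr_nK_bounds hβ0 hβ1
  refine ⟨A, hA, fun l k q w hl hw => ⟨?_, ?_⟩⟩
  · calc _ ≤ w ^ (k - 2) * Real.exp (-(q * w / 4)) * (A * w ^ (1 - β)) := by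
          gcongr
          exact (hb l w hl hw).1
      _ = _ := by
        rw [show k - β - 1 = (k - 2) + (1 - β) by ring, Real.rpow_add hw, show q / 4 * w = q * w / 4 by ring]; ring
  · calc _ ≤ w ^ (k - 2) * Real.exp (-(q * w / 4)) * (A * ((l ^ 2)⁻¹ * w ^ (1 + β))) := by
          gcongr
          exact (hb l w hl hw).2.1
      _ = _ := by
        rw [show k + β - 1 = (k - 2) + (1 + β) by ring, Real.rpow_add hw (k - 2) (1 + β), show q / 4 * w = q * w / 4 by ring]; ring

lemma sr_iK_nn {β l k q w : ℝ} (hβ0 : 0 < β) (hβ1 : β < 1) (hl : 0 < l) (hw : 0 < w) :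
    0 ≤ w ^ (k - 2) * Real.exp (-(q * w / 4)) * nK β l w := by
  have := sr_nK_nonneg (w := w) hβ0 hβ1 hl
  positivity

lemma sr_iK_integrable {β l k q : ℝ} (hβ0 : 0 < β) (hβ1 : β < 1) (hl : 0 < l) (hk : 0 < k + β) (hq : 0 < q) :
    IntegrableOn (fun w : ℝ => w ^ (k - 2) * Real.exp (-(q * w / 4)) * nK β l w) (Set.Ioi 0) := by
  obtain ⟨A, hA, hb⟩ := sr_iK_bound hβ0 hβ1
  have hg := (sr_gamma (a := k + β) (r := q / 4) hk (by positivity)).1.const_mul (A * (l ^ 2)⁻¹)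
  refine Integrable.mono' hg (sr_iK_meas β l k q).aestronglyMeasurable ?_
  filter_upwards [ae_restrict_mem measurableSet_Ioi] with w hw
  rw [Real.norm_eq_abs, abs_of_nonneg (sr_iK_nn hβ0 hβ1 hl hw)]
  exact (hb l k q w hl hw).2

lemma sr_iK_nonneg {β l k q : ℝ} (hβ0 : 0 < β) (hβ1 : β < 1) (hl : 0 < l) : 0 ≤ iK β l k q :=
  setIntegral_nonneg measurableSet_Ioi fun _ hw => sr_iK_nn hβ0 hβ1 hl hw

lemma sr_iK_bounds {β k : ℝ} (hβ0 : 0 < β) (hβ1 : β < 1) (hk : β < k) : ∃ A c : ℝ, 0 < A ∧ 0 < c ∧ ∀ l q : ℝ, 0 < l → 0 < q →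
    iK β l k q ≤ A * q ^ (-(k - β)) ∧ iK β l k q ≤ A * ((l ^ 2)⁻¹ * q ^ (-(k + β))) ∧
    c * min (q ^ (-(k - β))) ((l ^ 2)⁻¹ * q ^ (-(k + β))) ≤ iK β l k q := by
  obtain ⟨A, hA, hb⟩ := sr_iK_bound hβ0 hβ1
  obtain ⟨_, c, _, hc, hc'⟩ := sr_nK_bounds hβ0 hβ1
  have hG1 := Real.Gamma_pos_of_pos (show 0 < k - β by linarith)
  have hG2 := Real.Gamma_pos_of_pos (show 0 < k + β by linarith)
  set A1 := A * (4 ^ (k - β) * Real.Gamma (k - β)) with hA1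
  set A2 := A * (4 ^ (k + β) * Real.Gamma (k + β)) with hA2
  have hA1p : 0 < A1 := by positivity
  have hA2p : 0 < A2 := by positivity
  refine ⟨A1 + A2, 2 ^ (-|k - 2|) * Real.exp (-(1/2)) * c, by positivity, by positivity, ?_⟩
  intro l q hl hq
  have hint := sr_iK_integrable (k := k) hβ0 hβ1 hl (by linarith) hq
  have hpow : ∀ e : ℝ, (1 / (q / 4)) ^ e = 4 ^ e * q ^ (-e) := by
    intro e
    rw [Real.rpow_neg hq.le, one_div_div, Real.div_rpow (by norm_num) hq.le]; rfl
  refine ⟨?_, ?_, ?_⟩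
  · obtain ⟨g1, g2⟩ := (sr_gamma (a := k - β) (r := q / 4) (by linarith) (by positivity))
    calc iK β l k q ≤ ∫ w in Set.Ioi (0:ℝ), A * (w ^ ((k - β) - 1) * Real.exp (-(q / 4 * w))) := by
          apply setIntegral_mono_on hint (g1.const_mul A) measurableSet_Ioi
          intro w hw
          exact (hb l k q w hl hw).1
      _ = A1 * q ^ (-(k - β)) := by
          rw [integral_const_mul, g2, hpow]; ring
      _ ≤ _ := by
          gcongr
          linarith
  · obtain ⟨g1, g2⟩ := (sr_gamma (a := k + β) (r := q / 4) (by linarith) (by positivity))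
    calc iK β l k q ≤ ∫ w in Set.Ioi (0:ℝ), A * (l ^ 2)⁻¹ * (w ^ ((k + β) - 1) * Real.exp (-(q / 4 * w))) := by
          apply setIntegral_mono_on hint (g1.const_mul _) measurableSet_Ioi
          intro w hw
          exact (hb l k q w hl hw).2
      _ = A2 * ((l ^ 2)⁻¹ * q ^ (-(k + β))) := by
          rw [integral_const_mul, g2, hpow]; ring
      _ ≤ _ := by
          gcongr
          linarith
  · set a := q⁻¹ with ha
    have hap : 0 < a := by positivity
    have hqa : ∀ e : ℝ, q ^ (-e) = a ^ e := by
      intro e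
      rw [ha, Real.inv_rpow hq.le, Real.rpow_neg hq.le]
    rw [hqa, hqa]
    have hmin : min (a ^ (k - β)) ((l ^ 2)⁻¹ * a ^ (k + β)) = a * (a ^ (k - 2) * min (a ^ (1 - β)) ((l ^ 2)⁻¹ * a ^ (1 + β))) := by
      rw [mul_min_of_nonneg _ _ (by positivity), mul_min_of_nonneg _ _ hap.le]
      rw [show k - β = 1 + (k - 2) + (1 - β) by ring, show k + β = 1 + (k - 2) + (1 + β) by ring]
      rw [Real.rpow_add hap, Real.rpow_add hap, Real.rpow_add hap _ (1 + β), Real.rpow_add hap, Real.rpow_one]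
      congr 1 <;> ring
    rw [hmin]
    calc _ = a * ((2 ^ (-|k - 2|) * a ^ (k - 2)) * Real.exp (-(1/2)) * (c * min (a ^ (1 - β)) ((l ^ 2)⁻¹ * a ^ (1 + β)))) := by ring
      _ ≤ _ := by
        apply sr_lower hap _ hint
        · intro w h1 h2
          have hw : 0 < w := by linarith
          have hn := hc' l w hl hw
          gcongr ?_ * ?_ * ?_
          · exact sr_rpow_double hap h1 h2
          · apply Real.exp_le_exp.2
            have : q * w ≤ q * (2 * a) := by gcongr
            have h3 : q * (2 * a) = 2 := by rw [ha]; field_simp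
            linarith
          · refine le_trans ?_ hn.2.2
            gcongr
        · intro w hw
          exact sr_iK_nn hβ0 hβ1 hl hw

lemma sr_iK_deriv {β l k q : ℝ} (hβ0 : 0 < β) (hβ1 : β < 1) (hl : 0 < l) (hk : 0 < k + β) (hq : 0 < q) :
    HasDerivAt (iK β l k) (-(1/4) * iK β l (k + 1) q) q := by
  have key := hasDerivAt_integral_of_dominated_loc_of_deriv_le (μ := volume.restrict (Set.Ioi (0:ℝ)))
    (F := fun q w : ℝ => w ^ (k - 2) * Real.exp (-(q * w / 4)) * nK β l w)
    (F' := fun q w : ℝ => -(1/4) * (w ^ (k + 1 - 2) * Real.exp (-(q * w / 4)) * nK β l w))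
    (x₀ := q) (s := Set.Ioi (q / 2)) (bound := fun w : ℝ => w ^ (k + 1 - 2) * Real.exp (-(q / 2 * w / 4)) * nK β l w)
    (Ioi_mem_nhds (by linarith)) ?_ ?_ ?_ ?_ ?_ ?_
  · have h2 := key.2
    rw [integral_const_mul] at h2
    exact h2
  · filter_upwards with q' using (sr_iK_meas β l k q').aestronglyMeasurable
  · exact sr_iK_integrable hβ0 hβ1 hl hk hq
  · exact ((sr_iK_meas β l (k+1) q).const_mul _).aestronglyMeasurable
  · filter_upwards [ae_restrict_mem measurableSet_Ioi] with w hw q' hq'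
    have hw : 0 < w := hw
    have hq' : q / 2 < q' := hq'
    rw [norm_mul, Real.norm_eq_abs, Real.norm_eq_abs, abs_of_nonneg (sr_iK_nn hβ0 hβ1 hl hw)]
    have hn := sr_nK_nonneg (w := w) hβ0 hβ1 hl
    calc _ ≤ 1 * (w ^ (k + 1 - 2) * Real.exp (-(q' * w / 4)) * nK β l w) := by
          apply mul_le_mul_of_nonneg_right _ (sr_iK_nn hβ0 hβ1 hl hw)
          norm_num [abs_of_pos]
      _ ≤ _ := by
          rw [one_mul]
          gcongr
  · exact sr_iK_integrable hβ0 hβ1 hl (by linarith) (by linarith)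
  · filter_upwards [ae_restrict_mem measurableSet_Ioi] with w hw q' hq'
    have hw : 0 < w := hw
    have h1 : HasDerivAt (fun q : ℝ => -(q * w / 4)) (-(1 * w / 4)) q' := (((hasDerivAt_id q').mul_const w).div_const 4).neg
    have h2 := ((h1.exp.const_mul (w ^ (k - 2))).mul_const (nK β l w))
    refine h2.congr_deriv ?_
    rw [show k + 1 - 2 = (k - 2) + 1 by ring, Real.rpow_add hw, Real.rpow_one]
    ring

end Part3

section Part4
open MeasureTheory Filter Topology
open scoped ENNReal RealInnerProductSpace

lemma sr_expinv {a : ℝ} (ha : 0 < a) :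
    IntegrableOn (fun w : ℝ => w ^ (-2 : ℝ) * Real.exp (-(a / w))) (Set.Ioi 0) ∧
    ∫ w in Set.Ioi (0:ℝ), w ^ (-2 : ℝ) * Real.exp (-(a / w)) = a⁻¹ := by
  have hg := sr_gamma (a := 1) (r := a) one_pos ha
  simp only [sub_self, Real.rpow_zero, one_mul, Real.rpow_one, Real.Gamma_one, mul_one, one_div] at hg
  have hcongr : Set.EqOn (fun w : ℝ => (|(-1:ℝ)| * w ^ ((-1:ℝ) - 1)) • Real.exp (-(a * (w ^ (-1:ℝ))))) (fun w : ℝ => w ^ (-2 : ℝ) * Real.exp (-(a / w))) (Set.Ioi 0) := by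
    intro w hw
    have hw : 0 < w := hw
    simp only [smul_eq_mul, abs_neg, abs_one, one_mul, Real.rpow_neg_one]
    norm_num [div_eq_mul_inv]
  constructor
  · rw [← integrableOn_congr_fun hcongr measurableSet_Ioi]
    exact (integrableOn_Ioi_comp_rpow_iff (fun y => Real.exp (-(a * y))) (p := -1) (by norm_num)).2 hg.1
  · rw [← setIntegral_congr_fun measurableSet_Ioi hcongr, integral_comp_rpow_Ioi (fun y => Real.exp (-(a * y))) (p := -1) (by norm_num)]
    exact hg.2

lemma sr_nK_laplace {β l v : ℝ} (hβ0 : 0 < β) (hβ1 : β < 1) (hl : 0 < l) (hv : 0 < v) :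
    ∫ w in Set.Ioi (0:ℝ), w ^ (-2 : ℝ) * Real.exp (-(v / w)) * nK β l w = (l + v ^ β)⁻¹ := by
  obtain ⟨s1, s2⟩ := sr_stieltjes hβ0 hβ1 hl hv
  have hm := sr_mK_meas β l
  have hpt : ∀ s, 0 < s → (fun w : ℝ => w ^ (-2 : ℝ) * Real.exp (-(v / w)) * (Real.exp (-(s / w)) * mK β l s))
       = (fun w => (w ^ (-2 : ℝ) * Real.exp (-((s + v) / w))) * mK β l s) := by
    intro s hs
    ext w
    rw [show -((s + v) / w) = -(v / w) + -(s / w) by ring, Real.exp_add]; ring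
  have hI : Integrable (Function.uncurry (fun w s : ℝ => w ^ (-2 : ℝ) * Real.exp (-(v / w)) * (Real.exp (-(s / w)) * mK β l s)))
      ((volume.restrict (Set.Ioi (0:ℝ))).prod (volume.restrict (Set.Ioi (0:ℝ)))) := by
    rw [integrable_prod_iff']
    · constructor
      · filter_upwards [ae_restrict_mem measurableSet_Ioi] with s hs
        have hs : 0 < s := hs
        simp only [Function.uncurry]
        rw [hpt s hs]
        exact (sr_expinv (by positivity)).1.mul_const _
      · refine s1.congr ?_
        filter_upwards [ae_restrict_mem measurableSet_Ioi] with s hs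
        have hs : 0 < s := hs
        simp only [Function.uncurry]
        have h1 : ∫ w in Set.Ioi (0:ℝ), ‖w ^ (-2 : ℝ) * Real.exp (-(v / w)) * (Real.exp (-(s / w)) * mK β l s)‖ =
            ∫ w in Set.Ioi (0:ℝ), w ^ (-2 : ℝ) * Real.exp (-(v / w)) * (Real.exp (-(s / w)) * mK β l s) := by
          apply setIntegral_congr_fun measurableSet_Ioi
          intro w hw
          have hw : 0 < w := hw
          have := sr_mK_pos hβ0 hβ1 hl hs
          exact Real.norm_of_nonneg (by positivity)
        rw [h1, hpt s hs, integral_mul_const, (sr_expinv (by positivity)).2]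
        ring
    · apply Measurable.aestronglyMeasurable
      simp only [Function.uncurry_def]
      fun_prop
  calc _ = ∫ w in Set.Ioi (0:ℝ), ∫ s in Set.Ioi (0:ℝ), w ^ (-2 : ℝ) * Real.exp (-(v / w)) * (Real.exp (-(s / w)) * mK β l s) := by
        simp only [integral_const_mul, nK]
    _ = ∫ s in Set.Ioi (0:ℝ), ∫ w in Set.Ioi (0:ℝ), w ^ (-2 : ℝ) * Real.exp (-(v / w)) * (Real.exp (-(s / w)) * mK β l s) :=
        integral_integral_swap hI
    _ = ∫ s in Set.Ioi (0:ℝ), mK β l s / (s + v) := by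
        apply setIntegral_congr_fun measurableSet_Ioi
        intro s hs
        have hs : 0 < s := hs
        simp only
        rw [hpt s hs, integral_mul_const, (sr_expinv (by positivity)).2]
        ring
    _ = _ := s2

lemma sr_nK_int2 {β l : ℝ} (hβ0 : 0 < β) (hβ1 : β < 1) (hl : 0 < l) :
    IntegrableOn (fun w : ℝ => w ^ (-2 : ℝ) * nK β l w) (Set.Ioi 0) := by
  obtain ⟨A, c, hA, hc, hb⟩ := sr_nK_bounds hβ0 hβ1
  have hm := sr_nK_meas β l
  have hmeas : Measurable (fun w : ℝ => w ^ (-2 : ℝ) * nK β l w) := by fun_prop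
  rw [← Set.Ioc_union_Ioi_eq_Ioi (zero_le_one' ℝ)]
  apply IntegrableOn.union
  · have h1 : IntegrableOn (fun w : ℝ => (A * (l ^ 2)⁻¹) * w ^ (β - 1)) (Set.Ioc 0 1) := by
      have := (intervalIntegral.intervalIntegrable_rpow' (a := 0) (b := 1) (r := β - 1) (by linarith)).1
      exact this.const_mul _
    refine Integrable.mono' h1 hmeas.aestronglyMeasurable ?_
    filter_upwards [ae_restrict_mem measurableSet_Ioc] with w hw
    have hw : 0 < w := hw.1
    have hn := sr_nK_nonneg (w := w) hβ0 hβ1 hl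
    rw [Real.norm_of_nonneg (by positivity), show β - 1 = -2 + (1 + β) by ring, Real.rpow_add hw (-2) (1 + β)]
    calc _ ≤ w ^ (-2:ℝ) * (A * ((l ^ 2)⁻¹ * w ^ (1 + β))) := by
          gcongr
          exact (hb l w hl hw).2.1
      _ = _ := by ring
  · have h1 : IntegrableOn (fun w : ℝ => A * w ^ (-1 - β)) (Set.Ioi 1) := by
      exact (integrableOn_Ioi_rpow_of_lt (by linarith) one_pos).const_mul _
    refine Integrable.mono' h1 hmeas.aestronglyMeasurable ?_
    filter_upwards [ae_restrict_mem measurableSet_Ioi] with w hw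
    have hw : 0 < w := lt_trans one_pos hw
    have hn := sr_nK_nonneg (w := w) hβ0 hβ1 hl
    rw [Real.norm_of_nonneg (by positivity), show -1 - β = -2 + (1 - β) by ring, Real.rpow_add hw (-2) (1 - β)]
    calc _ ≤ w ^ (-2:ℝ) * (A * w ^ (1 - β)) := by
          gcongr
          exact (hb l w hl hw).1
      _ = _ := by ring

lemma sr_gauss {d : ℕ} {b : ℝ} (hb : 0 < b) (ξ : EuclideanSpace ℝ (Fin d)) :
    ∫ x : EuclideanSpace ℝ (Fin d), Complex.exp ((⟪x, ξ⟫ : ℝ) * Complex.I) * (Real.exp (-(b * ‖x‖ ^ 2)) : ℂ)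
      = (((Real.pi / b) ^ ((d:ℝ) / 2) * Real.exp (-(‖ξ‖ ^ 2 / (4 * b))) : ℝ) : ℂ) := by
  have h := GaussianFourier.integral_cexp_neg_mul_sq_norm_add (b := (b : ℂ)) (by simpa using hb) Complex.I ξ
  have hp : 0 ≤ Real.pi / b := by have := Real.pi_pos; positivity
  rw [Complex.ofReal_mul, Complex.ofReal_cpow hp]
  rw [show (∫ x : EuclideanSpace ℝ (Fin d), Complex.exp ((⟪x, ξ⟫ : ℝ) * Complex.I) * (Real.exp (-(b * ‖x‖ ^ 2)) : ℂ)) =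
    ∫ v : EuclideanSpace ℝ (Fin d), Complex.exp (-(b:ℂ) * ‖v‖ ^ 2 + Complex.I * ⟪ξ, v⟫) from ?_, h]
  · simp only [finrank_euclideanSpace, Fintype.card_fin]
    push_cast
    congr 2
    rw [Complex.I_sq]; ring
  · congr 1
    ext x
    rw [Complex.exp_add, real_inner_comm]
    push_cast
    rw [mul_comm]
    congr 2 <;> ring

lemma sr_gauss_real {d : ℕ} {b : ℝ} (hb : 0 < b) :
    Integrable (fun x : EuclideanSpace ℝ (Fin d) => Real.exp (-(b * ‖x‖ ^ 2))) ∧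
    ∫ x : EuclideanSpace ℝ (Fin d), Real.exp (-(b * ‖x‖ ^ 2)) = (Real.pi / b) ^ ((d:ℝ) / 2) := by
  have h2 : ∫ x : EuclideanSpace ℝ (Fin d), Real.exp (-(b * ‖x‖ ^ 2)) = (Real.pi / b) ^ ((d:ℝ) / 2) := by
    have := GaussianFourier.integral_rexp_neg_mul_sq_norm (V := EuclideanSpace ℝ (Fin d)) hb
    simpa using this
  refine ⟨?_, h2⟩
  by_contra h
  rw [integral_undef h] at h2
  have := Real.pi_pos
  have : 0 < (Real.pi / b) ^ ((d:ℝ) / 2) := by positivity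
  linarith

noncomputable def rK (d : ℕ) (β l : ℝ) (x : EuclideanSpace ℝ (Fin d)) : ℝ :=
  (4 * Real.pi) ^ (-((d:ℝ) / 2)) * iK β l ((d:ℝ) / 2) (‖x‖ ^ 2)

lemma sr_prod_integrable (d : ℕ) {β l : ℝ} (hβ0 : 0 < β) (hβ1 : β < 1) (hl : 0 < l) :
    Integrable (fun p : ℝ × EuclideanSpace ℝ (Fin d) => p.1 ^ ((d:ℝ) / 2 - 2) * Real.exp (-(‖p.2‖ ^ 2 * p.1 / 4)) * nK β l p.1)
      ((volume.restrict (Set.Ioi (0:ℝ))).prod volume) := by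
  have hm := sr_nK_meas β l
  rw [integrable_prod_iff]
  · constructor
    · filter_upwards [ae_restrict_mem measurableSet_Ioi] with w hw
      have hw : 0 < w := hw
      have := ((sr_gauss_real (d := d) (b := w / 4) (by positivity)).1.const_mul (w ^ ((d:ℝ) / 2 - 2))).mul_const (nK β l w)
      refine this.congr (Eventually.of_forall fun x => ?_)
      simp only
      rw [show w / 4 * ‖x‖ ^ 2 = ‖x‖ ^ 2 * w / 4 by ring]
    · refine ((sr_nK_int2 hβ0 hβ1 hl).const_mul ((4 * Real.pi) ^ ((d:ℝ)/2))).congr ?_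
      filter_upwards [ae_restrict_mem measurableSet_Ioi] with w hw
      have hw : 0 < w := hw
      have hn := sr_nK_nonneg (w := w) hβ0 hβ1 hl
      have h1 : (fun x : EuclideanSpace ℝ (Fin d) => ‖w ^ ((d:ℝ) / 2 - 2) * Real.exp (-(‖x‖ ^ 2 * w / 4)) * nK β l w‖) =
        fun x => w ^ ((d:ℝ) / 2 - 2) * Real.exp (-(w / 4 * ‖x‖ ^ 2)) * nK β l w := by
        ext x
        rw [Real.norm_of_nonneg (by positivity), show w / 4 * ‖x‖ ^ 2 = ‖x‖ ^ 2 * w / 4 by ring]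
      rw [h1, integral_mul_const, integral_const_mul, (sr_gauss_real (d := d) (b := w / 4) (by positivity)).2]
      have hp := Real.pi_pos
      rw [show Real.pi / (w / 4) = (4 * Real.pi) / w by field_simp, Real.div_rpow (by positivity) hw.le,
        show (d:ℝ)/2 - 2 = (d:ℝ)/2 + (-2) by ring, Real.rpow_add hw]
      have : 0 < w ^ ((d:ℝ)/2) := by positivity
      field_simp
  · apply Measurable.aestronglyMeasurable
    fun_prop

lemma sr_rK_integrable (d : ℕ) {β l : ℝ} (hβ0 : 0 < β) (hβ1 : β < 1) (hl : 0 < l) : Integrable (rK d β l) := by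
  have := (sr_prod_integrable d hβ0 hβ1 hl).integral_prod_right
  exact this.const_mul _

lemma sr_rK_nonneg (d : ℕ) {β l : ℝ} (hβ0 : 0 < β) (hβ1 : β < 1) (hl : 0 < l) (x : EuclideanSpace ℝ (Fin d)) : 0 ≤ rK d β l x := by
  have := sr_iK_nonneg (k := (d:ℝ)/2) (q := ‖x‖^2) hβ0 hβ1 hl
  have := Real.pi_pos
  unfold rK
  positivity

lemma sr_rK_fourier (d : ℕ) {β l : ℝ} (hβ0 : 0 < β) (hβ1 : β < 1) (hl : 0 < l) (ξ : EuclideanSpace ℝ (Fin d)) (hξ : ξ ≠ 0) :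
    ∫ x, Complex.exp ((⟪x, ξ⟫ : ℝ) * Complex.I) * (rK d β l x : ℂ) = (((l + (‖ξ‖ ^ 2) ^ β)⁻¹ : ℝ) : ℂ) := by
  have hp := Real.pi_pos
  have hn : 0 < ‖ξ‖ := norm_pos_iff.2 hξ
  have hI : Integrable (Function.uncurry fun (x : EuclideanSpace ℝ (Fin d)) (w : ℝ) => Complex.exp ((⟪x, ξ⟫ : ℝ) * Complex.I) * ((w ^ ((d:ℝ) / 2 - 2) * Real.exp (-(‖x‖ ^ 2 * w / 4)) * nK β l w : ℝ) : ℂ))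
      (volume.prod (volume.restrict (Set.Ioi (0:ℝ)))) := by
    have h1 := ((sr_prod_integrable d hβ0 hβ1 hl).swap).ofReal (𝕜 := ℂ)
    refine h1.bdd_mul (c := 1) (f := fun p : EuclideanSpace ℝ (Fin d) × ℝ => Complex.exp ((⟪p.1, ξ⟫ : ℝ) * Complex.I)) ?_ ?_
    · apply Continuous.aestronglyMeasurable
      fun_prop
    · filter_upwards with p
      rw [Complex.norm_exp_ofReal_mul_I]
  calc _ = ∫ x, (((4 * Real.pi) ^ (-((d:ℝ) / 2)) : ℝ) : ℂ) * ∫ w in Set.Ioi (0:ℝ), Complex.exp ((⟪x, ξ⟫ : ℝ) * Complex.I) * ((w ^ ((d:ℝ) / 2 - 2) * Real.exp (-(‖x‖ ^ 2 * w / 4)) * nK β l w : ℝ) : ℂ) := by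
        congr 1
        ext x
        rw [integral_const_mul, integral_complex_ofReal, rK, iK]
        push_cast
        ring
    _ = (((4 * Real.pi) ^ (-((d:ℝ) / 2)) : ℝ) : ℂ) * ∫ w in Set.Ioi (0:ℝ), ∫ x, Complex.exp ((⟪x, ξ⟫ : ℝ) * Complex.I) * ((w ^ ((d:ℝ) / 2 - 2) * Real.exp (-(‖x‖ ^ 2 * w / 4)) * nK β l w : ℝ) : ℂ) := by
        rw [integral_const_mul, integral_integral_swap hI]
    _ = (((4 * Real.pi) ^ (-((d:ℝ) / 2)) : ℝ) : ℂ) * ∫ w in Set.Ioi (0:ℝ), (((4 * Real.pi) ^ ((d:ℝ) / 2) * (w ^ (-2 : ℝ) * Real.exp (-(‖ξ‖ ^ 2 / w)) * nK β l w) : ℝ) : ℂ) := by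
        congr 1
        apply setIntegral_congr_fun measurableSet_Ioi
        intro w hw
        have hw : 0 < w := hw
        simp only
        have h1 : ∀ x : EuclideanSpace ℝ (Fin d), Complex.exp ((⟪x, ξ⟫ : ℝ) * Complex.I) * ((w ^ ((d:ℝ) / 2 - 2) * Real.exp (-(‖x‖ ^ 2 * w / 4)) * nK β l w : ℝ) : ℂ)
          = ((w ^ ((d:ℝ) / 2 - 2) * nK β l w : ℝ) : ℂ) * (Complex.exp ((⟪x, ξ⟫ : ℝ) * Complex.I) * (Real.exp (-(w / 4 * ‖x‖ ^ 2)) : ℂ)) := by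
          intro x
          rw [show w / 4 * ‖x‖ ^ 2 = ‖x‖ ^ 2 * w / 4 by ring]
          push_cast
          ring
        simp_rw [h1]
        rw [integral_const_mul, sr_gauss (by positivity), ← Complex.ofReal_mul]
        congr 1
        rw [show Real.pi / (w / 4) = (4 * Real.pi) / w by field_simp, Real.div_rpow (by positivity) hw.le,
          show (d:ℝ)/2 - 2 = (d:ℝ)/2 + (-2) by ring, Real.rpow_add hw, show 4 * (w / 4) = w by ring]
        have : 0 < w ^ ((d:ℝ)/2) := by positivity
        field_simp
    _ = _ := by
        rw [integral_complex_ofReal, integral_const_mul, sr_nK_laplace hβ0 hβ1 hl (by positivity), ← Complex.ofReal_mul, ← mul_assoc,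
          ← Real.rpow_add (by positivity)]
        simp

end Part4

section Part5
open MeasureTheory Filter Topology
open scoped ENNReal RealInnerProductSpace

lemma sr_int_pow {d : ℕ} {α l : ℝ} (hα : 1 < α) (hl : 0 < l) {n : ℕ} (hn : d < n) :
    Integrable (fun ξ : EuclideanSpace ℝ (Fin d) => ((l + ‖ξ‖ ^ α) ^ n)⁻¹) := by
  set C : ℝ := 2 ^ α * (1 + 1 / l) with hC
  have hCp : 0 < C := by positivity
  have hI : Integrable (fun ξ : EuclideanSpace ℝ (Fin d) => C ^ n * (1 + ‖ξ‖) ^ (-(α * n))) := by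
    apply Integrable.const_mul
    apply integrable_one_add_norm
    simp only [finrank_euclideanSpace, Fintype.card_fin]
    have : (d:ℝ) < n := by exact_mod_cast hn
    nlinarith
  refine Integrable.mono' hI ?_ ?_
  · apply Measurable.aestronglyMeasurable
    fun_prop
  · filter_upwards with ξ
    have hx : 0 ≤ ‖ξ‖ := norm_nonneg ξ
    have hX : 0 ≤ ‖ξ‖ ^ α := by positivity
    rw [Real.norm_of_nonneg (by positivity)]
    have h1 : (1 + ‖ξ‖) ^ α ≤ C * (l + ‖ξ‖ ^ α) := by
      have h2 : (1 + ‖ξ‖) ^ α ≤ 2 ^ α * (1 + ‖ξ‖ ^ α) := by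
        rcases le_total 1 ‖ξ‖ with h | h
        · calc (1 + ‖ξ‖) ^ α ≤ (2 * ‖ξ‖) ^ α := by gcongr; linarith
            _ = 2 ^ α * ‖ξ‖ ^ α := Real.mul_rpow (by norm_num) hx
            _ ≤ _ := by gcongr; linarith
        · calc (1 + ‖ξ‖) ^ α ≤ 2 ^ α := by gcongr; linarith
            _ ≤ _ := by
              have : (0:ℝ) < 2 ^ α := by positivity
              nlinarith [mul_nonneg this.le hX]
      refine h2.trans ?_
      rw [hC, mul_assoc]
      gcongr
      have : (1 + 1 / l) * (l + ‖ξ‖ ^ α) = 1 + ‖ξ‖ ^ α + l + ‖ξ‖ ^ α / l := by field_simp; ring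
      rw [this]
      have : 0 ≤ ‖ξ‖ ^ α / l := by positivity
      linarith
    rw [Real.rpow_neg (by positivity), Real.rpow_mul (by positivity), Real.rpow_natCast, ← div_eq_mul_inv, inv_eq_one_div,
      div_le_div_iff₀ (by positivity) (by positivity), one_mul, ← mul_pow]
    gcongr

lemma sr_int_exp {d : ℕ} {α t : ℝ} (hα : 1 < α) (ht : 0 < t) :
    Integrable (fun ξ : EuclideanSpace ℝ (Fin d) => Real.exp (-(t * ‖ξ‖ ^ α))) := by
  have h := (sr_int_pow (d := d) hα one_pos (Nat.lt_succ_self d)).const_mul (Real.exp t * ((d+1).factorial / t ^ (d + 1)))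
  refine Integrable.mono' h ?_ ?_
  · apply Measurable.aestronglyMeasurable
    fun_prop
  · filter_upwards with ξ
    have hX : 0 ≤ ‖ξ‖ ^ α := by positivity
    rw [Real.norm_of_nonneg (by positivity)]
    have h1 := Real.pow_div_factorial_le_exp (t * (1 + ‖ξ‖ ^ α)) (by positivity) (d + 1)
    have h2 : Real.exp (-(t * ‖ξ‖ ^ α)) = Real.exp t * (Real.exp (t * (1 + ‖ξ‖ ^ α)))⁻¹ := by
      rw [← Real.exp_neg, ← Real.exp_add]; congr 1; ring
    rw [h2, mul_assoc]
    gcongr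
    calc (Real.exp (t * (1 + ‖ξ‖ ^ α)))⁻¹ ≤ ((t * (1 + ‖ξ‖ ^ α)) ^ (d + 1) / (d+1).factorial)⁻¹ := by gcongr
      _ = _ := by rw [mul_pow]; field_simp

lemma sr_pos_fourier {d : ℕ} (ν : Measure (EuclideanSpace ℝ (Fin d))) [IsFiniteMeasure ν] {ε : ℝ} (hε : 0 < ε)
    (x : EuclideanSpace ℝ (Fin d)) :
    0 ≤ (∫ ξ : EuclideanSpace ℝ (Fin d), Complex.exp (-Complex.I * ((⟪ξ, x⟫ : ℝ) : ℂ)) * (charFun ν ξ * (Real.exp (-(ε * ‖ξ‖ ^ 2)) : ℂ))).re := by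
  have hI : Integrable (Function.uncurry fun (ξ y : EuclideanSpace ℝ (Fin d)) => Complex.exp ((⟪ξ, y - x⟫ : ℝ) * Complex.I) * (Real.exp (-(ε * ‖ξ‖ ^ 2)) : ℂ))
      (volume.prod ν) := by
    have h1 := ((sr_gauss_real (d := d) hε).1.comp_fst ν).ofReal (𝕜 := ℂ)
    refine h1.bdd_mul (c := 1) (f := fun p : EuclideanSpace ℝ (Fin d) × EuclideanSpace ℝ (Fin d) => Complex.exp ((⟪p.1, p.2 - x⟫ : ℝ) * Complex.I)) ?_ ?_
    · apply Continuous.aestronglyMeasurable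
      fun_prop
    · filter_upwards with p
      rw [Complex.norm_exp_ofReal_mul_I]
  have : (∫ ξ : EuclideanSpace ℝ (Fin d), Complex.exp (-Complex.I * ((⟪ξ, x⟫ : ℝ) : ℂ)) * (charFun ν ξ * (Real.exp (-(ε * ‖ξ‖ ^ 2)) : ℂ)))
     = ((∫ y, (Real.pi / ε) ^ ((d:ℝ) / 2) * Real.exp (-(‖y - x‖ ^ 2 / (4 * ε))) ∂ν : ℝ) : ℂ) := by
    calc _ = ∫ ξ : EuclideanSpace ℝ (Fin d), ∫ y, Complex.exp ((⟪ξ, y - x⟫ : ℝ) * Complex.I) * (Real.exp (-(ε * ‖ξ‖ ^ 2)) : ℂ) ∂ν := by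
          congr 1
          ext ξ
          rw [integral_mul_const, charFun_apply, ← mul_assoc, ← integral_const_mul]
          congr 2
          ext y
          rw [← Complex.exp_add, inner_sub_right, real_inner_comm y ξ]
          congr 1
          push_cast
          ring
      _ = ∫ y, (∫ ξ : EuclideanSpace ℝ (Fin d), Complex.exp ((⟪ξ, y - x⟫ : ℝ) * Complex.I) * (Real.exp (-(ε * ‖ξ‖ ^ 2)) : ℂ)) ∂ν :=
          integral_integral_swap hI
      _ = _ := by
          simp_rw [sr_gauss hε]
          rw [integral_complex_ofReal]
  rw [this, Complex.ofReal_re]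
  apply integral_nonneg
  intro y
  have := Real.pi_pos
  positivity

lemma sr_sq_rpow {d : ℕ} (α : ℝ) (ξ : EuclideanSpace ℝ (Fin d)) : (‖ξ‖ ^ 2) ^ (α / 2) = ‖ξ‖ ^ α := by
  rw [← Real.rpow_natCast, ← Real.rpow_mul (norm_nonneg _)]
  congr 1
  push_cast
  ring

lemma sr_exists_measure (d : ℕ) {α c : ℝ} (hα1 : 1 < α) (hα2 : α < 2) (hc : 0 < c) (n : ℕ) :
    ∃ ν : Measure (EuclideanSpace ℝ (Fin d)), IsFiniteMeasure ν ∧ ∀ ξ, ξ ≠ 0 → charFun ν ξ = ((((1 + c * ‖ξ‖ ^ α)⁻¹) ^ n : ℝ) : ℂ) := by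
  have hβ0 : 0 < α / 2 := by linarith
  have hβ1 : α / 2 < 1 := by linarith
  have hl : 0 < c⁻¹ := by positivity
  induction n with
  | zero => exact ⟨Measure.dirac 0, inferInstance, fun ξ hξ => by simp [charFun_apply]⟩
  | succ n ih =>
    obtain ⟨ν, hν, hch⟩ := ih
    have hint := (sr_rK_integrable d hβ0 hβ1 hl).const_mul c⁻¹
    have hfin := isFiniteMeasure_withDensity_ofReal hint.2
    refine ⟨ν.conv (volume.withDensity fun x => ENNReal.ofReal (c⁻¹ * rK d (α / 2) c⁻¹ x)), inferInstance, fun ξ hξ => ?_⟩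
    rw [charFun_conv, hch ξ hξ, pow_succ, Complex.ofReal_mul]
    congr 1
    rw [charFun_apply, integral_withDensity_eq_integral_toReal_smul₀ hint.aemeasurable.ennreal_ofReal (by simp)]
    have h1 : ∀ x : EuclideanSpace ℝ (Fin d), (ENNReal.ofReal (c⁻¹ * rK d (α / 2) c⁻¹ x)).toReal • Complex.exp ((⟪x, ξ⟫ : ℝ) * Complex.I)
        = (c⁻¹ : ℂ) * (Complex.exp ((⟪x, ξ⟫ : ℝ) * Complex.I) * (rK d (α / 2) c⁻¹ x : ℂ)) := by
      intro x
      have := sr_rK_nonneg d hβ0 hβ1 hl x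
      rw [ENNReal.toReal_ofReal (by positivity), Complex.real_smul]
      push_cast
      ring
    simp_rw [h1]
    rw [integral_const_mul, sr_rK_fourier d hβ0 hβ1 hl ξ hξ, sr_sq_rpow, ← Complex.ofReal_inv, ← Complex.ofReal_mul]
    congr 1
    have : 0 ≤ ‖ξ‖ ^ α := by positivity
    field_simp

lemma sr_ae_ne {d : ℕ} (hd : 1 ≤ d) : ∀ᵐ ξ : EuclideanSpace ℝ (Fin d), ξ ≠ 0 := by
  have : Nonempty (Fin d) := ⟨⟨0, hd⟩⟩
  have : Nontrivial (EuclideanSpace ℝ (Fin d)) := inferInstance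
  rw [ae_iff]
  simp

lemma sr_norm_char {d : ℕ} (ξ x : EuclideanSpace ℝ (Fin d)) : ‖Complex.exp (-Complex.I * ((⟪ξ, x⟫ : ℝ) : ℂ))‖ = 1 := by
  rw [Complex.norm_exp]; simp

lemma sr_pos_step1 {d : ℕ} (hd : 1 ≤ d) {α t ε : ℝ} (hα1 : 1 < α) (hα2 : α < 2) (ht : 0 < t) (hε : 0 < ε) (x : EuclideanSpace ℝ (Fin d)) :
    0 ≤ (∫ ξ : EuclideanSpace ℝ (Fin d), Complex.exp (-Complex.I * ((⟪ξ, x⟫ : ℝ) : ℂ)) *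
      ((Real.exp (-(t * ‖ξ‖ ^ α)) : ℂ) * (Real.exp (-(ε * ‖ξ‖ ^ 2)) : ℂ))).re := by
  have hlim : Tendsto (fun n : ℕ => ∫ ξ : EuclideanSpace ℝ (Fin d), Complex.exp (-Complex.I * ((⟪ξ, x⟫ : ℝ) : ℂ)) *
      (((((1 + t / ((n:ℝ) + 1) * ‖ξ‖ ^ α)⁻¹) ^ (n + 1) : ℝ) : ℂ) * (Real.exp (-(ε * ‖ξ‖ ^ 2)) : ℂ))) atTop (𝓝 (∫ ξ : EuclideanSpace ℝ (Fin d), Complex.exp (-Complex.I * ((⟪ξ, x⟫ : ℝ) : ℂ)) *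
      ((Real.exp (-(t * ‖ξ‖ ^ α)) : ℂ) * (Real.exp (-(ε * ‖ξ‖ ^ 2)) : ℂ)))) := by
    apply tendsto_integral_of_dominated_convergence _ _ (sr_gauss_real (d := d) hε).1
    · intro n
      filter_upwards with ξ
      have : 0 ≤ t / ((n:ℝ) + 1) * ‖ξ‖ ^ α := by positivity
      rw [norm_mul, norm_mul, sr_norm_char, Complex.norm_real, Complex.norm_real, Real.norm_of_nonneg (by positivity), Real.norm_of_nonneg (by positivity), one_mul]
      calc _ ≤ 1 * Real.exp (-(ε * ‖ξ‖ ^ 2)) := by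
            gcongr
            apply pow_le_one₀ (by positivity)
            apply inv_le_one_of_one_le₀
            linarith
        _ = _ := one_mul _
    · filter_upwards with ξ
      apply Tendsto.const_mul
      apply Tendsto.mul_const
      apply (Complex.continuous_ofReal.tendsto _).comp
      have h1 := (Real.tendsto_one_add_div_pow_exp (t * ‖ξ‖ ^ α)).comp (tendsto_add_atTop_nat 1)
      have h2 := h1.inv₀ (Real.exp_ne_zero _)
      rw [← Real.exp_neg] at h2
      refine h2.congr fun n => ?_
      simp only [Function.comp, inv_pow]
      push_cast
      congr 3
      ring
    · intro n
      apply Measurable.aestronglyMeasurable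
      fun_prop
  refine ge_of_tendsto ((Complex.continuous_re.tendsto _).comp hlim) ?_
  filter_upwards with n
  obtain ⟨ν, hν, hch⟩ := sr_exists_measure d hα1 hα2 (show 0 < t / ((n:ℝ) + 1) by positivity) (n + 1)
  have h := sr_pos_fourier ν hε x
  simp only [Function.comp]
  refine h.trans_eq (congrArg Complex.re (integral_congr_ae ?_))
  filter_upwards [sr_ae_ne hd] with ξ hξ
  rw [hch ξ hξ]

lemma sr_pos_step2 {d : ℕ} (hd : 1 ≤ d) {α t : ℝ} (hα1 : 1 < α) (hα2 : α < 2) (ht : 0 < t) (x : EuclideanSpace ℝ (Fin d)) :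
    0 ≤ (∫ ξ : EuclideanSpace ℝ (Fin d), Complex.exp (-Complex.I * ((⟪ξ, x⟫ : ℝ) : ℂ)) *
      (Real.exp (-(t * ‖ξ‖ ^ α)) : ℂ)).re := by
  have hlim : Tendsto (fun n : ℕ => ∫ ξ : EuclideanSpace ℝ (Fin d), Complex.exp (-Complex.I * ((⟪ξ, x⟫ : ℝ) : ℂ)) *
      ((Real.exp (-(t * ‖ξ‖ ^ α)) : ℂ) * (Real.exp (-(1 / ((n:ℝ) + 1) * ‖ξ‖ ^ 2)) : ℂ))) atTop (𝓝 (∫ ξ : EuclideanSpace ℝ (Fin d), Complex.exp (-Complex.I * ((⟪ξ, x⟫ : ℝ) : ℂ)) *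
      (Real.exp (-(t * ‖ξ‖ ^ α)) : ℂ))) := by
    apply tendsto_integral_of_dominated_convergence _ _ (sr_int_exp (d := d) hα1 ht)
    · intro n
      filter_upwards with ξ
      rw [norm_mul, norm_mul, sr_norm_char, Complex.norm_real, Complex.norm_real, Real.norm_of_nonneg (by positivity), Real.norm_of_nonneg (by positivity), one_mul]
      calc _ ≤ Real.exp (-(t * ‖ξ‖ ^ α)) * 1 := by
            gcongr
            apply Real.exp_le_one_iff.2
            have : 0 ≤ 1 / ((n:ℝ) + 1) * ‖ξ‖ ^ 2 := by positivity
            linarith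
        _ = _ := mul_one _
    · filter_upwards with ξ
      apply Tendsto.const_mul
      rw [show (𝓝 (Real.exp (-(t * ‖ξ‖ ^ α)) : ℂ)) = 𝓝 ((Real.exp (-(t * ‖ξ‖ ^ α)) : ℂ) * ((Real.exp (-(0 * ‖ξ‖ ^ 2)) : ℝ) : ℂ)) by simp]
      apply Tendsto.const_mul
      apply (Complex.continuous_ofReal.tendsto _).comp
      apply (Real.continuous_exp.tendsto _).comp
      exact ((tendsto_one_div_add_atTop_nhds_zero_nat (𝕜 := ℝ)).mul_const _).neg
    · intro n
      apply Measurable.aestronglyMeasurable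
      fun_prop
  refine ge_of_tendsto ((Complex.continuous_re.tendsto _).comp hlim) ?_
  filter_upwards with n
  exact sr_pos_step1 hd hα1 hα2 ht (by positivity) x

end Part5

section Part6
open MeasureTheory Filter Topology
open scoped ENNReal RealInnerProductSpace FourierTransform

lemma sr_inv {d : ℕ} (hd : 1 ≤ d) {f g : EuclideanSpace ℝ (Fin d) → ℝ} (hf : Integrable f) (hg : Integrable g)
    (hfg : ∀ ξ, ξ ≠ 0 → ∫ x, Complex.exp ((⟪x, ξ⟫ : ℝ) * Complex.I) * (f x : ℂ) = (g ξ : ℂ))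
    {v : EuclideanSpace ℝ (Fin d)} (hv : ContinuousAt f v) :
    (((2 * Real.pi) ^ (-(d : ℝ)) : ℝ) : ℂ) * ∫ ξ : EuclideanSpace ℝ (Fin d),
      Complex.exp (-Complex.I * ((⟪ξ, v⟫ : ℝ) : ℂ)) * (g ξ : ℂ) = (f v : ℂ) := by
  have hpi := Real.pi_pos
  have hne : (-(2 * Real.pi)) ≠ 0 := by linarith
  have hF : ∀ᵐ w : EuclideanSpace ℝ (Fin d), 𝓕 (fun x => (f x : ℂ)) w = (g ((-(2 * Real.pi)) • w) : ℂ) := by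
    filter_upwards [sr_ae_ne hd] with w hw
    rw [Real.fourier_eq', ← hfg _ (smul_ne_zero hne hw)]
    congr 1
    ext x
    rw [smul_eq_mul, inner_smul_right]
    congr 3
    push_cast
    ring
  have hgi : Integrable (fun w : EuclideanSpace ℝ (Fin d) => (g ((-(2 * Real.pi)) • w) : ℂ)) :=
    ((integrable_comp_smul_iff volume g hne).2 hg).ofReal
  have h := (hf.ofReal (𝕜 := ℂ)).fourierInv_fourier_eq (hgi.congr (hF.mono fun _ h => h.symm))
    (v := v) (Complex.continuous_ofReal.continuousAt.comp hv)
  rw [Real.fourierInv_eq'] at h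
  refine Eq.trans ?_ h
  have h2 : ∫ w : EuclideanSpace ℝ (Fin d), Complex.exp (((2 * Real.pi * ⟪w, v⟫ : ℝ) : ℂ) * Complex.I) • 𝓕 (fun x => (f x : ℂ)) w
     = ∫ w, (fun ξ : EuclideanSpace ℝ (Fin d) => Complex.exp (-Complex.I * ((⟪ξ, v⟫ : ℝ) : ℂ)) * (g ξ : ℂ)) ((-(2 * Real.pi)) • w) := by
    apply integral_congr_ae
    filter_upwards [hF] with w hw
    rw [hw, smul_eq_mul]
    congr 2
    rw [inner_smul_left]
    simp
    ring
  refine Eq.trans ?_ h2.symm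
  refine Eq.trans ?_ (Measure.integral_comp_smul volume (fun ξ : EuclideanSpace ℝ (Fin d) => Complex.exp (-Complex.I * ((⟪ξ, v⟫ : ℝ) : ℂ)) * (g ξ : ℂ)) (-(2 * Real.pi))).symm
  rw [finrank_euclideanSpace, Fintype.card_fin, Complex.real_smul]
  congr 2
  rw [abs_inv, abs_pow, abs_neg, abs_of_pos (by positivity), Real.rpow_neg (by positivity), Real.rpow_natCast]

noncomputable def wK (n : ℕ) (l a t : ℝ) : ℝ := (1 - Real.exp (-(a * t))) ^ n * Real.exp (-(l * t))
noncomputable def sK (n : ℕ) (l a X : ℝ) : ℝ :=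
  ∑ k ∈ Finset.range (n + 1), (-1) ^ k * (n.choose k : ℝ) * (l + k * a + X)⁻¹

lemma sr_exp1 {r : ℝ} (hr : 0 < r) : IntegrableOn (fun t => Real.exp (-(r * t))) (Set.Ioi 0) ∧
    ∫ t in Set.Ioi (0:ℝ), Real.exp (-(r * t)) = r⁻¹ := by
  have := sr_gamma (a := 1) one_pos hr
  simpa using this

lemma sr_wK_exp (n : ℕ) (l a X t : ℝ) : wK n l a t * Real.exp (-(t * X)) =
    ∑ k ∈ Finset.range (n + 1), (-1) ^ k * (n.choose k : ℝ) * Real.exp (-((l + k * a + X) * t)) := by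
  rw [wK, sub_eq_neg_add, add_pow, Finset.sum_mul, Finset.sum_mul]
  apply Finset.sum_congr rfl
  intro k _
  rw [neg_pow, ← Real.exp_nat_mul, one_pow, mul_one]
  rw [show (-((l + k * a + X) * t)) = k * (-(a * t)) + (-(l * t)) + (-(t * X)) by ring, Real.exp_add, Real.exp_add]
  ring

lemma sr_wK_int (n : ℕ) {l a X : ℝ} (hl : 0 < l) (ha : 0 < a) (hX : 0 ≤ X) :
    IntegrableOn (fun t => wK n l a t * Real.exp (-(t * X))) (Set.Ioi 0) ∧
    ∫ t in Set.Ioi (0:ℝ), wK n l a t * Real.exp (-(t * X)) = sK n l a X := by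
  have h : ∀ k : ℕ, 0 < l + k * a + X := fun k => by positivity
  simp_rw [sr_wK_exp]
  constructor
  · exact integrable_finsetSum _ fun k _ => (sr_exp1 (h k)).1.const_mul _
  · rw [integral_finsetSum _ fun k _ => (sr_exp1 (h k)).1.const_mul _]
    simp_rw [integral_const_mul, (sr_exp1 (h _)).2]
    rfl

lemma sr_wK_bd (n : ℕ) {l a t : ℝ} (ha : 0 < a) (ht : 0 < t) :
    0 ≤ wK n l a t ∧ wK n l a t ≤ a ^ n * t ^ n * Real.exp (-(l * t)) := by
  have h1 : Real.exp (-(a * t)) ≤ 1 := Real.exp_le_one_iff.2 (by nlinarith [mul_pos ha ht])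
  have h2 := Real.add_one_le_exp (-(a * t))
  unfold wK
  constructor
  · have : 0 ≤ 1 - Real.exp (-(a * t)) := by linarith
    positivity
  · rw [← mul_pow]
    gcongr
    · linarith

lemma sr_sK_bd (n : ℕ) {l a X : ℝ} (hl : 0 < l) (ha : 0 < a) (hX : 0 ≤ X) :
    0 ≤ sK n l a X ∧ sK n l a X ≤ a ^ n * Real.Gamma (n + 1) * ((l + X) ^ (n + 1))⁻¹ := by
  rw [← (sr_wK_int n hl ha hX).2]
  constructor
  · apply setIntegral_nonneg measurableSet_Ioi
    intro t ht
    have := (sr_wK_bd n (l := l) ha ht).1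
    positivity
  · have hG := sr_gamma (a := (n:ℝ) + 1) (r := l + X) (by positivity) (by positivity)
    calc _ ≤ ∫ t in Set.Ioi (0:ℝ), a ^ n * (t ^ ((n:ℝ) + 1 - 1) * Real.exp (-((l + X) * t))) := by
          apply setIntegral_mono_on (sr_wK_int n hl ha hX).1 (hG.1.const_mul _) measurableSet_Ioi
          intro t ht
          have := (sr_wK_bd n (l := l) ha ht).2
          calc _ ≤ (a ^ n * t ^ n * Real.exp (-(l * t))) * Real.exp (-(t * X)) := by gcongr
            _ = _ := by
              rw [add_sub_cancel_right, Real.rpow_natCast, mul_assoc, mul_assoc, ← Real.exp_add]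
              congr 3
              ring_nf
      _ = _ := by
        rw [integral_const_mul, hG.2, one_div, Real.inv_rpow (by positivity), ← Nat.cast_add_one, Real.rpow_natCast]
        ring

lemma sr_sK_int {d : ℕ} {α l a : ℝ} (hα : 1 < α) (hl : 0 < l) (ha : 0 < a) :
    Integrable (fun ξ : EuclideanSpace ℝ (Fin d) => sK d l a (‖ξ‖ ^ α)) := by
  refine Integrable.mono' ((sr_int_pow (d := d) hα hl (Nat.lt_succ_self d)).const_mul (a ^ d * Real.Gamma (d + 1))) ?_ ?_
  · apply Measurable.aestronglyMeasurable
    unfold sK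
    fun_prop
  · filter_upwards with ξ
    have := sr_sK_bd d hl ha (show 0 ≤ ‖ξ‖ ^ α by positivity)
    rw [Real.norm_of_nonneg this.1]
    exact this.2

lemma sr_fub {d : ℕ} {α l a : ℝ} (hα : 1 < α) (hl : 0 < l) (ha : 0 < a) (x : EuclideanSpace ℝ (Fin d)) :
    Integrable (Function.uncurry fun (t : ℝ) (ξ : EuclideanSpace ℝ (Fin d)) => Complex.exp (-Complex.I * ((⟪ξ, x⟫ : ℝ) : ℂ)) *
      ((wK d l a t * Real.exp (-(t * ‖ξ‖ ^ α)) : ℝ) : ℂ)) ((volume.restrict (Set.Ioi 0)).prod volume) := by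
  have hm : Measurable (Function.uncurry fun (t : ℝ) (ξ : EuclideanSpace ℝ (Fin d)) => Complex.exp (-Complex.I * ((⟪ξ, x⟫ : ℝ) : ℂ)) *
      ((wK d l a t * Real.exp (-(t * ‖ξ‖ ^ α)) : ℝ) : ℂ)) := by
    unfold wK Function.uncurry
    fun_prop
  have hX : ∀ ξ : EuclideanSpace ℝ (Fin d), 0 ≤ ‖ξ‖ ^ α := fun ξ => by positivity
  rw [integrable_prod_iff' hm.aestronglyMeasurable]
  constructor
  · filter_upwards with ξ
    exact ((sr_wK_int d hl ha (hX ξ)).1.ofReal (𝕜 := ℂ)).const_mul (Complex.exp (-Complex.I * ((⟪ξ, x⟫ : ℝ) : ℂ)))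
  · refine (sr_sK_int (d := d) hα hl ha).congr ?_
    filter_upwards with ξ
    rw [← (sr_wK_int d hl ha (hX ξ)).2]
    apply setIntegral_congr_fun measurableSet_Ioi
    intro t ht
    have := (sr_wK_bd d (l := l) ha ht).1
    simp only [Function.uncurry]
    rw [norm_mul, sr_norm_char, one_mul, Complex.norm_real, Real.norm_of_nonneg (by positivity)]

end Part6

section Part7
open scoped FourierTransform

lemma sr_stableP {d : ℕ} (α t : ℝ) (x : EuclideanSpace ℝ (Fin d)) : stableP d α t x =
    (2 * Real.pi) ^ (-(d : ℝ)) * (∫ ξ : EuclideanSpace ℝ (Fin d), Complex.exp (-Complex.I * ((⟪ξ, x⟫ : ℝ) : ℂ)) *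
      (Real.exp (-(t * ‖ξ‖ ^ α)) : ℂ)).re := by
  rw [stableP, Complex.re_ofReal_mul]
  congr 3
  ext ξ
  congr 1
  push_cast
  congr 1
  ring

lemma sr_stableP_nonneg {d : ℕ} (hd : 1 ≤ d) {α t : ℝ} (hα1 : 1 < α) (hα2 : α < 2) (ht : 0 < t) (x : EuclideanSpace ℝ (Fin d)) :
    0 ≤ stableP d α t x := by
  rw [sr_stableP]
  have := sr_pos_step2 hd hα1 hα2 ht x
  have := Real.pi_pos
  positivity

lemma sr_rK_cont {d : ℕ} {β l : ℝ} (hβ0 : 0 < β) (hβ1 : β < 1) (hl : 0 < l) {x : EuclideanSpace ℝ (Fin d)} (hx : x ≠ 0) :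
    ContinuousAt (rK d β l) x := by
  unfold rK
  have hq : 0 < ‖x‖ ^ 2 := by positivity
  have h := (sr_iK_deriv (k := (d:ℝ)/2) hβ0 hβ1 hl (by positivity) hq).continuousAt
  apply ContinuousAt.mul continuousAt_const
  exact ContinuousAt.comp (f := fun x : EuclideanSpace ℝ (Fin d) => ‖x‖ ^ 2) h (by fun_prop)

lemma sr_rK_bd {d : ℕ} {β : ℝ} (hβ0 : 0 < β) (hβ1 : β < 1) {x : EuclideanSpace ℝ (Fin d)} (hx : x ≠ 0) :
    ∃ C : ℝ, ∀ l, 0 < l → rK d β l x ≤ C * (l ^ 2)⁻¹ := by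
  have hpi := Real.pi_pos
  have hq : 0 < ‖x‖ ^ 2 := by positivity
  obtain ⟨A, hA, hb⟩ := sr_iK_bound hβ0 hβ1
  have hG := sr_gamma (a := (d:ℝ)/2 + β) (r := ‖x‖ ^ 2 / 4) (by positivity) (by positivity)
  refine ⟨(4 * Real.pi) ^ (-((d:ℝ) / 2)) * (A * ((1 / (‖x‖ ^ 2 / 4)) ^ ((d:ℝ)/2 + β) * Real.Gamma ((d:ℝ)/2 + β))), fun l hl => ?_⟩
  unfold rK
  rw [mul_assoc]
  gcongr
  rw [iK]
  calc _ ≤ ∫ w in Set.Ioi (0:ℝ), A * (l ^ 2)⁻¹ * (w ^ (((d:ℝ)/2 + β) - 1) * Real.exp (-(‖x‖ ^ 2 / 4 * w))) := by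
        apply setIntegral_mono_on (sr_iK_integrable hβ0 hβ1 hl (by positivity) hq) (hG.1.const_mul _) measurableSet_Ioi
        intro w hw
        exact (hb l _ _ w hl hw).2
    _ = _ := by
      rw [integral_const_mul, hG.2]
      ring

noncomputable def fK (d : ℕ) (β l a : ℝ) (x : EuclideanSpace ℝ (Fin d)) : ℝ :=
  ∑ k ∈ Finset.range (d + 1), (-1) ^ k * (d.choose k : ℝ) * rK d β (l + k * a) x

lemma sr_fK_four {d : ℕ} {α l a : ℝ} (hα1 : 1 < α) (hα2 : α < 2) (hl : 0 < l) (ha : 0 < a)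
    (ξ : EuclideanSpace ℝ (Fin d)) (hξ : ξ ≠ 0) :
    ∫ x, Complex.exp ((⟪x, ξ⟫ : ℝ) * Complex.I) * (fK d (α/2) l a x : ℂ) = ((sK d l a (‖ξ‖ ^ α) : ℝ) : ℂ) := by
  have hβ0 : 0 < α / 2 := by linarith
  have hβ1 : α / 2 < 1 := by linarith
  have h : ∀ k : ℕ, 0 < l + k * a := fun k => by positivity
  have hi : ∀ k : ℕ, Integrable (fun x : EuclideanSpace ℝ (Fin d) => Complex.exp ((⟪x, ξ⟫ : ℝ) * Complex.I) * (rK d (α/2) (l + k * a) x : ℂ)) := by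
    intro k
    refine ((sr_rK_integrable d hβ0 hβ1 (h k)).ofReal (𝕜 := ℂ)).bdd_mul (c := 1) (f := fun x : EuclideanSpace ℝ (Fin d) => Complex.exp ((⟪x, ξ⟫ : ℝ) * Complex.I)) ?_ ?_
    · apply Continuous.aestronglyMeasurable
      fun_prop
    · filter_upwards with p
      rw [Complex.norm_exp_ofReal_mul_I]
  have h1 : ∀ x : EuclideanSpace ℝ (Fin d), Complex.exp ((⟪x, ξ⟫ : ℝ) * Complex.I) * (fK d (α/2) l a x : ℂ) =
     ∑ k ∈ Finset.range (d + 1), ((-1) ^ k * (d.choose k : ℂ)) * (Complex.exp ((⟪x, ξ⟫ : ℝ) * Complex.I) * (rK d (α/2) (l + k * a) x : ℂ)) := by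
    intro x
    rw [fK]
    push_cast
    rw [Finset.mul_sum]
    exact Finset.sum_congr rfl fun k _ => by ring
  simp_rw [h1]
  rw [integral_finsetSum _ fun k _ => (hi k).const_mul _, sK]
  push_cast
  apply Finset.sum_congr rfl
  intro k _
  rw [integral_const_mul, sr_rK_fourier d hβ0 hβ1 (h k) ξ hξ, sr_sq_rpow]
  push_cast
  rfl

lemma sr_fK_main {d : ℕ} (hd : 1 ≤ d) {α l a : ℝ} (hα1 : 1 < α) (hα2 : α < 2) (hl : 0 < l) (ha : 0 < a)
    {x : EuclideanSpace ℝ (Fin d)} (hx : x ≠ 0) :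
    IntegrableOn (fun t => wK d l a t * stableP d α t x) (Set.Ioi 0) ∧
    ∫ t in Set.Ioi (0:ℝ), wK d l a t * stableP d α t x = fK d (α/2) l a x := by
  have hβ0 : 0 < α / 2 := by linarith
  have hβ1 : α / 2 < 1 := by linarith
  have h : ∀ k : ℕ, 0 < l + k * a := fun k => by positivity
  have hF := sr_fub hα1 hl ha x
  have h1 : (fun t => wK d l a t * stableP d α t x) = fun t => (2 * Real.pi) ^ (-(d : ℝ)) * Complex.reCLM (∫ ξ : EuclideanSpace ℝ (Fin d), Complex.exp (-Complex.I * ((⟪ξ, x⟫ : ℝ) : ℂ)) *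
      ((wK d l a t * Real.exp (-(t * ‖ξ‖ ^ α)) : ℝ) : ℂ)) := by
    ext t
    rw [sr_stableP, mul_left_comm, Complex.reCLM_apply, ← Complex.re_ofReal_mul, ← integral_const_mul]
    congr 3
    ext ξ
    push_cast
    ring
  have hI : Integrable (fun t => ∫ ξ : EuclideanSpace ℝ (Fin d), Complex.exp (-Complex.I * ((⟪ξ, x⟫ : ℝ) : ℂ)) *
      ((wK d l a t * Real.exp (-(t * ‖ξ‖ ^ α)) : ℝ) : ℂ)) (volume.restrict (Set.Ioi 0)) := hF.integral_prod_left
  rw [h1]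
  refine ⟨(Complex.reCLM.integrable_comp hI).const_mul _, ?_⟩
  rw [integral_const_mul, ContinuousLinearMap.integral_comp_comm _ hI, integral_integral_swap hF, Complex.reCLM_apply, ← Complex.re_ofReal_mul]
  have h2 : ∀ ξ : EuclideanSpace ℝ (Fin d), ∫ t in Set.Ioi (0:ℝ), Complex.exp (-Complex.I * ((⟪ξ, x⟫ : ℝ) : ℂ)) *
      ((wK d l a t * Real.exp (-(t * ‖ξ‖ ^ α)) : ℝ) : ℂ) = Complex.exp (-Complex.I * ((⟪ξ, x⟫ : ℝ) : ℂ)) * ((sK d l a (‖ξ‖ ^ α) : ℝ) : ℂ) := by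
    intro ξ
    rw [integral_const_mul, integral_complex_ofReal, (sr_wK_int d hl ha (by positivity)).2]
  simp_rw [h2]
  rw [sr_inv hd (f := fK d (α/2) l a) ?_ (sr_sK_int hα1 hl ha) (sr_fK_four hα1 hα2 hl ha) ?_, Complex.ofReal_re]
  · exact integrable_finsetSum _ fun k _ => (sr_rK_integrable d hβ0 hβ1 (h k)).const_mul _
  · unfold fK
    apply tendsto_finsetSum
    intro k _
    exact (sr_rK_cont hβ0 hβ1 (h k) hx).const_mul _

lemma sr_fK_lim {d : ℕ} {β l : ℝ} (hβ0 : 0 < β) (hβ1 : β < 1) (hl : 0 < l) {x : EuclideanSpace ℝ (Fin d)} (hx : x ≠ 0) :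
    Tendsto (fun m : ℕ => fK d β l ((m:ℝ) + 1) x) atTop (𝓝 (rK d β l x)) := by
  obtain ⟨C, hC⟩ := sr_rK_bd (d := d) hβ0 hβ1 hx
  have h0 : ∀ k : ℕ, Tendsto (fun m : ℕ => rK d β (l + ((k + 1 : ℕ) : ℝ) * ((m:ℝ) + 1)) x) atTop (𝓝 0) := by
    intro k
    have hp : ∀ m : ℕ, 0 < l + ((k + 1 : ℕ) : ℝ) * ((m:ℝ) + 1) := fun m => by positivity
    refine squeeze_zero (fun m => sr_rK_nonneg d hβ0 hβ1 (hp m) x) (fun m => hC _ (hp m)) ?_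
    rw [show (𝓝 (0:ℝ)) = 𝓝 (C * 0) by simp]
    apply Tendsto.const_mul
    apply tendsto_inv_atTop_zero.comp
    apply (tendsto_pow_atTop two_ne_zero).comp
    apply tendsto_atTop_add_const_left
    apply Tendsto.const_mul_atTop (by positivity)
    exact tendsto_atTop_add_const_right _ _ tendsto_natCast_atTop_atTop
  have h1 : ∀ m : ℕ, fK d β l ((m:ℝ) + 1) x = (∑ k ∈ Finset.range d, (-1) ^ (k+1) * (d.choose (k+1) : ℝ) * rK d β (l + ((k + 1 : ℕ) : ℝ) * ((m:ℝ) + 1)) x) + rK d β l x := by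
    intro m
    rw [fK, Finset.sum_range_succ']
    simp
  simp_rw [h1]
  have h2 := (tendsto_finsetSum (Finset.range d) fun k _ => (h0 k).const_mul ((-1) ^ (k+1) * (d.choose (k+1) : ℝ))).add_const (rK d β l x)
  simpa using h2

lemma sr_resKer {d : ℕ} (hd : 1 ≤ d) {α l : ℝ} (hα1 : 1 < α) (hα2 : α < 2) (hl : 0 < l)
    {x : EuclideanSpace ℝ (Fin d)} (hx : x ≠ 0) : resKer d α l x = rK d (α/2) l x := by
  have hβ0 : 0 < α / 2 := by linarith
  have hβ1 : α / 2 < 1 := by linarith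
  have hm : ∀ m : ℕ, (0:ℝ) < (m:ℝ) + 1 := fun m => by positivity
  have hP : ∀ t ∈ Set.Ioi (0:ℝ), 0 ≤ stableP d α t x := fun t ht => sr_stableP_nonneg hd hα1 hα2 ht x
  have hlim : ∀ᵐ t ∂(volume.restrict (Set.Ioi (0:ℝ))), Tendsto (fun m : ℕ => wK d l ((m:ℝ)+1) t * stableP d α t x) atTop
      (𝓝 (Real.exp (-(l * t)) * stableP d α t x)) := by
    filter_upwards [ae_restrict_mem measurableSet_Ioi] with t ht
    have ht : 0 < t := ht
    apply Tendsto.mul_const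
    unfold wK
    have : Tendsto (fun m : ℕ => Real.exp (-(((m:ℝ) + 1) * t))) atTop (𝓝 0) := by
      apply Real.tendsto_exp_neg_atTop_nhds_zero.comp
      apply Tendsto.atTop_mul_const ht
      exact tendsto_atTop_add_const_right _ _ tendsto_natCast_atTop_atTop
    have := ((this.const_sub 1).pow d).mul_const (Real.exp (-(l * t)))
    simpa using this
  have hmeas : AEStronglyMeasurable (fun t => Real.exp (-(l * t)) * stableP d α t x) (volume.restrict (Set.Ioi (0:ℝ))) :=
    aestronglyMeasurable_of_tendsto_ae atTop (fun m : ℕ => (sr_fK_main hd hα1 hα2 hl (hm m) hx).1.aestronglyMeasurable) hlim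
  have hmono : ∀ᵐ t ∂(volume.restrict (Set.Ioi (0:ℝ))), Monotone (fun m : ℕ => ENNReal.ofReal (wK d l ((m:ℝ)+1) t * stableP d α t x)) := by
    filter_upwards [ae_restrict_mem measurableSet_Ioi] with t ht m m' hmm
    have h1 := hP t ht
    have ht : 0 < t := ht
    have h2 : (m:ℝ) ≤ m' := by exact_mod_cast hmm
    have h3 : Real.exp (-(((m:ℝ) + 1) * t)) ≤ 1 := Real.exp_le_one_iff.2 (by have := mul_pos (hm m) ht; linarith)
    apply ENNReal.ofReal_le_ofReal
    unfold wK
    gcongr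
  have key := lintegral_tendsto_of_tendsto_of_monotone (μ := volume.restrict (Set.Ioi (0:ℝ)))
    (f := fun (m : ℕ) t => ENNReal.ofReal (wK d l ((m:ℝ)+1) t * stableP d α t x))
    (F := fun t => ENNReal.ofReal (Real.exp (-(l * t)) * stableP d α t x))
    (fun m => (sr_fK_main hd hα1 hα2 hl (hm m) hx).1.aemeasurable.ennreal_ofReal) hmono
    (hlim.mono fun t ht => (ENNReal.continuous_ofReal.tendsto _).comp ht)
  have h2 : ∀ m : ℕ, ∫⁻ t in Set.Ioi (0:ℝ), ENNReal.ofReal (wK d l ((m:ℝ)+1) t * stableP d α t x) = ENNReal.ofReal (fK d (α/2) l ((m:ℝ)+1) x) := by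
    intro m
    rw [← (sr_fK_main hd hα1 hα2 hl (hm m) hx).2, ofReal_integral_eq_lintegral_ofReal (sr_fK_main hd hα1 hα2 hl (hm m) hx).1]
    filter_upwards [ae_restrict_mem measurableSet_Ioi] with t ht
    exact mul_nonneg (sr_wK_bd d (hm m) ht).1 (hP t ht)
  simp_rw [h2] at key
  have h3 := tendsto_nhds_unique key ((ENNReal.continuous_ofReal.tendsto _).comp (sr_fK_lim hβ0 hβ1 hl hx))
  rw [resKer, integral_eq_lintegral_of_nonneg_ae _ hmeas, h3, ENNReal.toReal_ofReal (sr_rK_nonneg d hβ0 hβ1 hl x)]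
  filter_upwards [ae_restrict_mem measurableSet_Ioi] with t ht
  exact mul_nonneg (Real.exp_pos _).le (hP t ht)

end Part7

lemma sr_iK_contDiff {β l k : ℝ} (hβ0 : 0 < β) (hβ1 : β < 1) (hl : 0 < l) (hk : 0 < k + β) :
    ContDiffOn ℝ 1 (iK β l k) (Set.Ioi 0) := by
  have hd : ∀ q ∈ Set.Ioi (0:ℝ), HasDerivAt (iK β l k) (-(1/4)*iK β l (k+1) q) q := fun q hq => sr_iK_deriv hβ0 hβ1 hl hk hq
  rw [show (1 : WithTop ℕ∞) = 0 + 1 by simp, contDiffOn_succ_iff_deriv_of_isOpen isOpen_Ioi]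
  refine ⟨fun q hq => (hd q hq).differentiableAt.differentiableWithinAt, by simp, ?_⟩
  rw [contDiffOn_zero]
  refine ContinuousOn.congr (f := fun q => -(1/4)*iK β l (k+1) q) ?_ fun q hq => (hd q hq).deriv
  intro q hq
  apply ContinuousAt.continuousWithinAt
  exact continuousAt_const.mul (sr_iK_deriv hβ0 hβ1 hl (by linarith) hq).continuousAt

lemma sr_grad {d : ℕ} (hd : 1 ≤ d) {α l : ℝ} (hα1 : 1 < α) (hα2 : α < 2) (hl : 0 < l)
    {z : EuclideanSpace ℝ (Fin d)} (hz : z ≠ 0) :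
    ‖gradient (resKer d α l) z‖ = (1/2) * (4 * Real.pi) ^ (-((d:ℝ) / 2)) * (iK (α/2) l ((d:ℝ)/2 + 1) (‖z‖ ^ 2) * ‖z‖) := by
  have hβ0 : 0 < α / 2 := by linarith
  have hβ1 : α / 2 < 1 := by linarith
  have hpi := Real.pi_pos
  have hq : 0 < ‖z‖ ^ 2 := by positivity
  have h1 : resKer d α l =ᶠ[𝓝 z] rK d (α/2) l := by
    filter_upwards [isOpen_ne.mem_nhds hz] with x hx
    exact sr_resKer hd hα1 hα2 hl hx
  have h2 := ((sr_iK_deriv (k := (d:ℝ)/2) hβ0 hβ1 hl (by positivity) hq).const_mul ((4 * Real.pi) ^ (-((d:ℝ) / 2)))).comp_hasFDerivAt z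
    (hasStrictFDerivAt_norm_sq z).hasFDerivAt
  have h3 : fderiv ℝ (resKer d α l) z = _ := (h1.fderiv_eq).trans (HasFDerivAt.fderiv (f := rK d (α/2) l) h2)
  have hn := sr_iK_nonneg (k := (d:ℝ)/2 + 1) (q := ‖z‖^2) hβ0 hβ1 hl
  rw [gradient, LinearIsometryEquiv.norm_map, h3, norm_smul, two_smul, ← two_smul ℝ, norm_smul, innerSL_apply_norm, Real.norm_eq_abs,
    abs_mul, abs_mul, abs_of_nonneg hn, abs_of_pos (by positivity)]
  norm_num
  ring

lemma sr_pow_conv {d : ℕ} {z : EuclideanSpace ℝ (Fin d)} (hz : z ≠ 0) (s : ℝ) :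
    (‖z‖ ^ 2) ^ (-((d:ℝ)/2 + 1 + s / 2)) * ‖z‖ = ‖z‖ ^ (-((d:ℝ) + 1 + s)) := by
  have h : 0 < ‖z‖ := norm_pos_iff.2 hz
  rw [← Real.rpow_natCast, ← Real.rpow_mul h.le]
  nth_rewrite 2 [← Real.rpow_one ‖z‖]
  rw [← Real.rpow_add h]
  congr 1
  push_cast
  ring

/-- for every `λ > 0`, `r_λ` is `C^1` off the origin, and
`|∇r_λ(z)| ≍ |z|^{-(d+1-α)} ∧ λ^{-2}|z|^{-(d+1+α)}` with a constant depending only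
on `d` and `α`. -/
theorem stmt5 (d : ℕ) (hd : 1 ≤ d) (α : ℝ) (hα1 : 1 < α) (hα2 : α < 2) :
    (∀ l : ℝ, 0 < l →
      ContDiffOn ℝ 1 (resKer d α l) {z : EuclideanSpace ℝ (Fin d) | z ≠ 0}) ∧
    ∃ c : ℝ, 1 < c ∧ ∀ l : ℝ, 0 < l → ∀ z : EuclideanSpace ℝ (Fin d), z ≠ 0 →
      c⁻¹ * min (‖z‖ ^ (-((d : ℝ) + 1 - α))) (l ^ (-(2 : ℝ)) * ‖z‖ ^ (-((d : ℝ) + 1 + α))) ≤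
          ‖gradient (resKer d α l) z‖ ∧
      ‖gradient (resKer d α l) z‖ ≤
          c * min (‖z‖ ^ (-((d : ℝ) + 1 - α))) (l ^ (-(2 : ℝ)) * ‖z‖ ^ (-((d : ℝ) + 1 + α))) := by
  have hβ0 : 0 < α / 2 := by linarith
  have hβ1 : α / 2 < 1 := by linarith
  have hpi := Real.pi_pos
  constructor
  · intro l hl
    refine ContDiffOn.congr (f := rK d (α/2) l) ?_ fun x hx => sr_resKer hd hα1 hα2 hl hx
    unfold rK
    apply ContDiffOn.mul contDiffOn_const
    refine (sr_iK_contDiff (k := (d:ℝ)/2) hβ0 hβ1 hl (by positivity)).comp (contDiff_norm_sq ℝ).contDiffOn ?_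
    intro x hx
    have : x ≠ 0 := hx
    show 0 < ‖x‖ ^ 2
    positivity
  · have hd1 : (1:ℝ) ≤ d := by exact_mod_cast hd
    obtain ⟨A, c, hA, hc, hb⟩ := sr_iK_bounds (k := (d:ℝ)/2 + 1) hβ0 hβ1 (by linarith)
    set K : ℝ := (1/2) * (4 * Real.pi) ^ (-((d:ℝ) / 2)) with hK
    have hKp : 0 < K := by positivity
    have hinv : 0 < (K * c)⁻¹ := by positivity
    refine ⟨1 + K * A + (K * c)⁻¹, by linarith [mul_pos hKp hA], fun l hl z hz => ?_⟩
    have hzp : 0 < ‖z‖ := norm_pos_iff.2 hz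
    rw [sr_grad hd hα1 hα2 hl hz, ← hK]
    obtain ⟨b1, b2, b3⟩ := hb l (‖z‖ ^ 2) hl (by positivity)
    have e1 : (‖z‖ ^ 2) ^ (-((d:ℝ)/2 + 1 - α / 2)) * ‖z‖ = ‖z‖ ^ (-((d:ℝ) + 1 - α)) := by
      have := sr_pow_conv hz (-α)
      rw [neg_div] at this
      simpa only [← sub_eq_add_neg] using this
    have e2 := sr_pow_conv hz α
    have e3 : l ^ (-(2:ℝ)) = (l ^ 2)⁻¹ := by
      rw [Real.rpow_neg hl.le]; norm_num
    rw [e3, ← e1, ← e2, ← mul_assoc (l ^ 2)⁻¹, ← min_mul_of_nonneg _ _ hzp.le]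
    set M := min ((‖z‖ ^ 2) ^ (-((d:ℝ)/2 + 1 - α / 2))) ((l ^ 2)⁻¹ * (‖z‖ ^ 2) ^ (-((d:ℝ)/2 + 1 + α / 2))) with hM
    have hMp : 0 ≤ M := le_min (by positivity) (by positivity)
    have b4 : iK (α/2) l ((d:ℝ)/2 + 1) (‖z‖ ^ 2) ≤ A * M := by
      rw [hM, mul_min_of_nonneg _ _ hA.le]
      exact le_min b1 b2
    have hKA := mul_pos hKp hA
    constructor
    · have h1 : (1 + K * A + (K * c)⁻¹)⁻¹ ≤ K * c := by
        apply inv_le_of_inv_le₀ (by positivity)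
        linarith
      calc _ ≤ K * c * (M * ‖z‖) := by gcongr
        _ = K * ((c * M) * ‖z‖) := by ring
        _ ≤ _ := by gcongr
    · calc _ ≤ K * ((A * M) * ‖z‖) := by gcongr
        _ = (K * A) * (M * ‖z‖) := by ring
        _ ≤ _ := by gcongr; linarith
end

section
/- Let d ≥ 1, α ∈ (1,2) and λ > 0. For every f ∈ C_0(ℝ^d) (continuous functions vanishing at infinity), R_λ f is continuously differentiable on ℝ^d with ∇R_λ f(x) = ∫_{ℝ^d} ∇r_λ(x−y) f(y) dy, both R_λ f and each component of ∇R_λ f belong to C_0(ℝ^d), and there is a constant c > 0 (depending on d, α, λ) such that ‖R_λ f‖_∞ ≤ c ‖f‖_∞ and ‖∇R_λ f‖_∞ ≤ c ‖f‖_∞ for all f ∈ C_0(ℝ^d). -/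
open MeasureTheory Filter Topology
open scoped ENNReal RealInnerProductSpace

/-- The resolvent operator `R_λ g(x) = ∫ r_λ(x-y) g(y) dy`. -/
noncomputable def resOp (d : ℕ) (α : ℝ) (l : ℝ) (g : EuclideanSpace ℝ (Fin d) → ℝ)
    (x : EuclideanSpace ℝ (Fin d)) : ℝ :=
  ∫ y, resKer d α l (x - y) * g y


/-- convolution powers of `ν`, started from a Dirac mass at `δ`. -/
noncomputable def convPow (ν : Measure ℝ) (δ : ℝ) : ℕ → Measure ℝ
  | 0 => Measure.dirac δ
  | (k+1) => (convPow ν δ k).conv ν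

lemma convPow_finite (ν : Measure ℝ) [IsFiniteMeasure ν] (δ : ℝ) (k : ℕ) :
    IsFiniteMeasure (convPow ν δ k) := by
  induction k with
  | zero => unfold convPow; infer_instance
  | succ k ih => unfold convPow; infer_instance

lemma convPow_laplace (ν : Measure ℝ) [IsFiniteMeasure ν] (δ z : ℝ) (k : ℕ) :
    ∫⁻ s, ENNReal.ofReal (Real.exp (-(s*z))) ∂(convPow ν δ k)
      = ENNReal.ofReal (Real.exp (-(δ*z))) *
        (∫⁻ s, ENNReal.ofReal (Real.exp (-(s*z))) ∂ν)^k := by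
  induction k with
  | zero =>
    unfold convPow
    rw [lintegral_dirac' _ (by fun_prop)]; simp
  | succ k ih =>
    have := convPow_finite ν δ k
    unfold convPow
    rw [Measure.lintegral_conv (by fun_prop)]
    have : ∀ x y : ℝ, ENNReal.ofReal (Real.exp (-((x+y)*z)))
        = ENNReal.ofReal (Real.exp (-(x*z))) * ENNReal.ofReal (Real.exp (-(y*z))) := by
      intro x y
      rw [← ENNReal.ofReal_mul (Real.exp_pos _).le, ← Real.exp_add]; congr 2; ring
    simp_rw [this]
    simp_rw [lintegral_const_mul _ (show Measurable fun y : ℝ => ENNReal.ofReal (Real.exp (-(y*z))) by fun_prop)]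
    rw [lintegral_mul_const _ (by fun_prop), ih, pow_succ, mul_assoc]

lemma convPow_supp (ν : Measure ℝ) [IsFiniteMeasure ν] (hν : ∀ᵐ s ∂ν, 0 ≤ s) (δ : ℝ) (k : ℕ) :
    ∀ᵐ s ∂(convPow ν δ k), δ ≤ s := by
  induction k with
  | zero =>
    unfold convPow
    rw [ae_dirac_iff measurableSet_Ici]
  | succ k ih =>
    have := convPow_finite ν δ k
    unfold convPow
    have hm : MeasurableSet {s : ℝ | ¬ δ ≤ s} := measurableSet_Ici.compl
    rw [ae_iff, ← lintegral_indicator_one hm, Measure.lintegral_conv (measurable_one.indicator hm)]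
    rw [lintegral_eq_zero_iff']
    · filter_upwards [ih] with x hx
      rw [lintegral_congr_ae (g := fun _ => 0)]
      · simp
      · filter_upwards [hν] with y hy
        simp; linarith
    · refine Measurable.aemeasurable ?_
      refine Measurable.lintegral_prod_right' (f := fun p : ℝ × ℝ => ({s : ℝ | ¬ δ ≤ s}.indicator (1 : ℝ → ℝ≥0∞)) (p.1+p.2)) ?_
      exact (measurable_one.indicator hm).comp (measurable_fst.add measurable_snd)

/-- exponential of a finite measure -/
lemma exp_measure (ν : Measure ℝ) [IsFiniteMeasure ν] (hν : ∀ᵐ s ∂ν, 0 ≤ s) (δ C : ℝ) :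
    ∃ η : Measure ℝ, IsFiniteMeasure η ∧ (∀ᵐ s ∂η, δ ≤ s) ∧ ∀ z, 0 ≤ z →
      ∫ s, Real.exp (-(s*z)) ∂η = Real.exp (-(δ*z) + ∫ s, Real.exp (-(s*z)) ∂ν - C) := by
  set η : Measure ℝ := Measure.sum (fun k : ℕ =>
    ENNReal.ofReal (Real.exp (-C) * (1/(k.factorial : ℝ))) • convPow ν δ k) with hη
  have key : ∀ z, 0 ≤ z → ∫⁻ s, ENNReal.ofReal (Real.exp (-(s*z))) ∂η
      = ENNReal.ofReal (Real.exp (-(δ*z) + ∫ s, Real.exp (-(s*z)) ∂ν - C)) := by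
    intro z hz
    have hIntg : Integrable (fun s => Real.exp (-(s*z))) ν := by
      refine Integrable.mono' (integrable_const (1:ℝ)) (by fun_prop) ?_
      filter_upwards [hν] with s hs
      rw [Real.norm_eq_abs, abs_of_pos (Real.exp_pos _)]
      exact Real.exp_le_one_iff.2 (by nlinarith [mul_nonneg hs hz])
    have hL := ofReal_integral_eq_lintegral_ofReal hIntg (ae_of_all _ fun s => (Real.exp_pos _).le)
    set L := ∫ s, Real.exp (-(s*z)) ∂ν with hLdef
    have hL0 : 0 ≤ L := integral_nonneg fun s => (Real.exp_pos _).le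
    rw [hη, lintegral_sum_measure]
    simp_rw [lintegral_smul_measure, convPow_laplace, ← hL]
    have : ∀ k : ℕ, ENNReal.ofReal (Real.exp (-C) * (1/(k.factorial : ℝ))) •
        (ENNReal.ofReal (Real.exp (-(δ*z))) * (ENNReal.ofReal L)^k)
        = ENNReal.ofReal ((Real.exp (-C) * Real.exp (-(δ*z))) * (L^k / (k.factorial : ℝ))) := by
      intro k
      rw [smul_eq_mul, ← ENNReal.ofReal_pow hL0, ← ENNReal.ofReal_mul (Real.exp_pos _).le,
        ← ENNReal.ofReal_mul (by positivity)]
      congr 1; ring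
    simp_rw [this]
    rw [← ENNReal.ofReal_tsum_of_nonneg (fun k => by positivity)
      ((Real.summable_pow_div_factorial L).mul_left _), tsum_mul_left]
    congr 1
    have : ∑' k : ℕ, L^k/(k.factorial : ℝ) = Real.exp L := by
      rw [Real.exp_eq_exp_ℝ, NormedSpace.exp_eq_tsum_div]
    rw [this, ← Real.exp_add, ← Real.exp_add]; congr 1; ring
  have hfin : IsFiniteMeasure η := by
    constructor
    have := key 0 le_rfl
    simp at this
    rw [this]; exact ENNReal.ofReal_lt_top
  refine ⟨η, hfin, ?_, ?_⟩
  · rw [hη, Measure.ae_sum_iff]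
    intro k
    exact Measure.ae_smul_measure (convPow_supp ν hν δ k) _
  · intro z hz
    rw [integral_eq_lintegral_of_nonneg_ae (ae_of_all _ fun s => (Real.exp_pos _).le) (by fun_prop),
      key z hz, ENNReal.toReal_ofReal (Real.exp_pos _).le]


lemma levy_integrable (β : ℝ) (h0 : 0 < β) (h1 : β < 1) (z : ℝ) (hz : 0 ≤ z) :
    IntegrableOn (fun s : ℝ => (1 - Real.exp (-(s*z))) * s^(-1-β)) (Set.Ioi 0) := by
  have hmeas : Measurable (fun s : ℝ => (1 - Real.exp (-(s*z))) * s^(-1-β)) := by fun_prop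
  rw [← Set.Ioc_union_Ioi_eq_Ioi (zero_le_one' ℝ)]
  refine IntegrableOn.union ?_ ?_
  · have hi : IntegrableOn (fun s : ℝ => z * s^(-β)) (Set.Ioc 0 1) := by
      refine Integrable.const_mul ?_ _
      have := intervalIntegral.intervalIntegrable_rpow' (a := 0) (b := 1) (show -1 < -β by linarith)
      rwa [intervalIntegrable_iff_integrableOn_Ioc_of_le zero_le_one] at this
    refine Integrable.mono' hi hmeas.aestronglyMeasurable ?_
    refine (ae_restrict_iff' measurableSet_Ioc).2 (ae_of_all _ fun s hs => ?_)
    have hs0 : 0 < s := hs.1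
    have he : Real.exp (-(s*z)) ≤ 1 := Real.exp_le_one_iff.2 (by nlinarith [mul_nonneg hs0.le hz])
    have he2 := Real.add_one_le_exp (-(s*z))
    have hp := Real.rpow_pos_of_pos hs0 (-1-β)
    rw [Real.norm_eq_abs, abs_of_nonneg (mul_nonneg (by linarith) hp.le)]
    calc _ ≤ (s*z) * s^(-1-β) := by gcongr; linarith
      _ = z * s^(-β) := by
        rw [show -β = 1 + (-1-β) by ring, Real.rpow_add hs0 1, Real.rpow_one]; ring
  · have hi := integrableOn_Ioi_rpow_of_lt (show -1-β < -1 by linarith) (zero_lt_one' ℝ)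
    refine Integrable.mono' hi hmeas.aestronglyMeasurable ?_
    refine (ae_restrict_iff' measurableSet_Ioi).2 (ae_of_all _ fun s hs => ?_)
    have hs0 : 0 < s := lt_trans one_pos hs
    have he : Real.exp (-(s*z)) ≤ 1 := Real.exp_le_one_iff.2 (by nlinarith [mul_nonneg hs0.le hz])
    have hp := Real.rpow_pos_of_pos hs0 (-1-β)
    rw [Real.norm_eq_abs, abs_of_nonneg (mul_nonneg (by linarith) hp.le)]
    have := Real.exp_pos (-(s*z))
    calc _ ≤ 1 * s^(-1-β) := by gcongr; linarith
      _ = _ := one_mul _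

lemma levy_scaling (β : ℝ) (z : ℝ) (hz : 0 < z) :
    ∫ s in Set.Ioi (0:ℝ), (1 - Real.exp (-(s*z))) * s^(-1-β)
      = z^β * ∫ s in Set.Ioi (0:ℝ), (1 - Real.exp (-s)) * s^(-1-β) := by
  have := integral_comp_mul_left_Ioi (fun s : ℝ => (1 - Real.exp (-s)) * s^(-1-β)) 0 hz
  rw [mul_zero] at this
  have h2 : ∫ s in Set.Ioi (0:ℝ), (1 - Real.exp (-(z*s))) * (z*s)^(-1-β)
     = z^(-1-β) * ∫ s in Set.Ioi (0:ℝ), (1 - Real.exp (-(s*z))) * s^(-1-β) := by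
    rw [← integral_const_mul]
    refine setIntegral_congr_fun measurableSet_Ioi fun s hs => ?_
    rw [Real.mul_rpow hz.le (le_of_lt hs), mul_comm z s]; ring
  rw [h2, smul_eq_mul] at this
  have hp := Real.rpow_pos_of_pos hz (-1-β)
  have h3 : z^β * z^(-1-β) = z⁻¹ := by
    rw [← Real.rpow_add hz]; rw [show β + (-1-β) = -1 by ring, Real.rpow_neg_one]
  have : z^(-1-β) * (∫ s in Set.Ioi (0:ℝ), (1 - Real.exp (-(s*z))) * s^(-1-β))
    = z^(-1-β) * (z^β * ∫ s in Set.Ioi (0:ℝ), (1 - Real.exp (-s)) * s^(-1-β)) := by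
    rw [this, ← h3]; ring
  exact mul_left_cancel₀ hp.ne' this

lemma levy_pos (β : ℝ) (h0 : 0 < β) (h1 : β < 1) :
    0 < ∫ s in Set.Ioi (0:ℝ), (1 - Real.exp (-s)) * s^(-1-β) := by
  have hi := levy_integrable β h0 h1 1 zero_le_one
  simp only [mul_one] at hi
  have hpos : ∀ s ∈ Set.Ioi (0:ℝ), 0 < (1 - Real.exp (-s)) * s^(-1-β) := by
    intro s hs
    have : Real.exp (-s) < 1 := by rw [Real.exp_lt_one_iff]; simpa using hs
    exact mul_pos (by linarith) (Real.rpow_pos_of_pos hs _)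
  rw [setIntegral_pos_iff_support_of_nonneg_ae _ hi]
  · have : Set.Ioi (0:ℝ) ⊆ Function.support (fun s : ℝ => (1 - Real.exp (-s)) * s^(-1-β)) ∩ Set.Ioi 0 :=
      fun s hs => ⟨(hpos s hs).ne', hs⟩
    refine lt_of_lt_of_le ?_ (measure_mono this)
    simp
  · exact (ae_restrict_iff' measurableSet_Ioi).2 (ae_of_all _ fun s hs => (hpos s hs).le)

lemma subord_one (β : ℝ) (h0 : 0 < β) (h1 : β < 1) : ∃ K : ℝ, 0 < K ∧
    ∀ t : ℝ, 0 < t → ∀ ε : ℝ, 0 < ε →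
    ∃ η : Measure ℝ, IsFiniteMeasure η ∧ (∃ a, 0 < a ∧ ∀ᵐ s ∂η, a ≤ s) ∧ ∀ z, 0 ≤ z →
      ∫ s, Real.exp (-(s*z)) ∂η ≤ Real.exp (-(t*z^β)) ∧
      Real.exp (-(t*z^β) - t * K * ε^(1-β) * z) ≤ ∫ s, Real.exp (-(s*z)) ∂η := by
  set N := ∫ s in Set.Ioi (0:ℝ), (1 - Real.exp (-s)) * s^(-1-β) with hN
  have hNpos : 0 < N := levy_pos β h0 h1
  refine ⟨N⁻¹ * (1-β)⁻¹, mul_pos (inv_pos.2 hNpos) (inv_pos.2 (by linarith)), ?_⟩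
  intro t ht ε hε
  set w : ℝ → ℝ := fun s => t * N⁻¹ * s^(-1-β) with hw
  have hwm : Measurable w := by fun_prop
  have hwi : IntegrableOn w (Set.Ioi ε) :=
    (integrableOn_Ioi_rpow_of_lt (show -1-β < -1 by linarith) hε).const_mul _
  have hw0 : ∀ s ∈ Set.Ioi ε, 0 ≤ w s := fun s hs =>
    mul_nonneg (by positivity) (Real.rpow_nonneg (hε.le.trans (le_of_lt hs)) _)
  set ν : Measure ℝ := (volume.restrict (Set.Ioi ε)).withDensity (fun s => ENNReal.ofReal (w s)) with hν
  have hνf : IsFiniteMeasure ν := isFiniteMeasure_withDensity_ofReal hwi.2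
  have hν0 : ∀ᵐ s ∂ν, 0 ≤ s := by
    refine (withDensity_absolutelyContinuous _ _).ae_le ?_
    exact (ae_restrict_iff' measurableSet_Ioi).2 (ae_of_all _ fun s hs => hε.le.trans (le_of_lt hs))
  have hνint : ∀ z : ℝ, ∫ s, Real.exp (-(s*z)) ∂ν = ∫ s in Set.Ioi ε, w s * Real.exp (-(s*z)) := by
    intro z
    rw [hν, integral_withDensity_eq_integral_toReal_smul (by fun_prop) (ae_of_all _ fun _ => ENNReal.ofReal_lt_top)]
    refine setIntegral_congr_fun measurableSet_Ioi fun s hs => ?_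
    simp only [smul_eq_mul]
    rw [ENNReal.toReal_ofReal (hw0 s hs)]
  set δ := t * N⁻¹ * (1-β)⁻¹ * ε^(1-β) with hδ
  have hb : 0 < 1 - β := by linarith
  have hδ0 : 0 < δ := by positivity
  obtain ⟨η, hη1, hη2, hη3⟩ := exp_measure ν hν0 δ (∫ s in Set.Ioi ε, w s)
  refine ⟨η, hη1, ⟨δ, hδ0, hη2⟩, ?_⟩
  intro z hz
  have hLI := levy_integrable β h0 h1 z hz
  -- small jump part
  have hsm1 : 0 ≤ ∫ s in Set.Ioc 0 ε, (1 - Real.exp (-(s*z))) * s^(-1-β) := by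
    refine setIntegral_nonneg measurableSet_Ioc fun s hs => ?_
    have hs0 : 0 < s := hs.1
    have he : Real.exp (-(s*z)) ≤ 1 := Real.exp_le_one_iff.2 (by nlinarith [mul_nonneg hs0.le hz])
    exact mul_nonneg (by linarith) (Real.rpow_nonneg hs0.le _)
  have hsm2 : ∫ s in Set.Ioc 0 ε, (1 - Real.exp (-(s*z))) * s^(-1-β) ≤ z * ((1-β)⁻¹ * ε^(1-β)) := by
    have hii := intervalIntegral.intervalIntegrable_rpow' (a := 0) (b := ε) (show -1 < -β by linarith)
    rw [intervalIntegrable_iff_integrableOn_Ioc_of_le hε.le] at hii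
    have hval : ∫ s in Set.Ioc 0 ε, s^(-β) = (1-β)⁻¹ * ε^(1-β) := by
      rw [← intervalIntegral.integral_of_le hε.le, integral_rpow (Or.inl (by linarith))]
      rw [Real.zero_rpow (by linarith), show -β + 1 = 1 - β by ring]; field_simp; simp
    rw [← hval, ← integral_const_mul]
    refine setIntegral_mono_on (hLI.mono_set Set.Ioc_subset_Ioi_self) (hii.const_mul _) measurableSet_Ioc ?_
    intro s hs
    have hs0 : 0 < s := hs.1
    have he2 := Real.add_one_le_exp (-(s*z))
    have hp := Real.rpow_pos_of_pos hs0 (-1-β)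
    calc _ ≤ (s*z) * s^(-1-β) := by gcongr; linarith
      _ = z * s^(-β) := by
        rw [show -β = 1 + (-1-β) by ring, Real.rpow_add hs0 1, Real.rpow_one]; ring
  have hsplit : ∫ s in Set.Ioi (0:ℝ), (1 - Real.exp (-(s*z))) * s^(-1-β)
      = (∫ s in Set.Ioc 0 ε, (1 - Real.exp (-(s*z))) * s^(-1-β))
        + ∫ s in Set.Ioi ε, (1 - Real.exp (-(s*z))) * s^(-1-β) := by
    rw [← Set.Ioc_union_Ioi_eq_Ioi hε.le]
    refine setIntegral_union ?_ measurableSet_Ioi (hLI.mono_set Set.Ioc_subset_Ioi_self)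
      (hLI.mono_set (Set.Ioi_subset_Ioi hε.le))
    exact Set.Ioc_disjoint_Ioi le_rfl
  have htot : ∫ s in Set.Ioi (0:ℝ), (1 - Real.exp (-(s*z))) * s^(-1-β) = z^β * N := by
    rcases hz.eq_or_lt with rfl | hz
    · simp [Real.zero_rpow h0.ne']
    · exact levy_scaling β z hz
  have hbig : (∫ s in Set.Ioi ε, w s) - ∫ s in Set.Ioi ε, w s * Real.exp (-(s*z))
      = t * N⁻¹ * ∫ s in Set.Ioi ε, (1 - Real.exp (-(s*z))) * s^(-1-β) := by
    rw [← integral_const_mul, ← integral_sub hwi]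
    · refine setIntegral_congr_fun measurableSet_Ioi fun s hs => ?_
      simp only [hw]; ring
    · refine Integrable.mono hwi (by fun_prop) ?_
      refine (ae_restrict_iff' measurableSet_Ioi).2 (ae_of_all _ fun s hs => ?_)
      have hs0 : 0 ≤ s := hε.le.trans (le_of_lt hs)
      have he : Real.exp (-(s*z)) ≤ 1 := Real.exp_le_one_iff.2 (by nlinarith [mul_nonneg hs0 hz])
      rw [norm_mul, Real.norm_eq_abs (Real.exp _), abs_of_pos (Real.exp_pos _)]
      exact mul_le_of_le_one_right (norm_nonneg _) he
  rw [hη3 z hz, hνint z]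
  set S := ∫ s in Set.Ioc 0 ε, (1 - Real.exp (-(s*z))) * s^(-1-β)
  set B := ∫ s in Set.Ioi ε, (1 - Real.exp (-(s*z))) * s^(-1-β)
  have hexp : -(δ*z) + (∫ s in Set.Ioi ε, w s * Real.exp (-(s*z))) - ∫ s in Set.Ioi ε, w s
      = -(t*z^β) - δ * z + t * N⁻¹ * S := by
    have : B = z^β * N - S := by linarith
    rw [this] at hbig
    have h4 : t * N⁻¹ * (z^β * N - S) = t * z^β - t * N⁻¹ * S := by field_simp
    linarith
  rw [hexp]
  have hc : 0 ≤ t * N⁻¹ := by positivity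
  constructor
  · apply Real.exp_le_exp.2
    have := mul_le_mul_of_nonneg_left hsm2 hc
    have h5 : t * N⁻¹ * (z * ((1-β)⁻¹ * ε^(1-β))) = δ * z := by rw [hδ]; ring
    linarith
  · apply Real.exp_le_exp.2
    have := mul_nonneg hc hsm1
    have h5 : t * (N⁻¹ * (1-β)⁻¹) * ε^(1-β) * z = δ * z := by rw [hδ]; ring
    linarith

lemma subord_seq (β : ℝ) (h0 : 0 < β) (h1 : β < 1) (t : ℝ) (ht : 0 < t) :
    ∃ η : ℕ → Measure ℝ, (∀ n, IsFiniteMeasure (η n)) ∧ (∀ n, ∃ a, 0 < a ∧ ∀ᵐ s ∂(η n), a ≤ s) ∧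
      (∀ n z, 0 ≤ z → ∫ s, Real.exp (-(s*z)) ∂(η n) ≤ Real.exp (-(t*z^β))) ∧
      (∀ z, 0 ≤ z → Tendsto (fun n => ∫ s, Real.exp (-(s*z)) ∂(η n)) atTop
        (𝓝 (Real.exp (-(t*z^β))))) := by
  obtain ⟨K, hK, H⟩ := subord_one β h0 h1
  choose η h1' h2 h3 using fun n : ℕ => H t ht (1/((n:ℝ)+1)) (by positivity)
  refine ⟨η, h1', h2, fun n z hz => (h3 n z hz).1, fun z hz => ?_⟩
  refine tendsto_of_tendsto_of_tendsto_of_le_of_le ?_ tendsto_const_nhds (fun n => (h3 n z hz).2)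
    (fun n => (h3 n z hz).1)
  have hlim : Tendsto (fun n : ℕ => (1/((n:ℝ)+1))^(1-β)) atTop (𝓝 0) := by
    have := (tendsto_one_div_add_atTop_nhds_zero_nat (𝕜 := ℝ)).rpow_const (p := 1-β) (Or.inr (by linarith))
    rwa [Real.zero_rpow (by linarith)] at this
  have h := (Real.continuous_exp.tendsto _).comp
    (((hlim.const_mul (t*K)).mul_const z).const_sub (-(t*z^β)))
  simpa [Function.comp_def] using h


lemma hasGradientAt_integral {d : ℕ} {Ω : Type*} [MeasurableSpace Ω] {μ : Measure Ω}
    {F : EuclideanSpace ℝ (Fin d) → Ω → ℝ}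
    {G : EuclideanSpace ℝ (Fin d) → Ω → EuclideanSpace ℝ (Fin d)}
    {x₀ : EuclideanSpace ℝ (Fin d)} {S : Set (EuclideanSpace ℝ (Fin d))} {bound : Ω → ℝ}
    (hs : S ∈ 𝓝 x₀)
    (hF_meas : ∀ᶠ x in 𝓝 x₀, AEStronglyMeasurable (F x) μ) (hF_int : Integrable (F x₀) μ)
    (hG_meas : AEStronglyMeasurable (G x₀) μ)
    (h_bound : ∀ᵐ a ∂μ, ∀ x ∈ S, ‖G x a‖ ≤ bound a)
    (bound_integrable : Integrable bound μ)
    (h_diff : ∀ᵐ a ∂μ, ∀ x ∈ S, HasGradientAt (F · a) (G x a) x) :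
    HasGradientAt (fun x ↦ ∫ a, F x a ∂μ) (∫ a, G x₀ a ∂μ) x₀ := by
  have hGi : Integrable (G x₀) μ := by
    refine Integrable.mono' bound_integrable hG_meas ?_
    filter_upwards [h_bound] with a ha using ha x₀ (mem_of_mem_nhds hs)
  rw [hasGradientAt_iff_hasFDerivAt]
  let T : EuclideanSpace ℝ (Fin d) →L[ℝ] (StrongDual ℝ (EuclideanSpace ℝ (Fin d))) :=
    (InnerProductSpace.toDual ℝ (EuclideanSpace ℝ (Fin d))).toContinuousLinearEquiv.toContinuousLinearMap
  have h := hasFDerivAt_integral_of_dominated_of_fderiv_le (𝕜 := ℝ) (F := F)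
    (F' := fun x a => T (G x a)) hs hF_meas hF_int
    (T.continuous.comp_aestronglyMeasurable hG_meas)
    (bound := bound) (by
      filter_upwards [h_bound] with a ha x hx
      have : ‖T (G x a)‖ = ‖G x a‖ :=
        (InnerProductSpace.toDual ℝ (EuclideanSpace ℝ (Fin d))).norm_map _
      rw [this]; exact ha x hx) bound_integrable
    (by
      filter_upwards [h_diff] with a ha x hx
      exact (ha x hx).hasFDerivAt)
  rw [T.integral_comp_comm hGi] at h
  exact h

lemma hasGradientAt_cos {d : ℕ} (ξ x : EuclideanSpace ℝ (Fin d)) (c : ℝ) :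
    HasGradientAt (fun x => Real.cos ⟪ξ, x⟫ * c) ((-(Real.sin ⟪ξ, x⟫ * c)) • ξ) x := by
  rw [hasGradientAt_iff_hasFDerivAt]
  have h1 : HasFDerivAt (fun x : EuclideanSpace ℝ (Fin d) => (⟪ξ, x⟫ : ℝ)) (innerSL ℝ ξ) x :=
    (innerSL ℝ ξ).hasFDerivAt
  have h2 := (h1.cos).mul_const c
  refine h2.congr_fderiv ?_
  ext v
  simp [InnerProductSpace.toDual_apply_apply, inner_smul_left]
  ring

lemma hasGradientAt_cosTransform {d : ℕ} (w : EuclideanSpace ℝ (Fin d) → ℝ)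
    (hw : Integrable w) (hw1 : Integrable (fun ξ => ‖ξ‖ * ‖w ξ‖)) (x : EuclideanSpace ℝ (Fin d)) :
    HasGradientAt (fun x => ∫ ξ, Real.cos ⟪ξ, x⟫ * w ξ)
      (∫ ξ, (-(Real.sin ⟪ξ, x⟫ * w ξ)) • ξ) x := by
  have hm := hw.aestronglyMeasurable
  refine hasGradientAt_integral (S := Set.univ) (G := fun x ξ => (-(Real.sin ⟪ξ, x⟫ * w ξ)) • ξ)
    (bound := fun ξ => ‖ξ‖ * ‖w ξ‖) univ_mem
    ?_ ?_ ?_ ?_ hw1 ?_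
  · refine Eventually.of_forall fun x => ?_
    exact (Continuous.aestronglyMeasurable (by fun_prop)).mul hm
  · refine Integrable.mono hw ((Continuous.aestronglyMeasurable (by fun_prop)).mul hm) ?_
    refine ae_of_all _ fun ξ => ?_
    rw [norm_mul]
    exact mul_le_of_le_one_left (norm_nonneg _) (Real.abs_cos_le_one _)
  · exact ((Continuous.aestronglyMeasurable (by fun_prop)).mul hm).neg.smul (by fun_prop)
  · refine ae_of_all _ fun ξ x _ => ?_
    rw [norm_smul, norm_neg, norm_mul, mul_comm]
    gcongr
    exact mul_le_of_le_one_left (norm_nonneg _) (Real.abs_sin_le_one _)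
  · exact ae_of_all _ fun ξ x _ => hasGradientAt_cos ξ x _

/-- decay of the stretched exponential -/
lemma exp_norm_bound (α : ℝ) (hα : 1 ≤ α) (t : ℝ) (ht : 0 < t) (m : ℕ) (r : ℝ) (hr : 0 ≤ r) :
    Real.exp (-(t * r^α)) ≤ (Real.exp (2*t) * m.factorial / t^m) * (1+r)^(-(m:ℝ)) := by
  have h1 : r ≤ 1 + r^α := by
    rcases le_total r 1 with h | h
    · have := Real.rpow_nonneg hr α; linarith
    · have : r^(1:ℝ) ≤ r^α := Real.rpow_le_rpow_of_exponent_le h hα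
      rw [Real.rpow_one] at this; linarith
  have h2 := Real.pow_div_factorial_le_exp (x := t*(1+r)) (by positivity) m
  have h3 : Real.exp (-(t*r^α)) ≤ Real.exp (2*t) * Real.exp (-(t*(1+r))) := by
    rw [← Real.exp_add]; apply Real.exp_le_exp.2; nlinarith
  refine h3.trans ?_
  rw [Real.rpow_neg (by positivity), Real.rpow_natCast, mul_div_assoc, mul_assoc]
  gcongr
  rw [Real.exp_neg, ← div_eq_mul_inv, div_div, ← mul_pow, inv_eq_one_div]
  rw [div_le_div_iff₀ (Real.exp_pos _) (by positivity)]
  rw [div_le_iff₀ (by positivity)] at h2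
  linarith

lemma stretched_integrable {d : ℕ} (α : ℝ) (hα : 1 ≤ α) (t : ℝ) (ht : 0 < t) :
    Integrable (fun ξ : EuclideanSpace ℝ (Fin d) => Real.exp (-(t * ‖ξ‖^α))) ∧
    Integrable (fun ξ : EuclideanSpace ℝ (Fin d) => ‖ξ‖ * Real.exp (-(t * ‖ξ‖^α))) := by
  have hi : Integrable (fun ξ : EuclideanSpace ℝ (Fin d) => (1+‖ξ‖)^(-((d+1:ℕ):ℝ))) := by
    apply integrable_one_add_norm; simp
  constructor
  · refine Integrable.mono' (hi.const_mul (Real.exp (2*t) * (d+1).factorial / t^(d+1))) ?_ ?_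
    · exact Measurable.aestronglyMeasurable (by fun_prop)
    · refine ae_of_all _ fun ξ => ?_
      rw [Real.norm_eq_abs, abs_of_pos (Real.exp_pos _)]
      exact exp_norm_bound α hα t ht (d+1) ‖ξ‖ (norm_nonneg _)
  · refine Integrable.mono' (hi.const_mul (Real.exp (2*t) * (d+2).factorial / t^(d+2))) ?_ ?_
    · exact Measurable.aestronglyMeasurable (by fun_prop)
    · refine ae_of_all _ fun ξ => ?_
      rw [Real.norm_eq_abs, abs_of_nonneg (by positivity)]
      have h := exp_norm_bound α hα t ht (d+2) ‖ξ‖ (norm_nonneg _)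
      have hp : 0 < 1 + ‖ξ‖ := by positivity
      have h2 : (1+‖ξ‖)^(-((d+1:ℕ):ℝ)) = (1+‖ξ‖) * (1+‖ξ‖)^(-((d+2:ℕ):ℝ)) := by
        rw [← Real.rpow_one_add' hp.le]
        · congr 1; push_cast; ring
        · push_cast; intro h; have : (0:ℝ) ≤ d := by positivity
          linarith
      rw [h2]
      have hq := Real.rpow_nonneg hp.le (-((d+2:ℕ):ℝ))
      calc ‖ξ‖ * Real.exp (-(t * ‖ξ‖^α)) ≤ (1+‖ξ‖) * Real.exp (-(t * ‖ξ‖^α)) := by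
            gcongr; linarith
        _ ≤ (1+‖ξ‖) * ((Real.exp (2*t) * (d+2).factorial / t^(d+2)) * (1+‖ξ‖)^(-((d+2:ℕ):ℝ))) := by
            gcongr
        _ = _ := by ring

lemma gauss_integrable {d : ℕ} (t : ℝ) (ht : 0 < t) :
    Integrable (fun ξ : EuclideanSpace ℝ (Fin d) => Real.exp (-(t * ‖ξ‖^2))) ∧
    Integrable (fun ξ : EuclideanSpace ℝ (Fin d) => ‖ξ‖ * Real.exp (-(t * ‖ξ‖^2))) := by
  have := stretched_integrable (d := d) 2 (by norm_num) t ht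
  simpa [Real.rpow_two] using this

lemma gauss_cos {d : ℕ} (s : ℝ) (hs : 0 < s) (x : EuclideanSpace ℝ (Fin d)) :
    ∫ ξ, Real.cos ⟪ξ, x⟫ * Real.exp (-(s*‖ξ‖^2))
      = (Real.pi/s)^((d:ℝ)/2) * Real.exp (-(‖x‖^2/(4*s))) := by
  have h := GaussianFourier.integral_cexp_neg_mul_sq_norm_add (V := EuclideanSpace ℝ (Fin d))
    (b := (s:ℂ)) (by simpa using hs) Complex.I x
  have hi : Integrable (fun v : EuclideanSpace ℝ (Fin d) =>
      Complex.exp (-(s:ℂ) * ‖v‖^2 + Complex.I * (⟪x, v⟫ : ℝ))) :=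
    GaussianFourier.integrable_cexp_neg_mul_sq_norm_add (by simpa using hs) _ _
  have h2 := congrArg Complex.re h
  have h3 := integral_re (𝕜 := ℂ) hi
  simp only [RCLike.re_to_complex] at h3
  rw [← h3] at h2
  convert h2 using 1
  · refine integral_congr_ae (ae_of_all _ fun ξ => ?_)
    simp only
    rw [Complex.exp_re]
    have e1 : (-(s:ℂ) * ‖ξ‖^2 + Complex.I * (⟪x, ξ⟫ : ℝ)).re = -(s*‖ξ‖^2) := by
      simp [← Complex.ofReal_pow]
    have e2 : (-(s:ℂ) * ‖ξ‖^2 + Complex.I * (⟪x, ξ⟫ : ℝ)).im = ⟪ξ, x⟫ := by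
      simp [← Complex.ofReal_pow, real_inner_comm]
    rw [e1, e2, mul_comm]
  · have e : ((Real.pi:ℂ) / s)^((Module.finrank ℝ (EuclideanSpace ℝ (Fin d)) : ℂ)/2)
        = (((Real.pi/s)^((d:ℝ)/2) : ℝ) : ℂ) := by
      rw [Complex.ofReal_cpow (by positivity)]
      simp
    rw [e, Complex.re_ofReal_mul]
    congr 1
    rw [Complex.I_sq, show (-1 : ℂ) * ‖x‖^2/(4*s) = ((-(‖x‖^2/(4*s)) : ℝ) : ℂ) by push_cast; ring]
    rw [Complex.exp_ofReal_re]

lemma gauss_sin {d : ℕ} (s : ℝ) (hs : 0 < s) (x : EuclideanSpace ℝ (Fin d)) :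
    ∫ ξ, (-(Real.sin ⟪ξ, x⟫ * Real.exp (-(s*‖ξ‖^2)))) • ξ
      = (-((Real.pi/s)^((d:ℝ)/2) * Real.exp (-(‖x‖^2/(4*s))) / (2*s))) • x := by
  obtain ⟨i1, i2⟩ := gauss_integrable (d := d) s hs
  have h := hasGradientAt_cosTransform (fun ξ : EuclideanSpace ℝ (Fin d) => Real.exp (-(s*‖ξ‖^2))) i1
    (by simpa using i2) x
  simp_rw [gauss_cos s hs] at h
  refine h.unique ?_
  rw [hasGradientAt_iff_hasFDerivAt]
  have h1 : HasFDerivAt (fun x : EuclideanSpace ℝ (Fin d) => ‖x‖^2) (2 • innerSL ℝ x) x :=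
    (hasStrictFDerivAt_norm_sq x).hasFDerivAt
  have h2 := (((h1.mul_const ((4*s)⁻¹)).neg).exp).const_mul ((Real.pi/s)^((d:ℝ)/2))
  simp only [← div_eq_mul_inv] at h2
  refine h2.congr_fderiv ?_
  ext v
  simp [InnerProductSpace.toDual_apply_apply, inner_smul_left]
  field_simp
  ring

lemma rpow_mul_exp_bdd (a : ℝ) (ha : 0 ≤ a) : ∃ C : ℝ, 0 < C ∧ ∀ u : ℝ, 0 ≤ u → u^a * Real.exp (-u) ≤ C := by
  refine ⟨1 + (⌈a⌉₊).factorial, by positivity, fun u hu => ?_⟩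
  have hf : (1:ℝ) ≤ (⌈a⌉₊).factorial := by exact_mod_cast Nat.succ_le_of_lt (Nat.factorial_pos _)
  rcases le_total u 1 with h | h
  · have h1 : u^a ≤ 1 := Real.rpow_le_one hu h ha
    have h2 : Real.exp (-u) ≤ 1 := Real.exp_le_one_iff.2 (by linarith)
    have := mul_le_one₀ h1 (Real.exp_pos _).le h2
    linarith
  · have h1 : u^a ≤ u^((⌈a⌉₊:ℕ):ℝ) := Real.rpow_le_rpow_of_exponent_le h (Nat.le_ceil a)
    rw [Real.rpow_natCast] at h1
    have h2 := Real.pow_div_factorial_le_exp u hu ⌈a⌉₊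
    rw [div_le_iff₀ (by positivity)] at h2
    rw [Real.exp_neg, ← div_eq_mul_inv, div_le_iff₀ (Real.exp_pos _)]
    nlinarith [Real.exp_pos u]

lemma gauss_bounds (d : ℕ) : ∃ C : ℝ, 0 < C ∧ ∀ s : ℝ, 0 < s → ∀ x : EuclideanSpace ℝ (Fin d),
    ‖x‖^d * ((Real.pi/s)^((d:ℝ)/2) * Real.exp (-(‖x‖^2/(4*s)))) ≤ C ∧
    ‖x‖^(d+1) * ‖(-((Real.pi/s)^((d:ℝ)/2) * Real.exp (-(‖x‖^2/(4*s))) / (2*s))) • x‖ ≤ C := by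
  obtain ⟨C1, hC1, H1⟩ := rpow_mul_exp_bdd ((d:ℝ)/2) (by positivity)
  obtain ⟨C2, hC2, H2⟩ := rpow_mul_exp_bdd ((d:ℝ)/2+1) (by positivity)
  have hpi := Real.pi_pos
  refine ⟨(4*Real.pi)^((d:ℝ)/2) * C1 + (4*Real.pi)^((d:ℝ)/2) * (2*C2), by positivity, fun s hs x => ?_⟩
  set u := ‖x‖^2/(4*s) with hu
  have hu0 : 0 ≤ u := by positivity
  have key : ‖x‖^d * (Real.pi/s)^((d:ℝ)/2) = (4*Real.pi)^((d:ℝ)/2) * u^((d:ℝ)/2) := by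
    have : ‖x‖^d = (‖x‖^2)^((d:ℝ)/2) := by
      rw [← Real.rpow_natCast, ← Real.rpow_natCast, ← Real.rpow_mul (norm_nonneg _)]
      congr 1; push_cast; ring
    rw [this, ← Real.mul_rpow (by positivity) (by positivity), ← Real.mul_rpow (by positivity) hu0]
    congr 1; rw [hu]; field_simp
  have h1 := H1 u hu0
  have h2 := H2 u hu0
  have hA : 0 < (4*Real.pi)^((d:ℝ)/2) := by positivity
  constructor
  · rw [← mul_assoc, key, mul_assoc]
    have := mul_le_mul_of_nonneg_left h1 hA.le
    have : 0 ≤ (4*Real.pi)^((d:ℝ)/2) * (2*C2) := by positivity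
    linarith
  · rw [norm_smul, norm_neg, Real.norm_eq_abs, abs_of_nonneg (by positivity)]
    have e : ‖x‖^(d+1) * ((Real.pi/s)^((d:ℝ)/2) * Real.exp (-u) / (2*s) * ‖x‖)
        = (‖x‖^d * (Real.pi/s)^((d:ℝ)/2)) * (2 * (u * Real.exp (-u))) := by
      rw [hu]; field_simp; ring
    rw [e, key]
    have e2 : (4*Real.pi)^((d:ℝ)/2) * u^((d:ℝ)/2) * (2 * (u * Real.exp (-u)))
       = (4*Real.pi)^((d:ℝ)/2) * (2 * (u^((d:ℝ)/2+1) * Real.exp (-u))) := by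
      rw [Real.rpow_add_one' hu0 (by positivity)]; ring
    rw [e2]
    have : (4*Real.pi)^((d:ℝ)/2) * (2 * (u^((d:ℝ)/2+1) * Real.exp (-u))) ≤ (4*Real.pi)^((d:ℝ)/2) * (2*C2) := by
      gcongr
    have : 0 ≤ (4*Real.pi)^((d:ℝ)/2) * C1 := by positivity
    linarith


/-- gradient of the stable density -/
noncomputable def stableG (d : ℕ) (α : ℝ) (t : ℝ) (x : EuclideanSpace ℝ (Fin d)) :
    EuclideanSpace ℝ (Fin d) :=
  ((2 * Real.pi) ^ (-(d : ℝ)) : ℝ) •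
    ∫ ξ, (-(Real.sin ⟪ξ, x⟫ * Real.exp (-(t * ‖ξ‖^α)))) • ξ

lemma stableP_eq (d : ℕ) (α : ℝ) (hα : 1 ≤ α) (t : ℝ) (ht : 0 < t) (x : EuclideanSpace ℝ (Fin d)) :
    stableP d α t x = ((2 * Real.pi) ^ (-(d : ℝ)) : ℝ) *
      ∫ ξ, Real.cos ⟪ξ, x⟫ * Real.exp (-(t * ‖ξ‖^α)) := by
  unfold stableP
  rw [Complex.re_ofReal_mul]
  congr 1
  have hre : ∀ ξ : EuclideanSpace ℝ (Fin d),
      Complex.exp (-Complex.I * ((⟪ξ, x⟫ : ℝ) : ℂ)) * Complex.exp (-(t : ℂ) * ((‖ξ‖ ^ α : ℝ) : ℂ))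
      = Complex.exp (((-⟪ξ, x⟫ : ℝ) : ℂ) * Complex.I) * ((Real.exp (-(t * ‖ξ‖^α)) : ℝ) : ℂ) := by
    intro ξ
    push_cast
    congr 2
    · ring
    · ring
  simp_rw [hre]
  have hi : Integrable (fun ξ : EuclideanSpace ℝ (Fin d) =>
      Complex.exp (((-⟪ξ, x⟫ : ℝ) : ℂ) * Complex.I) * ((Real.exp (-(t * ‖ξ‖^α)) : ℝ) : ℂ)) := by
    refine Integrable.mono' (stretched_integrable (d := d) α hα t ht).1 ?_ ?_
    · exact Measurable.aestronglyMeasurable (by fun_prop)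
    · refine ae_of_all _ fun ξ => ?_
      rw [norm_mul, Complex.norm_exp_ofReal_mul_I, one_mul, Complex.norm_real, Real.norm_eq_abs,
        abs_of_pos (Real.exp_pos _)]
  have h3 := integral_re (𝕜 := ℂ) hi
  simp only [RCLike.re_to_complex] at h3
  rw [← h3]
  refine integral_congr_ae (ae_of_all _ fun ξ => ?_)
  simp only
  rw [Complex.re_mul_ofReal, Complex.exp_ofReal_mul_I_re, Real.cos_neg]

lemma stable_hasGradient (d : ℕ) (α : ℝ) (hα : 1 ≤ α) (t : ℝ) (ht : 0 < t)
    (x : EuclideanSpace ℝ (Fin d)) :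
    HasGradientAt (stableP d α t) (stableG d α t x) x := by
  obtain ⟨i1, i2⟩ := stretched_integrable (d := d) α hα t ht
  have h := hasGradientAt_cosTransform _ i1 (by simpa using i2) x
  have e : stableP d α t = fun x => ((2 * Real.pi) ^ (-(d : ℝ)) : ℝ) *
      ∫ ξ, Real.cos ⟪ξ, x⟫ * Real.exp (-(t * ‖ξ‖^α)) := by
    funext x; exact stableP_eq d α hα t ht x
  rw [e, hasGradientAt_iff_hasFDerivAt]
  unfold stableG
  refine (h.hasFDerivAt.const_mul _).congr_fderiv ?_
  rw [map_smul]

/-- Approximants: cosine transform of a Laplace transform. -/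
lemma laplace_cos {d : ℕ} (η : Measure ℝ) [IsFiniteMeasure η] (a : ℝ) (ha : 0 < a)
    (hη : ∀ᵐ s ∂η, a ≤ s) (x : EuclideanSpace ℝ (Fin d)) :
    ∫ ξ : EuclideanSpace ℝ (Fin d), Real.cos ⟪ξ, x⟫ * ∫ s, Real.exp (-(s*‖ξ‖^2)) ∂η
      = ∫ s, (Real.pi/s)^((d:ℝ)/2) * Real.exp (-(‖x‖^2/(4*s))) ∂η := by
  simp_rw [← integral_const_mul]
  rw [integral_integral_swap]
  · refine integral_congr_ae ?_
    filter_upwards [hη] with s hs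
    exact gauss_cos s (ha.trans_le hs) x
  · have hb := (gauss_integrable (d := d) a ha).1.mul_prod (integrable_const (1:ℝ) (μ := η))
    refine Integrable.mono' hb ?_ ?_
    · exact Measurable.aestronglyMeasurable (by unfold Function.uncurry; fun_prop)
    · have : ∀ᵐ p ∂((volume : Measure (EuclideanSpace ℝ (Fin d))).prod η), a ≤ p.2 :=
        Measure.quasiMeasurePreserving_snd.ae hη
      filter_upwards [this] with p hp
      simp only [Function.uncurry]
      rw [norm_mul, mul_one, Real.norm_eq_abs (Real.exp _), abs_of_pos (Real.exp_pos _)]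
      refine (mul_le_of_le_one_left (Real.exp_pos _).le (Real.abs_cos_le_one _)).trans ?_
      apply Real.exp_le_exp.2
      have := mul_le_mul_of_nonneg_right hp (sq_nonneg ‖p.1‖)
      linarith

lemma laplace_sin {d : ℕ} (η : Measure ℝ) [IsFiniteMeasure η] (a : ℝ) (ha : 0 < a)
    (hη : ∀ᵐ s ∂η, a ≤ s) (x : EuclideanSpace ℝ (Fin d)) :
    ∫ ξ : EuclideanSpace ℝ (Fin d), (-(Real.sin ⟪ξ, x⟫ * ∫ s, Real.exp (-(s*‖ξ‖^2)) ∂η)) • ξ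
      = ∫ s, (-((Real.pi/s)^((d:ℝ)/2) * Real.exp (-(‖x‖^2/(4*s))) / (2*s))) • x ∂η := by
  simp_rw [← integral_const_mul, ← integral_neg, ← integral_smul_const]
  rw [integral_integral_swap]
  · refine integral_congr_ae ?_
    filter_upwards [hη] with s hs
    exact gauss_sin s (ha.trans_le hs) x
  · have hb := (gauss_integrable (d := d) a ha).2.mul_prod (integrable_const (1:ℝ) (μ := η))
    refine Integrable.mono' hb ?_ ?_
    · exact Measurable.aestronglyMeasurable (by unfold Function.uncurry; fun_prop)
    · have : ∀ᵐ p ∂((volume : Measure (EuclideanSpace ℝ (Fin d))).prod η), a ≤ p.2 :=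
        Measure.quasiMeasurePreserving_snd.ae hη
      filter_upwards [this] with p hp
      simp only [Function.uncurry]
      rw [norm_smul, norm_neg, norm_mul, mul_one, Real.norm_eq_abs (Real.exp _),
        abs_of_pos (Real.exp_pos _), mul_comm]
      gcongr
      refine (mul_le_of_le_one_left (Real.exp_pos _).le (Real.abs_sin_le_one _)).trans ?_
      apply Real.exp_le_exp.2
      have := mul_le_mul_of_nonneg_right hp (sq_nonneg ‖p.1‖)
      linarith

lemma laplace_meas {d : ℕ} (η : Measure ℝ) [IsFiniteMeasure η] :
    StronglyMeasurable (fun ξ : EuclideanSpace ℝ (Fin d) => ∫ s, Real.exp (-(s*‖ξ‖^2)) ∂η) := by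
  refine StronglyMeasurable.integral_prod_right
    (f := fun (ξ : EuclideanSpace ℝ (Fin d)) s => Real.exp (-(s*‖ξ‖^2))) ?_
  exact Measurable.stronglyMeasurable (by unfold Function.uncurry; fun_prop)

/-- The approximation statement. -/
lemma stable_approx (d : ℕ) (α : ℝ) (h1 : 1 < α) (h2 : α < 2) (t : ℝ) (ht : 0 < t) :
    ∃ η : ℕ → Measure ℝ, (∀ n, IsFiniteMeasure (η n)) ∧ (∀ n, (η n).real Set.univ ≤ 1) ∧
      (∀ n, ∃ a, 0 < a ∧ ∀ᵐ s ∂(η n), a ≤ s) ∧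
      (∀ x : EuclideanSpace ℝ (Fin d), Tendsto (fun n => ((2 * Real.pi) ^ (-(d : ℝ)) : ℝ) *
        ∫ s, (Real.pi/s)^((d:ℝ)/2) * Real.exp (-(‖x‖^2/(4*s))) ∂(η n)) atTop (𝓝 (stableP d α t x))) ∧
      (∀ x : EuclideanSpace ℝ (Fin d), Tendsto (fun n => ((2 * Real.pi) ^ (-(d : ℝ)) : ℝ) •
        ∫ s, (-((Real.pi/s)^((d:ℝ)/2) * Real.exp (-(‖x‖^2/(4*s))) / (2*s))) • x ∂(η n)) atTop
          (𝓝 (stableG d α t x))) := by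
  obtain ⟨η, hf, ha, hle, hlim⟩ := subord_seq (α/2) (by linarith) (by linarith) t ht
  have hpow : ∀ ξ : EuclideanSpace ℝ (Fin d), (‖ξ‖^2)^(α/2) = ‖ξ‖^α := by
    intro ξ
    rw [← Real.rpow_natCast, ← Real.rpow_mul (norm_nonneg _)]; congr 1; push_cast; ring
  have hb : ∀ n (ξ : EuclideanSpace ℝ (Fin d)), ‖∫ s, Real.exp (-(s*‖ξ‖^2)) ∂(η n)‖ ≤ Real.exp (-(t*‖ξ‖^α)) := by
    intro n ξ
    rw [Real.norm_eq_abs, abs_of_nonneg (integral_nonneg fun s => (Real.exp_pos _).le), ← hpow]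
    exact hle n _ (sq_nonneg _)
  obtain ⟨i1, i2⟩ := stretched_integrable (d := d) α h1.le t ht
  refine ⟨η, hf, ?_, ha, ?_, ?_⟩
  · intro n
    have := hle n 0 le_rfl
    simpa [Real.zero_rpow (show α/2 ≠ 0 by linarith)] using this
  · intro x
    rw [stableP_eq d α h1.le t ht]
    refine Tendsto.const_mul _ ?_
    have e : ∀ n, ∫ s, (Real.pi/s)^((d:ℝ)/2) * Real.exp (-(‖x‖^2/(4*s))) ∂(η n)
      = ∫ ξ : EuclideanSpace ℝ (Fin d), Real.cos ⟪ξ, x⟫ * ∫ s, Real.exp (-(s*‖ξ‖^2)) ∂(η n) := by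
      intro n
      obtain ⟨a, ha0, ha1⟩ := ha n
      have := hf n
      exact (laplace_cos (η n) a ha0 ha1 x).symm
    simp_rw [e]
    refine tendsto_integral_of_dominated_convergence (fun ξ => Real.exp (-(t*‖ξ‖^α))) ?_ i1 ?_ ?_
    · intro n
      have := hf n
      exact (Continuous.aestronglyMeasurable (by fun_prop)).mul (laplace_meas (η n)).aestronglyMeasurable
    · intro n
      refine ae_of_all _ fun ξ => ?_
      rw [norm_mul]
      exact (mul_le_of_le_one_left (norm_nonneg _) (Real.abs_cos_le_one _)).trans (hb n ξ)
    · refine ae_of_all _ fun ξ => ?_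
      refine Tendsto.const_mul _ ?_
      rw [← hpow]; exact hlim _ (sq_nonneg _)
  · intro x
    unfold stableG
    refine Tendsto.const_smul ?_ _
    have e : ∀ n, ∫ s, (-((Real.pi/s)^((d:ℝ)/2) * Real.exp (-(‖x‖^2/(4*s))) / (2*s))) • x ∂(η n)
      = ∫ ξ : EuclideanSpace ℝ (Fin d), (-(Real.sin ⟪ξ, x⟫ * ∫ s, Real.exp (-(s*‖ξ‖^2)) ∂(η n))) • ξ := by
      intro n
      obtain ⟨a, ha0, ha1⟩ := ha n
      have := hf n
      exact (laplace_sin (η n) a ha0 ha1 x).symm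
    simp_rw [e]
    refine tendsto_integral_of_dominated_convergence (fun ξ => ‖ξ‖ * Real.exp (-(t*‖ξ‖^α))) ?_ i2 ?_ ?_
    · intro n
      have := hf n
      exact (((Continuous.aestronglyMeasurable (by fun_prop)).mul
        (laplace_meas (η n)).aestronglyMeasurable).neg).smul (by fun_prop)
    · intro n
      refine ae_of_all _ fun ξ => ?_
      rw [norm_smul, norm_neg, norm_mul, mul_comm]
      gcongr
      exact (mul_le_of_le_one_left (norm_nonneg _) (Real.abs_sin_le_one _)).trans (hb n ξ)
    · refine ae_of_all _ fun ξ => ?_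
      refine Tendsto.smul_const (Tendsto.neg (Tendsto.const_mul _ ?_)) _
      rw [← hpow]; exact hlim _ (sq_nonneg _)

lemma stableP_nonneg (d : ℕ) (α : ℝ) (h1 : 1 < α) (h2 : α < 2) (t : ℝ) (ht : 0 < t)
    (x : EuclideanSpace ℝ (Fin d)) : 0 ≤ stableP d α t x := by
  obtain ⟨η, hf, hm, ha, hl, -⟩ := stable_approx d α h1 h2 t ht
  refine ge_of_tendsto' (hl x) fun n => ?_
  obtain ⟨a, ha0, ha1⟩ := ha n
  refine mul_nonneg (by positivity) (integral_nonneg_of_ae ?_)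
  filter_upwards [ha1] with s hs
  have : 0 < s := ha0.trans_le hs
  simp only [Pi.zero_apply]; positivity

lemma stable_decay (d : ℕ) (α : ℝ) (h1 : 1 < α) (h2 : α < 2) : ∃ B : ℝ, 0 < B ∧
    ∀ t : ℝ, 0 < t → ∀ x : EuclideanSpace ℝ (Fin d),
      ‖x‖^d * stableP d α t x ≤ B ∧ ‖x‖^(d+1) * ‖stableG d α t x‖ ≤ B := by
  obtain ⟨C, hC, HC⟩ := gauss_bounds d
  have hpi := Real.pi_pos
  set k := ((2 * Real.pi) ^ (-(d : ℝ)) : ℝ) with hk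
  have hk0 : 0 < k := by positivity
  refine ⟨k * C, by positivity, fun t ht x => ?_⟩
  obtain ⟨η, hf, hm, ha, hl, hg⟩ := stable_approx d α h1 h2 t ht
  have aux : ∀ n, ∀ F : ℝ → EuclideanSpace ℝ (Fin d), ∀ m : ℕ, (∀ s, 0 < s → ‖x‖^m * ‖F s‖ ≤ C) →
      ‖x‖^m * ‖∫ s, F s ∂(η n)‖ ≤ C := by
    intro n F m hF
    obtain ⟨a, ha0, ha1⟩ := ha n
    have := hf n
    have : ‖∫ s, (‖x‖^m) • F s ∂(η n)‖ ≤ C * (η n).real Set.univ := by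
      refine norm_integral_le_of_norm_le_const ?_
      filter_upwards [ha1] with s hs
      rw [norm_smul, norm_pow, norm_norm]
      exact hF s (ha0.trans_le hs)
    rw [integral_smul, norm_smul, norm_pow, norm_norm] at this
    refine this.trans (mul_le_of_le_one_right hC.le (hm n))
  have aux1 : ∀ n, ∀ F : ℝ → ℝ, ∀ m : ℕ, (∀ s, 0 < s → 0 ≤ F s) → (∀ s, 0 < s → ‖x‖^m * F s ≤ C) →
      ‖x‖^m * ∫ s, F s ∂(η n) ≤ C := by
    intro n F m hF0 hF
    obtain ⟨a, ha0, ha1⟩ := ha n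
    have := hf n
    have : ‖∫ s, (‖x‖^m) * F s ∂(η n)‖ ≤ C * (η n).real Set.univ := by
      refine norm_integral_le_of_norm_le_const ?_
      filter_upwards [ha1] with s hs
      have hs0 := ha0.trans_le hs
      rw [norm_mul, norm_pow, norm_norm, Real.norm_eq_abs, abs_of_nonneg (hF0 s hs0)]
      exact hF s hs0
    rw [integral_const_mul] at this
    exact (le_abs_self _).trans (this.trans (mul_le_of_le_one_right hC.le (hm n)))
  constructor
  · refine le_of_tendsto' ((hl x).const_mul _) fun n => ?_
    rw [mul_left_comm]
    refine mul_le_mul_of_nonneg_left ?_ hk0.le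
    exact aux1 n _ d (fun s hs => by positivity) (fun s hs => (HC s hs x).1)
  · refine le_of_tendsto' ((hg x).norm.const_mul _) fun n => ?_
    rw [norm_smul, mul_left_comm, Real.norm_eq_abs, abs_of_pos hk0]
    refine mul_le_mul_of_nonneg_left ?_ hk0.le
    exact aux n _ (d+1) (fun s hs => (HC s hs x).2)

lemma stableP_lintegral (d : ℕ) (α : ℝ) (h1 : 1 < α) (h2 : α < 2) (t : ℝ) (ht : 0 < t) :
    ∫⁻ x, ENNReal.ofReal (stableP d α t x) ≤ 1 := by
  obtain ⟨η, hf, hm, ha, hl, hg⟩ := stable_approx d α h1 h2 t ht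
  have hpi := Real.pi_pos
  set k := ((2 * Real.pi) ^ (-(d : ℝ)) : ℝ) with hk
  have hk0 : 0 < k := by positivity
  have e1 : ∀ x, ENNReal.ofReal (stableP d α t x) = liminf (fun n => ENNReal.ofReal (k *
        ∫ s, (Real.pi/s)^((d:ℝ)/2) * Real.exp (-(‖x‖^2/(4*s))) ∂(η n))) atTop := fun x =>
    ((ENNReal.continuous_ofReal.tendsto _).comp (hl x)).liminf_eq.symm
  simp_rw [e1]
  have hmeas2 : Measurable (fun p : EuclideanSpace ℝ (Fin d) × ℝ =>
      (Real.pi/p.2)^((d:ℝ)/2) * Real.exp (-(‖p.1‖^2/(4*p.2)))) := by fun_prop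
  refine (lintegral_liminf_le' ?_).trans ?_
  · intro n
    have := hf n
    refine (Measurable.ennreal_ofReal (Measurable.const_mul ?_ k)).aemeasurable
    exact (StronglyMeasurable.integral_prod_right
      (f := fun (x : EuclideanSpace ℝ (Fin d)) s => (Real.pi/s)^((d:ℝ)/2) * Real.exp (-(‖x‖^2/(4*s))))
      hmeas2.stronglyMeasurable).measurable
  · refine liminf_le_of_le (by isBoundedDefault) fun b hb => ?_
    obtain ⟨n, hn⟩ := hb.exists
    refine hn.trans ?_
    have := hf n
    obtain ⟨a, ha0, ha1⟩ := ha n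
    have e2 : ∀ x : EuclideanSpace ℝ (Fin d), ENNReal.ofReal (k * ∫ s, (Real.pi/s)^((d:ℝ)/2) * Real.exp (-(‖x‖^2/(4*s))) ∂(η n))
        ≤ ∫⁻ s, ENNReal.ofReal (k * ((Real.pi/s)^((d:ℝ)/2) * Real.exp (-(‖x‖^2/(4*s))))) ∂(η n) := by
      intro x
      rw [← integral_const_mul]
      refine (ENNReal.ofReal_le_ofReal (le_abs_self _)).trans ?_
      rw [← Real.norm_eq_abs, ofReal_norm]
      refine (enorm_integral_le_lintegral_enorm _).trans (lintegral_mono_ae ?_)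
      filter_upwards [ha1] with s hs
      have hs0 := ha0.trans_le hs
      rw [← ofReal_norm, Real.norm_eq_abs, abs_of_nonneg (by positivity)]
    refine (lintegral_mono e2).trans ?_
    rw [lintegral_lintegral_swap]
    · have e3 : ∀ᵐ s ∂(η n), ∫⁻ x : EuclideanSpace ℝ (Fin d), ENNReal.ofReal (k * ((Real.pi/s)^((d:ℝ)/2) * Real.exp (-(‖x‖^2/(4*s))))) = 1 := by
        filter_upwards [ha1] with s hs
        have hs0 := ha0.trans_le hs
        have hb : 0 < (4*s)⁻¹ := by positivity
        have hi := (gauss_integrable (d := d) _ hb).1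
        have hv := GaussianFourier.integral_rexp_neg_mul_sq_norm (V := EuclideanSpace ℝ (Fin d)) hb
        have hc : ∀ x : EuclideanSpace ℝ (Fin d), -(‖x‖^2/(4*s)) = -((4*s)⁻¹ * ‖x‖^2) := by
          intro x; rw [div_eq_inv_mul]
        simp_rw [hc]
        rw [← ofReal_integral_eq_lintegral_ofReal ((hi.const_mul _).const_mul _)
          (ae_of_all _ fun x => by positivity)]
        rw [integral_const_mul, integral_const_mul]
        simp_rw [neg_mul] at hv
        rw [hv]
        have : k * ((Real.pi/s)^((d:ℝ)/2) * (Real.pi/(4*s)⁻¹)^((Module.finrank ℝ (EuclideanSpace ℝ (Fin d)):ℝ)/2)) = 1 := by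
          rw [finrank_euclideanSpace_fin, ← Real.mul_rpow (by positivity) (by positivity)]
          rw [show Real.pi/s * (Real.pi/(4*s)⁻¹) = (2*Real.pi)^(2:ℝ) by rw [Real.rpow_two]; field_simp; ring]
          rw [← Real.rpow_mul (by positivity), hk, ← Real.rpow_add (by positivity)]
          rw [show -(d:ℝ) + 2 * ((d:ℝ)/2) = 0 by ring, Real.rpow_zero]
        rw [this, ENNReal.ofReal_one]
      rw [lintegral_congr_ae e3, lintegral_one]
      have := hm n
      rw [measureReal_def] at this
      exact (ENNReal.toReal_le_toReal (measure_ne_top _ _) ENNReal.one_ne_top).1 (by simpa using this)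
    · exact (Measurable.ennreal_ofReal (hmeas2.const_mul k)).aemeasurable

lemma stableG_scale (d : ℕ) (α : ℝ) (h1 : 1 < α) : ∃ A : ℝ, 0 < A ∧
    ∀ t : ℝ, 0 < t → ∀ x : EuclideanSpace ℝ (Fin d),
      ‖stableG d α t x‖ ≤ A * t^(-(((d:ℝ)+1)/α)) := by
  have hpi := Real.pi_pos
  set k := ((2 * Real.pi) ^ (-(d : ℝ)) : ℝ) with hk
  have hk0 : 0 < k := by positivity
  set M := ∫ ξ : EuclideanSpace ℝ (Fin d), ‖ξ‖ * Real.exp (-(1*‖ξ‖^α)) with hM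
  have hM0 : 0 ≤ M := integral_nonneg fun ξ => by positivity
  refine ⟨k * (M+1), by positivity, fun t ht x => ?_⟩
  obtain ⟨i1, i2⟩ := stretched_integrable (d := d) α h1.le t ht
  set c := t^(1/α) with hc
  have hc0 : 0 < c := Real.rpow_pos_of_pos ht _
  have hca : c^α = t := by rw [hc, ← Real.rpow_mul ht.le, one_div_mul_cancel (by linarith), Real.rpow_one]
  have hsc : ∫ ξ : EuclideanSpace ℝ (Fin d), ‖ξ‖ * Real.exp (-(t*‖ξ‖^α)) = t^(-(((d:ℝ)+1)/α)) * M := by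
    have h := Measure.integral_comp_smul_of_nonneg (volume : Measure (EuclideanSpace ℝ (Fin d)))
      (fun ξ : EuclideanSpace ℝ (Fin d) => ‖ξ‖ * Real.exp (-(1*‖ξ‖^α))) c (hR := hc0.le)
    have e : ∀ ξ : EuclideanSpace ℝ (Fin d), ‖c • ξ‖ * Real.exp (-(1*‖c • ξ‖^α)) = c * (‖ξ‖ * Real.exp (-(t*‖ξ‖^α))) := by
      intro ξ
      rw [norm_smul, Real.norm_eq_abs, abs_of_pos hc0, Real.mul_rpow hc0.le (norm_nonneg _), hca, one_mul, mul_assoc]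
    simp_rw [e] at h
    rw [integral_const_mul, finrank_euclideanSpace_fin, smul_eq_mul, ← hM] at h
    have e2 : t^(-(((d:ℝ)+1)/α)) = c⁻¹ * (c^d)⁻¹ := by
      rw [← mul_inv, ← pow_succ', ← Real.rpow_natCast, hc, ← Real.rpow_mul ht.le, ← Real.rpow_neg ht.le]
      congr 1; push_cast; ring
    rw [e2, mul_assoc, ← h, ← mul_assoc, inv_mul_cancel₀ hc0.ne', one_mul]
  unfold stableG
  rw [norm_smul, Real.norm_eq_abs, abs_of_pos hk0, mul_assoc]
  refine mul_le_mul_of_nonneg_left ?_ hk0.le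
  have : ‖∫ ξ, (-(Real.sin ⟪ξ, x⟫ * Real.exp (-(t * ‖ξ‖^α)))) • ξ‖ ≤ ∫ ξ : EuclideanSpace ℝ (Fin d), ‖ξ‖ * Real.exp (-(t*‖ξ‖^α)) := by
    refine norm_integral_le_of_norm_le i2 (ae_of_all _ fun ξ => ?_)
    rw [norm_smul, norm_neg, norm_mul, Real.norm_eq_abs (Real.exp _), abs_of_pos (Real.exp_pos _), mul_comm]
    gcongr
    exact mul_le_of_le_one_left (Real.exp_pos _).le (Real.abs_sin_le_one _)
  rw [hsc] at this
  have hp := Real.rpow_nonneg ht.le (-(((d:ℝ)+1)/α))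
  nlinarith


lemma stableP_meas (d : ℕ) (α : ℝ) :
    StronglyMeasurable (fun z : ℝ × EuclideanSpace ℝ (Fin d) => stableP d α z.1 z.2) := by
  unfold stableP
  have h : StronglyMeasurable (fun z : ℝ × EuclideanSpace ℝ (Fin d) =>
      ∫ ξ : EuclideanSpace ℝ (Fin d),
      Complex.exp (-Complex.I * ((⟪ξ, z.2⟫ : ℝ) : ℂ)) *
        Complex.exp (-(z.1 : ℂ) * ((‖ξ‖ ^ α : ℝ) : ℂ))) := by
    refine StronglyMeasurable.integral_prod_right (f := fun (z : ℝ × EuclideanSpace ℝ (Fin d))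
      (ξ : EuclideanSpace ℝ (Fin d)) => Complex.exp (-Complex.I * ((⟪ξ, z.2⟫ : ℝ) : ℂ)) *
        Complex.exp (-(z.1 : ℂ) * ((‖ξ‖ ^ α : ℝ) : ℂ))) ?_
    refine Measurable.stronglyMeasurable ?_
    unfold Function.uncurry
    fun_prop
  exact (Complex.measurable_re.comp (h.measurable.const_mul _)).stronglyMeasurable

lemma stableG_meas (d : ℕ) (α : ℝ) :
    StronglyMeasurable (fun z : ℝ × EuclideanSpace ℝ (Fin d) => stableG d α z.1 z.2) := by
  unfold stableG
  have h : StronglyMeasurable (fun z : ℝ × EuclideanSpace ℝ (Fin d) =>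
      ∫ ξ : EuclideanSpace ℝ (Fin d), (-(Real.sin ⟪ξ, z.2⟫ * Real.exp (-(z.1 * ‖ξ‖^α)))) • ξ) := by
    refine StronglyMeasurable.integral_prod_right (f := fun (z : ℝ × EuclideanSpace ℝ (Fin d))
      (ξ : EuclideanSpace ℝ (Fin d)) => (-(Real.sin ⟪ξ, z.2⟫ * Real.exp (-(z.1 * ‖ξ‖^α)))) • ξ) ?_
    refine Measurable.stronglyMeasurable ?_
    unfold Function.uncurry
    fun_prop
  exact h.const_smul ((2 * Real.pi) ^ (-(d : ℝ)) : ℝ)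

lemma decay_bound (m : ℕ) (v A B r : ℝ) (hv : 0 ≤ v) (hr : 0 ≤ r) (h1 : v ≤ A) (h2 : r^m*v ≤ B) :
    v ≤ 2^m * (A+B) * (1+r)^(-(m:ℝ)) := by
  have hB : 0 ≤ B := le_trans (by positivity) h2
  have hA : 0 ≤ A := hv.trans h1
  rw [Real.rpow_neg (by positivity), Real.rpow_natCast, ← div_eq_mul_inv, le_div_iff₀ (by positivity)]
  rcases le_total r 1 with h | h
  · have : (1+r)^m ≤ 2^m := by gcongr; linarith
    calc v * (1+r)^m ≤ A * 2^m := by gcongr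
      _ ≤ 2^m * (A+B) := by nlinarith [pow_pos (two_pos : (0:ℝ)<2) m, mul_nonneg (pow_pos (two_pos : (0:ℝ)<2) m).le hB]
  · have : (1+r)^m ≤ (2*r)^m := by gcongr; linarith
    calc v * (1+r)^m ≤ v * (2*r)^m := by gcongr
      _ = 2^m * (r^m * v) := by rw [mul_pow]; ring
      _ ≤ 2^m * B := by gcongr
      _ ≤ 2^m * (A+B) := by gcongr; linarith

lemma stableG_bd (d : ℕ) (α : ℝ) (h1 : 1 < α) (h2 : α < 2) : ∃ K : ℝ, 0 < K ∧
    ∀ t : ℝ, 0 < t → ∀ x : EuclideanSpace ℝ (Fin d),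
      ‖stableG d α t x‖ ≤ K * (t^(-(1/α)))^(d+1) *
        (1 + ‖(t^(-(1/α)) : ℝ) • x‖)^(-((d+1 : ℕ):ℝ)) := by
  obtain ⟨A, hA, hA'⟩ := stableG_scale d α h1
  obtain ⟨B, hB, hB'⟩ := stable_decay d α h1 h2
  refine ⟨2^(d+1) * (A+B), by positivity, fun t ht x => ?_⟩
  have hc : 0 < t^(-(1/α)) := Real.rpow_pos_of_pos ht _
  have e : t^(-(((d:ℝ)+1)/α)) = (t^(-(1/α)))^(d+1) := by
    rw [← Real.rpow_natCast, ← Real.rpow_mul ht.le]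
    congr 1
    push_cast
    ring
  have g1 := hA' t ht x
  rw [e] at g1
  have g2 := (hB' t ht x).2
  have := decay_bound (d+1) ‖stableG d α t x‖ (A * (t^(-(1/α)))^(d+1)) (B * (t^(-(1/α)))^(d+1))
    ‖(t^(-(1/α)) : ℝ) • x‖ (norm_nonneg _) (norm_nonneg _) g1 (by
      rw [norm_smul, Real.norm_of_nonneg hc.le, mul_pow]
      calc _ = (‖x‖^(d+1) * ‖stableG d α t x‖) * (t^(-(1/α)))^(d+1) := by ring
        _ ≤ _ := by gcongr)
  calc _ ≤ _ := this
    _ = _ := by ring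

lemma one_add_int (d : ℕ) : Integrable (fun x : EuclideanSpace ℝ (Fin d) => (1+‖x‖)^(-((d+1 : ℕ):ℝ))) :=
  integrable_one_add_norm (by simp)

lemma stableG_L1 (d : ℕ) (α : ℝ) (h1 : 1 < α) (h2 : α < 2) : ∃ K : ℝ, 0 < K ∧
    ∀ t : ℝ, 0 < t → Integrable (stableG d α t) ∧ ∫ x, ‖stableG d α t x‖ ≤ K * t^(-(1/α)) := by
  obtain ⟨K, hK, hb⟩ := stableG_bd d α h1 h2
  have hJ : 0 ≤ ∫ x : EuclideanSpace ℝ (Fin d), (1+‖x‖)^(-((d+1 : ℕ):ℝ)) :=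
    integral_nonneg fun x => by positivity
  refine ⟨K * ((∫ x : EuclideanSpace ℝ (Fin d), (1+‖x‖)^(-((d+1 : ℕ):ℝ))) + 1), by positivity, fun t ht => ?_⟩
  have hc : 0 < t^(-(1/α)) := Real.rpow_pos_of_pos ht _
  have hi := ((one_add_int d).comp_smul hc.ne').const_mul (K * (t^(-(1/α)))^(d+1))
  have hm : AEStronglyMeasurable (stableG d α t) volume :=
    ((stableG_meas d α).comp_measurable (measurable_const.prodMk measurable_id)).aestronglyMeasurable
  have hG : Integrable (stableG d α t) := hi.mono' hm (ae_of_all _ fun x => hb t ht x)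
  refine ⟨hG, ?_⟩
  calc _ ≤ ∫ x : EuclideanSpace ℝ (Fin d), K * (t^(-(1/α)))^(d+1) * (1 + ‖(t^(-(1/α)) : ℝ) • x‖)^(-((d+1 : ℕ):ℝ)) :=
        integral_mono hG.norm hi fun x => hb t ht x
    _ = K * (∫ x : EuclideanSpace ℝ (Fin d), (1+‖x‖)^(-((d+1 : ℕ):ℝ))) * t^(-(1/α)) := by
        rw [integral_const_mul, Measure.integral_comp_smul_of_nonneg (μ := volume)
          (f := fun x : EuclideanSpace ℝ (Fin d) => (1+‖x‖)^(-((d+1 : ℕ):ℝ))) _ (hR := hc.le)]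
        simp only [finrank_euclideanSpace, Fintype.card_fin, smul_eq_mul]
        rw [pow_succ]
        field_simp
    _ ≤ _ := by gcongr; linarith

lemma exp_int (l : ℝ) (hl : 0 < l) :
    Integrable (fun t => Real.exp (-(l*t))) (volume.restrict (Set.Ioi (0:ℝ))) := by
  have := exp_neg_integrableOn_Ioi 0 hl
  simpa [IntegrableOn] using this

lemma rpow_exp_int (α : ℝ) (h1 : 1 < α) (l : ℝ) (hl : 0 < l) :
    Integrable (fun t => Real.exp (-(l*t)) * t^(-(1/α))) (volume.restrict (Set.Ioi (0:ℝ))) := by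
  have h : -1 < -(1/α) := by
    have : 1/α < 1 := by rw [div_lt_one (by linarith)]; exact h1
    linarith
  have := integrableOn_rpow_mul_exp_neg_mul_rpow h one_pos hl
  simp only [Real.rpow_one] at this
  refine this.congr (ae_of_all _ fun t => ?_)
  simp only [neg_mul]
  ring

lemma stableP_L1 (d : ℕ) (α : ℝ) (h1 : 1 < α) (h2 : α < 2) (t : ℝ) (ht : 0 < t) :
    Integrable (stableP d α t) ∧ ∫ x, ‖stableP d α t x‖ ≤ 1 := by
  have hm : AEStronglyMeasurable (stableP d α t) volume :=
    ((stableP_meas d α).comp_measurable (measurable_const.prodMk measurable_id)).aestronglyMeasurable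
  have hn : ∀ x, ‖stableP d α t x‖ = stableP d α t x := fun x =>
    Real.norm_of_nonneg (stableP_nonneg d α h1 h2 t ht x)
  have hl := stableP_lintegral d α h1 h2 t ht
  refine ⟨⟨hm, ?_⟩, ?_⟩
  · rw [hasFiniteIntegral_iff_norm]
    simp_rw [hn]
    exact hl.trans_lt ENNReal.one_lt_top
  · simp_rw [hn]
    rw [integral_eq_lintegral_of_nonneg_ae (ae_of_all _ fun x => stableP_nonneg d α h1 h2 t ht x) hm]
    exact ENNReal.toReal_le_of_le_ofReal zero_le_one (by simpa using hl)

lemma prodP_int (d : ℕ) (α : ℝ) (h1 : 1 < α) (h2 : α < 2) (l : ℝ) (hl : 0 < l) :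
    Integrable (fun z : ℝ × EuclideanSpace ℝ (Fin d) => Real.exp (-(l*z.1)) * stableP d α z.1 z.2)
      ((volume.restrict (Set.Ioi (0:ℝ))).prod volume) := by
  have hm : StronglyMeasurable (fun z : ℝ × EuclideanSpace ℝ (Fin d) =>
      Real.exp (-(l*z.1)) * stableP d α z.1 z.2) :=
    (Measurable.stronglyMeasurable (by fun_prop)).mul (stableP_meas d α)
  rw [integrable_prod_iff hm.aestronglyMeasurable]
  constructor
  · filter_upwards [ae_restrict_mem measurableSet_Ioi] with t ht
    exact (stableP_L1 d α h1 h2 t ht).1.const_mul _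
  · refine (exp_int l hl).mono' hm.norm.integral_prod_right.aestronglyMeasurable ?_
    filter_upwards [ae_restrict_mem measurableSet_Ioi] with t ht
    simp only [norm_mul]
    rw [integral_const_mul, norm_mul]
    simp only [Real.norm_eq_abs, Real.abs_exp]
    have := (stableP_L1 d α h1 h2 t ht).2
    simp only [Real.norm_eq_abs] at this
    rw [abs_of_nonneg (integral_nonneg fun x => abs_nonneg _)]
    exact mul_le_of_le_one_right (Real.exp_pos _).le this

lemma prodG_int (d : ℕ) (α : ℝ) (h1 : 1 < α) (h2 : α < 2) (l : ℝ) (hl : 0 < l) :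
    Integrable (fun z : ℝ × EuclideanSpace ℝ (Fin d) => Real.exp (-(l*z.1)) • stableG d α z.1 z.2)
      ((volume.restrict (Set.Ioi (0:ℝ))).prod volume) := by
  obtain ⟨K, hK, hb⟩ := stableG_L1 d α h1 h2
  have hm : StronglyMeasurable (fun z : ℝ × EuclideanSpace ℝ (Fin d) =>
      Real.exp (-(l*z.1)) • stableG d α z.1 z.2) :=
    StronglyMeasurable.smul (f := fun z : ℝ × EuclideanSpace ℝ (Fin d) => Real.exp (-(l*z.1)))
      (Measurable.stronglyMeasurable (by fun_prop)) (stableG_meas d α)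
  rw [integrable_prod_iff hm.aestronglyMeasurable]
  constructor
  · filter_upwards [ae_restrict_mem measurableSet_Ioi] with t ht
    exact (hb t ht).1.smul (Real.exp (-(l*t)))
  · refine ((rpow_exp_int α h1 l hl).const_mul K).mono' hm.norm.integral_prod_right.aestronglyMeasurable ?_
    filter_upwards [ae_restrict_mem measurableSet_Ioi] with t ht
    simp only [norm_smul]
    rw [integral_const_mul, norm_mul, Real.norm_of_nonneg (integral_nonneg fun x => norm_nonneg _)]
    simp only [Real.norm_eq_abs, Real.abs_exp]
    calc _ ≤ Real.exp (-(l*t)) * (K * t^(-(1/α))) := by gcongr; exact (hb t ht).2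
      _ = _ := by ring

/-- gradient of the resolvent kernel -/
noncomputable def resG (d : ℕ) (α : ℝ) (l : ℝ) (x : EuclideanSpace ℝ (Fin d)) :
    EuclideanSpace ℝ (Fin d) :=
  ∫ t in Set.Ioi (0 : ℝ), Real.exp (-(l * t)) • stableG d α t x

lemma resKer_int (d : ℕ) (α : ℝ) (h1 : 1 < α) (h2 : α < 2) (l : ℝ) (hl : 0 < l) :
    Integrable (resKer d α l) :=
  (prodP_int d α h1 h2 l hl).integral_prod_right

lemma resG_int (d : ℕ) (α : ℝ) (h1 : 1 < α) (h2 : α < 2) (l : ℝ) (hl : 0 < l) :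
    Integrable (resG d α l) :=
  (prodG_int d α h1 h2 l hl).integral_prod_right

lemma resKer_grad (d : ℕ) (α : ℝ) (h1 : 1 < α) (h2 : α < 2) (l : ℝ) (hl : 0 < l)
    (x : EuclideanSpace ℝ (Fin d)) (hx : x ≠ 0) :
    HasGradientAt (resKer d α l) (resG d α l x) x := by
  obtain ⟨B, hB, hb⟩ := stable_decay d α h1 h2
  have hx' : 0 < ‖x‖ := norm_pos_iff.2 hx
  have hmP : ∀ x, AEStronglyMeasurable (fun t => Real.exp (-(l*t)) * stableP d α t x)
      (volume.restrict (Set.Ioi (0:ℝ))) := fun x =>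
    ((Measurable.stronglyMeasurable (by fun_prop)).mul
      ((stableP_meas d α).comp_measurable (measurable_id.prodMk measurable_const))).aestronglyMeasurable
  refine hasGradientAt_integral (S := Metric.ball x (‖x‖/2))
    (F := fun x t => Real.exp (-(l*t)) * stableP d α t x)
    (G := fun x t => Real.exp (-(l*t)) • stableG d α t x)
    (bound := fun t => Real.exp (-(l*t)) * (B / (‖x‖/2)^(d+1)))
    (Metric.ball_mem_nhds _ (by positivity)) ?_ ?_ ?_ ?_ ?_ ?_
  · exact Eventually.of_forall hmP
  · refine ((exp_int l hl).mul_const (B / ‖x‖^d)).mono' (hmP x) ?_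
    filter_upwards [ae_restrict_mem measurableSet_Ioi] with t ht
    rw [norm_mul, Real.norm_of_nonneg (Real.exp_pos _).le,
      Real.norm_of_nonneg (stableP_nonneg d α h1 h2 t ht x)]
    gcongr
    rw [le_div_iff₀ (by positivity), mul_comm]
    exact (hb t ht x).1
  · exact (StronglyMeasurable.smul (f := fun t : ℝ => Real.exp (-(l*t)))
      (Measurable.stronglyMeasurable (by fun_prop)) ((stableG_meas d α).comp_measurable (measurable_id.prodMk measurable_const))).aestronglyMeasurable
  · filter_upwards [ae_restrict_mem measurableSet_Ioi] with t ht z hz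
    rw [norm_smul, Real.norm_of_nonneg (Real.exp_pos _).le]
    gcongr
    rw [le_div_iff₀ (by positivity), mul_comm]
    refine le_trans ?_ (hb t ht z).2
    gcongr
    rw [Metric.mem_ball, dist_eq_norm] at hz
    have := norm_sub_norm_le x z
    rw [norm_sub_rev] at this
    linarith
  · exact (exp_int l hl).mul_const _
  · filter_upwards [ae_restrict_mem measurableSet_Ioi] with t ht z hz
    have := (stable_hasGradient d α h1.le t ht z).hasFDerivAt.const_mul (Real.exp (-(l*t)))
    rw [hasGradientAt_iff_hasFDerivAt, map_smul]
    exact this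

lemma resKer_grad_ae (d : ℕ) (hd : 1 ≤ d) (α : ℝ) (h1 : 1 < α) (h2 : α < 2) (l : ℝ) (hl : 0 < l) :
    gradient (resKer d α l) =ᵐ[volume] resG d α l := by
  have : Nonempty (Fin d) := ⟨⟨0, hd⟩⟩
  have : Nontrivial (EuclideanSpace ℝ (Fin d)) := inferInstance
  have h0 : ∀ᵐ x : EuclideanSpace ℝ (Fin d), x ≠ 0 := by
    simp [ae_iff]
  filter_upwards [h0] with x hx
  exact (resKer_grad d α h1 h2 l hl x hx).gradient

lemma conv_C0 {d : ℕ} {F : Type*} [NormedAddCommGroup F] [NormedSpace ℝ F]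
    (k : EuclideanSpace ℝ (Fin d) → F) (hk : Integrable k) (f : EuclideanSpace ℝ (Fin d) → ℝ)
    (hf : Continuous f) (hf0 : Tendsto f (cocompact (EuclideanSpace ℝ (Fin d))) (𝓝 0))
    (M : ℝ) (hM : ∀ x, |f x| ≤ M) :
    Continuous (fun x => ∫ y, f (x - y) • k y) ∧
    Tendsto (fun x => ∫ y, f (x - y) • k y) (cocompact (EuclideanSpace ℝ (Fin d))) (𝓝 0) ∧
    ∀ x, ‖∫ y, f (x - y) • k y‖ ≤ M * ∫ y, ‖k y‖ := by
  have hm : ∀ x, AEStronglyMeasurable (fun y => f (x - y) • k y) volume := fun x =>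
    (Continuous.aestronglyMeasurable (by fun_prop)).smul hk.1
  have hb : ∀ x y, ‖f (x - y) • k y‖ ≤ M * ‖k y‖ := fun x y => by
    rw [norm_smul]
    gcongr
    exact hM _
  have hi := hk.norm.const_mul M
  refine ⟨?_, ?_, fun x => ?_⟩
  · refine continuous_of_dominated hm (fun x => ae_of_all _ (hb x)) hi (ae_of_all _ fun y => ?_)
    fun_prop
  · have : (0 : F) = ∫ y : EuclideanSpace ℝ (Fin d), (0 : ℝ) • k y := by simp
    rw [this]
    have : (cocompact (EuclideanSpace ℝ (Fin d))).IsCountablyGenerated := by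
      rw [← Metric.cobounded_eq_cocompact, ← comap_norm_atTop]
      infer_instance
    refine tendsto_integral_filter_of_dominated_convergence _ (Eventually.of_forall hm)
      (Eventually.of_forall fun x => ae_of_all _ (hb x)) hi (ae_of_all _ fun y => ?_)
    refine Tendsto.smul_const ?_ _
    exact hf0.comp (Homeomorph.subRight y).isClosedEmbedding.tendsto_cocompact
  · calc _ ≤ ∫ y, M * ‖k y‖ := norm_integral_le_of_norm_le hi (ae_of_all _ (hb x))
      _ = _ := integral_const_mul _ _

lemma conv_swap {d : ℕ} {F : Type*} [NormedAddCommGroup F] [NormedSpace ℝ F]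
    (k : EuclideanSpace ℝ (Fin d) → F) (f : EuclideanSpace ℝ (Fin d) → ℝ)
    (x : EuclideanSpace ℝ (Fin d)) : ∫ y, f y • k (x - y) = ∫ y, f (x - y) • k y := by
  rw [← integral_sub_left_eq_self (fun y => f y • k (x - y)) volume x]
  simp

lemma stableP_meas1 (d : ℕ) (α t : ℝ) : StronglyMeasurable (stableP d α t) := by
  have h : Measurable (fun x : EuclideanSpace ℝ (Fin d) => (t, x)) := measurable_prodMk_left
  have h3 := (stableP_meas d α).comp_measurable h
  exact h3

lemma stableG_meas1 (d : ℕ) (α t : ℝ) : StronglyMeasurable (stableG d α t) := by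
  have h : Measurable (fun x : EuclideanSpace ℝ (Fin d) => (t, x)) := measurable_prodMk_left
  have h3 := (stableG_meas d α).comp_measurable h
  exact h3

lemma rpow_shift (m : ℕ) (a b c : ℝ) (ha : 0 ≤ a) (hb : 0 ≤ b) (_hc : 0 ≤ c) (h : 1 + b ≤ (1+c)*(1+a)) :
    (1+a)^(-(m:ℝ)) ≤ (1+c)^m * (1+b)^(-(m:ℝ)) := by
  rw [Real.rpow_neg (by positivity), Real.rpow_neg (by positivity), Real.rpow_natCast,
      Real.rpow_natCast, ← div_eq_mul_inv, inv_eq_one_div, div_le_div_iff₀ (by positivity) (by positivity),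
      one_mul, ← mul_pow]
  gcongr

/-- gradient of the semigroup -/
lemma semigroup_grad (d : ℕ) (α : ℝ) (h1 : 1 < α) (h2 : α < 2) (t : ℝ) (ht : 0 < t)
    (f : EuclideanSpace ℝ (Fin d) → ℝ) (hf : Continuous f) (M : ℝ) (hM : ∀ x, |f x| ≤ M)
    (x : EuclideanSpace ℝ (Fin d)) :
    HasGradientAt (fun x => ∫ y, f (x - y) • stableP d α t y)
      (∫ y, f (x - y) • stableG d α t y) x := by
  obtain ⟨K, hK, hb⟩ := stableG_bd d α h1 h2
  have hM0 : 0 ≤ M := (abs_nonneg _).trans (hM 0)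
  have e1 : (fun x => ∫ y, f (x - y) • stableP d α t y) =
      fun x => ∫ y, f y • stableP d α t (x - y) :=
    funext fun x => (conv_swap (stableP d α t) f x).symm
  rw [e1, ← conv_swap (stableG d α t) f x]
  obtain ⟨c, hc⟩ : ∃ c : ℝ, c = t^(-(1/α)) := ⟨_, rfl⟩
  have hc0 : 0 < c := hc ▸ Real.rpow_pos_of_pos ht _
  have hPm := stableP_meas1 d α t
  have hGm := stableG_meas1 d α t
  have hms : ∀ x : EuclideanSpace ℝ (Fin d), Measurable fun y => x - y := fun x => by fun_prop
  have hmP : ∀ x, AEStronglyMeasurable (fun y => f y • stableP d α t (x - y)) volume := fun x =>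
    (hf.stronglyMeasurable.smul (hPm.comp_measurable (hms x))).aestronglyMeasurable
  refine hasGradientAt_integral (S := Metric.ball x 1)
    (F := fun x y => f y • stableP d α t (x - y))
    (G := fun x y => f y • stableG d α t (x - y))
    (bound := fun y => M * (K * c^(d+1) * ((1+c)^(d+1) * (1 + ‖c • (x - y)‖)^(-((d+1 : ℕ):ℝ)))))
    (Metric.ball_mem_nhds _ one_pos) (Eventually.of_forall hmP) ?_ ?_ ?_ ?_ ?_
  · refine (((stableP_L1 d α h1 h2 t ht).1.comp_sub_left x).norm.const_mul M).mono' (hmP x)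
      (ae_of_all _ fun y => ?_)
    rw [norm_smul]
    gcongr
    exact hM y
  · exact (hf.stronglyMeasurable.smul (hGm.comp_measurable (hms x))).aestronglyMeasurable
  · refine ae_of_all _ fun y z hz => ?_
    rw [norm_smul]
    have hz' : ‖x - z‖ < 1 := by rwa [Metric.mem_ball, dist_eq_norm, norm_sub_rev] at hz
    gcongr
    · exact hM y
    refine (hb t ht (z - y)).trans ?_
    rw [← hc]
    gcongr
    refine rpow_shift (d+1) _ _ _ (norm_nonneg _) (norm_nonneg _) hc0.le ?_
    have e : c • (x - y) = c • (x - z) + c • (z - y) := by rw [← smul_add]; congr 1; abel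
    have i1 : ‖c • (x - z)‖ ≤ c := by
      rw [norm_smul, Real.norm_of_nonneg hc0.le]; nlinarith
    have i2 := norm_add_le (c • (x - z)) (c • (z - y))
    rw [e]
    nlinarith [norm_nonneg (c • (z - y))]
  · have := ((one_add_int d).comp_smul hc0.ne').comp_sub_left x
    exact (((this.const_mul _).const_mul _)).const_mul _
  · refine ae_of_all _ fun y z _ => ?_
    have h := (stable_hasGradient d α h1.le t ht (z - y)).hasFDerivAt
    rw [hasGradientAt_iff_hasFDerivAt, map_smul]
    have h3 : HasFDerivAt (fun z => stableP d α t (z - y))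
        ((InnerProductSpace.toDual ℝ (EuclideanSpace ℝ (Fin d))) (stableG d α t (z - y))) z := by
      rw [hasFDerivAt_comp_sub]
      exact h
    exact h3.const_smul (f y)

lemma fub_int {d : ℕ} {F : Type*} [NormedAddCommGroup F] [NormedSpace ℝ F]
    {μ : Measure ℝ} [SFinite μ] (k : ℝ × EuclideanSpace ℝ (Fin d) → F) (hk : Integrable k (μ.prod volume))
    (f : EuclideanSpace ℝ (Fin d) → ℝ) (hf : Continuous f) (M : ℝ) (hM : ∀ x, |f x| ≤ M)
    (x : EuclideanSpace ℝ (Fin d)) :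
    Integrable (fun z : ℝ × EuclideanSpace ℝ (Fin d) => f (x - z.2) • k z) (μ.prod volume) := by
  refine (hk.norm.const_mul M).mono' ((Continuous.aestronglyMeasurable (by fun_prop)).smul hk.1)
    (ae_of_all _ fun z => ?_)
  rw [norm_smul]
  gcongr
  exact hM _

lemma res_grad (d : ℕ) (α : ℝ) (h1 : 1 < α) (h2 : α < 2) (l : ℝ) (hl : 0 < l)
    (f : EuclideanSpace ℝ (Fin d) → ℝ) (hf : Continuous f) (M : ℝ) (hM : ∀ x, |f x| ≤ M)
    (x : EuclideanSpace ℝ (Fin d)) :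
    HasGradientAt (fun x => ∫ y, f (x - y) • resKer d α l y)
      (∫ y, f (x - y) • resG d α l y) x := by
  obtain ⟨K, hK, hb⟩ := stableG_L1 d α h1 h2
  have hM0 : 0 ≤ M := (abs_nonneg _).trans (hM 0)
  have hP := prodP_int d α h1 h2 l hl
  have hG := prodG_int d α h1 h2 l hl
  have iP := fun x => fub_int _ hP f hf M hM x
  have iG := fun x => fub_int _ hG f hf M hM x
  have eP : ∀ x, ∫ y, f (x - y) • resKer d α l y
      = ∫ t in Set.Ioi (0:ℝ), Real.exp (-(l*t)) * ∫ y, f (x - y) • stableP d α t y := by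
    intro x
    unfold resKer
    simp_rw [← integral_smul, ← integral_const_mul]
    rw [← integral_integral_swap (iP x)]
    refine integral_congr_ae (ae_of_all _ fun t => integral_congr_ae (ae_of_all _ fun y => ?_))
    simp only [smul_eq_mul]
    ring
  have eG : ∀ x, ∫ y, f (x - y) • resG d α l y
      = ∫ t in Set.Ioi (0:ℝ), Real.exp (-(l*t)) • ∫ y, f (x - y) • stableG d α t y := by
    intro x
    unfold resG
    simp_rw [← integral_smul]
    rw [← integral_integral_swap (iG x)]
    refine integral_congr_ae (ae_of_all _ fun t => integral_congr_ae (ae_of_all _ fun y => ?_))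
    simp only
    rw [smul_comm]
  simp_rw [eP]
  rw [eG]
  have jP : ∀ x, Integrable (fun t => Real.exp (-(l*t)) * ∫ y, f (x - y) • stableP d α t y)
      (volume.restrict (Set.Ioi (0:ℝ))) := by
    intro x
    refine (iP x).integral_prod_left.congr (ae_of_all _ fun t => ?_)
    simp only
    rw [← integral_const_mul]
    refine integral_congr_ae (ae_of_all _ fun y => ?_)
    simp only [smul_eq_mul]
    ring
  have jG : ∀ x, Integrable (fun t => Real.exp (-(l*t)) • ∫ y, f (x - y) • stableG d α t y)
      (volume.restrict (Set.Ioi (0:ℝ))) := by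
    intro x
    refine (iG x).integral_prod_left.congr (ae_of_all _ fun t => ?_)
    simp only
    rw [← integral_smul]
    refine integral_congr_ae (ae_of_all _ fun y => ?_)
    simp only
    rw [smul_comm]
  refine hasGradientAt_integral (S := Set.univ)
    (F := fun x t => Real.exp (-(l*t)) * ∫ y, f (x - y) • stableP d α t y)
    (G := fun x t => Real.exp (-(l*t)) • ∫ y, f (x - y) • stableG d α t y)
    (bound := fun t => (M * K) * (Real.exp (-(l*t)) * t^(-(1/α))))
    univ_mem (Eventually.of_forall fun x => (jP x).1) (jP x) (jG x).1 ?_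
    ((rpow_exp_int α h1 l hl).const_mul _) ?_
  · filter_upwards [ae_restrict_mem measurableSet_Ioi] with t ht z _
    rw [norm_smul, Real.norm_of_nonneg (Real.exp_pos _).le]
    have : ‖∫ y, f (z - y) • stableG d α t y‖ ≤ M * (K * t^(-(1/α))) := by
      calc _ ≤ ∫ y, M * ‖stableG d α t y‖ := by
            refine norm_integral_le_of_norm_le ((hb t ht).1.norm.const_mul M) (ae_of_all _ fun y => ?_)
            rw [norm_smul]
            gcongr
            exact hM _
        _ = M * ∫ y, ‖stableG d α t y‖ := integral_const_mul _ _
        _ ≤ _ := by gcongr; exact (hb t ht).2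
    calc _ ≤ Real.exp (-(l*t)) * (M * (K * t^(-(1/α)))) := by gcongr
      _ = _ := by ring
  · filter_upwards [ae_restrict_mem measurableSet_Ioi] with t ht z _
    have := (semigroup_grad d α h1 h2 t ht f hf M hM z).hasFDerivAt.const_mul (Real.exp (-(l*t)))
    rw [hasGradientAt_iff_hasFDerivAt, map_smul]
    exact this

/-- for `f ∈ C_0(ℝ^d)`, `R_λ f` is `C^1` with
`∇R_λ f(x) = ∫ ∇r_λ(x-y) f(y) dy`, both `R_λ f` and `∇R_λ f` vanish at infinity and are
continuous, and `‖R_λ f‖_∞ ≤ c‖f‖_∞`, `‖∇R_λ f‖_∞ ≤ c‖f‖_∞`. -/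
theorem stmt6 (d : ℕ) (hd : 1 ≤ d) (α : ℝ) (hα1 : 1 < α) (hα2 : α < 2)
    (l : ℝ) (hl : 0 < l) :
    ∃ c : ℝ, 0 < c ∧ ∀ f : EuclideanSpace ℝ (Fin d) → ℝ,
      Continuous f → Tendsto f (cocompact (EuclideanSpace ℝ (Fin d))) (𝓝 0) →
      ContDiff ℝ 1 (resOp d α l f) ∧
      (∀ x, gradient (resOp d α l f) x = ∫ y, f y • gradient (resKer d α l) (x - y)) ∧
      Continuous (resOp d α l f) ∧
      Tendsto (resOp d α l f) (cocompact (EuclideanSpace ℝ (Fin d))) (𝓝 0) ∧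
      Continuous (fun x => gradient (resOp d α l f) x) ∧
      Tendsto (fun x => gradient (resOp d α l f) x)
        (cocompact (EuclideanSpace ℝ (Fin d))) (𝓝 0) ∧
      (∀ x, |resOp d α l f x| ≤ c * ⨆ y, |f y|) ∧
      (∀ x, ‖gradient (resOp d α l f) x‖ ≤ c * ⨆ y, |f y|) := by
  have hiK := resKer_int d α hα1 hα2 l hl
  have hiG := resG_int d α hα1 hα2 l hl
  have n1 : 0 ≤ ∫ y, ‖resKer d α l y‖ := integral_nonneg fun _ => norm_nonneg _
  have n2 : 0 ≤ ∫ y, ‖resG d α l y‖ := integral_nonneg fun _ => norm_nonneg _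
  refine ⟨(∫ y, ‖resKer d α l y‖) + (∫ y, ‖resG d α l y‖) + 1, by positivity, fun f hf hf0 => ?_⟩
  have hbdd : BddAbove (Set.range fun y => |f y|) := by
    let f' : ZeroAtInftyContinuousMap (EuclideanSpace ℝ (Fin d)) ℝ := ⟨⟨f, hf⟩, hf0⟩
    obtain ⟨C, hC⟩ := (isBounded_iff_forall_norm_le.1 f'.isBounded_range)
    refine ⟨C, ?_⟩
    rintro _ ⟨y, rfl⟩
    exact hC (f y) ⟨y, rfl⟩
  have hM : ∀ x, |f x| ≤ ⨆ y, |f y| := fun x => le_ciSup hbdd x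
  have hM0 : 0 ≤ ⨆ y, |f y| := (abs_nonneg _).trans (hM 0)
  obtain ⟨k1, k2, k3⟩ := conv_C0 _ hiK f hf hf0 _ hM
  obtain ⟨g1, g2, g3⟩ := conv_C0 _ hiG f hf hf0 _ hM
  have eR : resOp d α l f = fun x => ∫ y, f (x - y) • resKer d α l y := by
    funext x
    unfold resOp
    rw [← conv_swap]
    simp only [smul_eq_mul, mul_comm]
  have hgr : ∀ x, HasGradientAt (resOp d α l f) (∫ y, f (x - y) • resG d α l y) x := by
    intro x
    rw [eR]
    exact res_grad d α hα1 hα2 l hl f hf _ hM x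
  have eG : (fun x => gradient (resOp d α l f) x) = fun x => ∫ y, f (x - y) • resG d α l y := by
    funext x
    exact (hgr x).gradient
  refine ⟨?_, ?_, ?_, ?_, ?_, ?_, ?_, ?_⟩
  · rw [contDiff_one_iff_fderiv]
    refine ⟨fun x => (hgr x).differentiableAt, ?_⟩
    have : fderiv ℝ (resOp d α l f) = fun x => (InnerProductSpace.toDual ℝ (EuclideanSpace ℝ (Fin d)))
        (∫ y, f (x - y) • resG d α l y) := by
      funext x
      exact (hgr x).hasFDerivAt.fderiv
    rw [this]
    exact (InnerProductSpace.toDual ℝ (EuclideanSpace ℝ (Fin d))).continuous.comp g1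
  · intro x
    rw [(hgr x).gradient, conv_swap]
    refine integral_congr_ae ?_
    filter_upwards [resKer_grad_ae d hd α hα1 hα2 l hl] with y hy
    rw [hy]
  · rw [eR]; exact k1
  · rw [eR]; exact k2
  · rw [eG]; exact g1
  · rw [eG]; exact g2
  · intro x
    rw [eR]
    refine (k3 x).trans ?_
    rw [mul_comm]
    gcongr
    linarith
  · intro x
    rw [(hgr x).gradient]
    refine (g3 x).trans ?_
    rw [mul_comm]
    gcongr
    linarith
end
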